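/- Let {u_β}_{β>0} be a family of solutions of the system (S_β) in Ω, with the nonlinearities f_{i,β} satisfying hypothesis (H), and assume the family is uniformly bounded in L^∞(Ω) (i.e. sup_β sup_i ‖u_{i,β}‖_{L^∞(Ω)} < ∞). Then for every open set Ω′ compactly contained in Ω and every α ∈ (0,1) there exists a constant C = C(Ω′,α) > 0, independent of β, such that ‖u_β‖_{C^{0,α}(Ω′)} ≤ C for all β > 0. -/

import Mathlib

open MeasureTheory Metric Filter Topology Set
open scoped ENNReal NNReal RealInnerProductSpace Classical

noncomputable section

/-- An `m`-decomposition of `d`: a strictly increasing vector of naturals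
`0 = a₀ < a₁ < ⋯ < a_m = d`. -/
structure Decomp (d m : ℕ) where
  pts : Fin (m + 1) → ℕ
  zero : pts 0 = 0
  last : pts (Fin.last m) = d
  mono : StrictMono pts

/-- `i` belongs to the group `I_h` (0-based: `a_h ≤ i < a_{h+1}`). -/
def Decomp.mem {d m : ℕ} (D : Decomp d m) (h : Fin m) (i : Fin d) : Prop :=
  D.pts h.castSucc ≤ (i : ℕ) ∧ (i : ℕ) < D.pts h.succ

/-- the set of couples belonging to different groups -/
def Decomp.K2 {d m : ℕ} (D : Decomp d m) (i j : Fin d) : Prop :=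
  ∃ h k : Fin m, h ≠ k ∧ D.mem h i ∧ D.mem k j

/-- the group `I_h` as a finset -/
def Decomp.grpSet {d m : ℕ} (D : Decomp d m) (h : Fin m) : Finset (Fin d) :=
  Finset.univ.filter fun i => D.pts h.castSucc ≤ (i : ℕ) ∧ (i : ℕ) < D.pts h.succ

/-- the pointwise Laplacian -/
def lapl {N : ℕ} (u : EuclideanSpace ℝ (Fin N) → ℝ) (x : EuclideanSpace ℝ (Fin N)) : ℝ :=
  ∑ i : Fin N, iteratedFDeriv ℝ 2 u x ![EuclideanSpace.single i 1, EuclideanSpace.single i 1]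

/-- assumptions on the coupling coefficients: symmetric, vanishing inside each group,
positive between different groups. -/
def CoefOK {d m : ℕ} (D : Decomp d m) (A : Fin d → Fin d → ℝ) : Prop :=
  (∀ i j, A i j = A j i) ∧
  (∀ i j, i ≠ j → (∃ h, D.mem h i ∧ D.mem h j) → A i j = 0) ∧
  (∀ i j, D.K2 i j → 0 < A i j)

/-- hypothesis (H) on the nonlinearities `f_{i,β}` -/
def HypH {N d m : ℕ} (D : Decomp d m) (Ω : Set (EuclideanSpace ℝ (Fin N))) (p : ℝ)
    (f : ℝ → Fin d → EuclideanSpace ℝ (Fin N) → (Fin d → ℝ) → ℝ) : Prop :=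
  if 1 ≤ p then
    ∀ K : Set (EuclideanSpace ℝ (Fin N) × (Fin d → ℝ)), IsCompact K → (∀ z ∈ K, z.1 ∈ Ω) →
      ∃ C : ℝ, ∀ β : ℝ, 0 < β → ∀ i : Fin d, ∀ z ∈ K, |f β i z.1 z.2| ≤ C
  else
    ∀ K : Set (EuclideanSpace ℝ (Fin N)), IsCompact K → K ⊆ Ω →
      ∃ C : ℝ, ∀ β : ℝ, 0 < β → ∀ h : Fin m, ∀ i : Fin d, D.mem h i → ∀ x ∈ K,
        ∀ s : Fin d → ℝ, |f β i x s| ≤ C * ∑ j ∈ D.grpSet h, |s j| ^ p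

/-- `u β` is a (classical) solution of the system `(S_β)` in `Ω`, for every `β > 0`. -/
def SolSys {N d : ℕ} (Ω : Set (EuclideanSpace ℝ (Fin N))) (p : ℝ)
    (A : Fin d → Fin d → ℝ)
    (f : ℝ → Fin d → EuclideanSpace ℝ (Fin N) → (Fin d → ℝ) → ℝ)
    (u : ℝ → Fin d → EuclideanSpace ℝ (Fin N) → ℝ) : Prop :=
  ∀ β : ℝ, 0 < β → ∀ i : Fin d, ContDiffOn ℝ 2 (u β i) Ω ∧ ∀ x ∈ Ω,
    -lapl (u β i) x = f β i x (fun j => u β j x)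
      - β * ∑ j ∈ Finset.univ.erase i,
          A i j * u β i x * |u β i x| ^ (p - 1) * |u β j x| ^ (p + 1)

/-- test functions for distributional identities in `Ω` -/
def IsTest {N : ℕ} (Ω : Set (EuclideanSpace ℝ (Fin N))) (φ : EuclideanSpace ℝ (Fin N) → ℝ) : Prop :=
  ContDiff ℝ (⊤ : ℕ∞) φ ∧ HasCompactSupport φ ∧ tsupport φ ⊆ Ω

/-- the Pohozaev identity (G3) -/
def Pohozaev {N d : ℕ} (Ω : Set (EuclideanSpace ℝ (Fin N)))
    (u : Fin d → EuclideanSpace ℝ (Fin N) → ℝ)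
    (f : Fin d → EuclideanSpace ℝ (Fin N) → (Fin d → ℝ) → ℝ) : Prop :=
  ∀ x₀ ∈ Ω, ∀ r : ℝ, 0 < r → r < infDist x₀ Ωᶜ →
    (2 - (N:ℝ)) * ∑ i, ∫ x in ball x₀ r, ‖gradient (u i) x‖^2 =
      r * ∑ i, (∫ x in sphere x₀ r,
        (2 * ⟪gradient (u i) x, r⁻¹ • (x - x₀)⟫^2 - ‖gradient (u i) x‖^2) ∂μH[(N:ℝ) - 1])
      + 2 * ∑ i, ∫ x in ball x₀ r, f i x (fun j => u j x) * ⟪gradient (u i) x, x - x₀⟫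

/-- the nodal set `Γ_u` -/
def nodalSet {N d : ℕ} (Ω : Set (EuclideanSpace ℝ (Fin N)))
    (u : Fin d → EuclideanSpace ℝ (Fin N) → ℝ) : Set (EuclideanSpace ℝ (Fin N)) :=
  {x ∈ Ω | ∀ i, u i x = 0}

/-- the reduced nodal set `Γ̃_u` -/
def tildeGamma {N d m : ℕ} (D : Decomp d m) (Ω : Set (EuclideanSpace ℝ (Fin N)))
    (u : Fin d → EuclideanSpace ℝ (Fin N) → ℝ) : Set (EuclideanSpace ℝ (Fin N)) :=
  Ω \ ⋃ h : Fin m, interior (closure {x | 0 < ∑ j ∈ D.grpSet h, (u j x)^2})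

/-- the class `G(Ω)` -/
structure ClassG {N d m : ℕ} (D : Decomp d m) (Ω : Set (EuclideanSpace ℝ (Fin N)))
    (u : Fin d → EuclideanSpace ℝ (Fin N) → ℝ)
    (f : Fin d → EuclideanSpace ℝ (Fin N) → (Fin d → ℝ) → ℝ)
    (M : Fin d → Measure (EuclideanSpace ℝ (Fin N))) : Prop where
  nontrivial : ∃ i, ∃ x ∈ Ω, u i x ≠ 0
  memH1 : ∀ i, IntegrableOn (fun x => (u i x)^2 + ‖gradient (u i) x‖^2) Ω
  lip : ∀ i, ∃ L : ℝ≥0, LipschitzOnWith L (u i) Ω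
  seg : ∀ i j, D.K2 i j → ∀ x ∈ Ω, u i x * u j x = 0
  hypL : ∃ C : ℝ, 0 < C ∧ ∀ h : Fin m, ∀ i, D.mem h i → ∀ x ∈ Ω, ∀ s : Fin d → ℝ,
    (∀ j, s j ∈ Set.Icc (0:ℝ) 1) → |f i x s| ≤ C * ∑ j ∈ D.grpSet h, |s j|
  radon : ∀ i, ∀ K : Set (EuclideanSpace ℝ (Fin N)), IsCompact K → K ⊆ Ω → M i K < ⊤
  suppM : ∀ i, M i (Ω \ nodalSet Ω u) = 0
  weakEq : ∀ i, ∀ φ, IsTest Ω φ →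
    ∫ x, ⟪gradient (u i) x, gradient φ x⟫
      = ∫ x, f i x (fun j => u j x) * φ x - ∫ x, φ x ∂(M i)
  pohozaev : Pohozaev Ω u f

/-- Almgren's `H` function -/
def Hfn {N d : ℕ} (u : Fin d → EuclideanSpace ℝ (Fin N) → ℝ)
    (x₀ : EuclideanSpace ℝ (Fin N)) (r : ℝ) : ℝ :=
  r ^ (1 - (N:ℝ)) * ∑ i, ∫ x in sphere x₀ r, (u i x)^2 ∂μH[(N:ℝ) - 1]

/-- Almgren's `E` function -/
def Efn {N d : ℕ} (u : Fin d → EuclideanSpace ℝ (Fin N) → ℝ)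
    (f : Fin d → EuclideanSpace ℝ (Fin N) → (Fin d → ℝ) → ℝ)
    (x₀ : EuclideanSpace ℝ (Fin N)) (r : ℝ) : ℝ :=
  r ^ (2 - (N:ℝ)) * ∑ i, ∫ x in ball x₀ r,
    (‖gradient (u i) x‖^2 - f i x (fun j => u j x) * u i x)

/-- the Almgren frequency function -/
def Nfn {N d : ℕ} (u : Fin d → EuclideanSpace ℝ (Fin N) → ℝ)
    (f : Fin d → EuclideanSpace ℝ (Fin N) → (Fin d → ℝ) → ℝ)
    (x₀ : EuclideanSpace ℝ (Fin N)) (r : ℝ) : ℝ :=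
  Efn u f x₀ r / Hfn u x₀ r

/-- `N(x₀,u,0⁺)` -/
def Nlim {N d : ℕ} (u : Fin d → EuclideanSpace ℝ (Fin N) → ℝ)
    (f : Fin d → EuclideanSpace ℝ (Fin N) → (Fin d → ℝ) → ℝ)
    (x₀ : EuclideanSpace ℝ (Fin N)) : ℝ :=
  limUnder (𝓝[>] (0:ℝ)) fun r => Nfn u f x₀ r

/-- hypotheses of the Lipschitz continuity proposition -/
def LipHyp {N d m : ℕ} (D : Decomp d m) (Ω : Set (EuclideanSpace ℝ (Fin N)))
    (u : Fin d → EuclideanSpace ℝ (Fin N) → ℝ)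
    (f : Fin d → EuclideanSpace ℝ (Fin N) → (Fin d → ℝ) → ℝ) : Prop :=
  (∃ i, ∃ x ∈ Ω, u i x ≠ 0) ∧
  (∀ i, IntegrableOn (fun x => (u i x)^2 + ‖gradient (u i) x‖^2) Ω) ∧
  (∀ α ∈ Set.Ioo (0:ℝ) 1, ∀ i : Fin d, ∀ K : Set (EuclideanSpace ℝ (Fin N)),
    IsCompact K → K ⊆ Ω →
    ∃ C : ℝ, ∀ x ∈ K, ∀ y ∈ K, |u i x - u i y| ≤ C * dist x y ^ α) ∧
  (∀ i j, D.K2 i j → ∀ x ∈ Ω, u i x * u j x = 0) ∧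
  (∃ C : ℝ, 0 < C ∧ ∀ h : Fin m, ∀ i, D.mem h i → ∀ x ∈ Ω, ∀ s : Fin d → ℝ,
    (∀ j, s j ∈ Set.Icc (0:ℝ) 1) → |f i x s| ≤ C * ∑ j ∈ D.grpSet h, |s j|) ∧
  (∀ h : Fin m, ∀ i, D.mem h i → ∀ φ,
    IsTest {x ∈ Ω | 0 < ∑ j ∈ D.grpSet h, |u j x|} φ →
    ∫ x, ⟪gradient (u i) x, gradient φ x⟫ = ∫ x, f i x (fun j => u j x) * φ x) ∧
  Pohozaev Ω u f

/-- an NTA (non-tangentially accessible) domain, with corkscrew constant `M`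
and scale `R`, in the sense of Jerison--Kenig. -/
structure IsNTA {N : ℕ} (ω : Set (EuclideanSpace ℝ (Fin N))) (M R : ℝ) : Prop where
  isOpen : IsOpen ω
  one_lt : 1 < M
  rpos : 0 < R
  intCork : ∀ x ∈ frontier ω, ∀ r : ℝ, 0 < r → r < R →
    ∃ y ∈ ω, dist y x < r ∧ ball y (r / M) ⊆ ω ∩ ball x r
  extCork : ∀ x ∈ frontier ω, ∀ r : ℝ, 0 < r → r < R →
    ∃ y, y ∉ closure ω ∧ dist y x < r ∧ ball y (r / M) ⊆ ball x r \ closure ω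
  harnackChain : ∀ Λ : ℝ, 0 < Λ → ∃ n : ℕ, ∀ ε : ℝ, 0 < ε → ∀ x ∈ ω, ∀ y ∈ ω,
    ε ≤ infDist x ωᶜ → ε ≤ infDist y ωᶜ → dist x y ≤ Λ * ε →
    ∃ (c : Fin (n + 1) → EuclideanSpace ℝ (Fin N)) (ρ : Fin (n + 1) → ℝ),
      x ∈ ball (c 0) (ρ 0) ∧ y ∈ ball (c (Fin.last n)) (ρ (Fin.last n)) ∧
      (∀ i, ball (c i) (ρ i) ⊆ ω) ∧
      (∀ i, infDist (c i) ωᶜ / M ≤ ρ i) ∧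
      (∀ i : Fin n, (ball (c i.castSucc) (ρ i.castSucc) ∩ ball (c i.succ) (ρ i.succ)).Nonempty)

/-- the hyperplane through `x` orthogonal to `ν` -/
def hyperplaneThrough {N : ℕ} (x ν : EuclideanSpace ℝ (Fin N)) :
    Set (EuclideanSpace ℝ (Fin N)) :=
  {y | ⟪y - x, ν⟫ = 0}

/-- a `(δ,R)`-Reifenberg flat domain -/
structure IsReifenbergFlat {N : ℕ} (ω : Set (EuclideanSpace ℝ (Fin N))) (δ R : ℝ) : Prop where
  isOpen : IsOpen ω
  flat : ∀ x ∈ frontier ω, ∀ r : ℝ, 0 < r → r < R →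
    ∃ ν : EuclideanSpace ℝ (Fin N), ‖ν‖ = 1 ∧
      hausdorffDist (frontier ω ∩ ball x r) (hyperplaneThrough x ν ∩ ball x r) ≤ δ * r ∧
      {y ∈ ball x r | δ * r ≤ ⟪y - x, ν⟫} ⊆ ω ∧
      {y ∈ ball x r | ⟪y - x, ν⟫ ≤ -(δ * r)} ⊆ (closure ω)ᶜ

/-- `w` is a weak (H¹) solution of `-Δw = a w` in `U` -/
def WeakSol {N : ℕ} (U : Set (EuclideanSpace ℝ (Fin N)))
    (a w : EuclideanSpace ℝ (Fin N) → ℝ) : Prop :=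
  ∀ φ, IsTest U φ → ∫ x, ⟪gradient w x, gradient φ x⟫ = ∫ x, a x * w x * φ x

/-- `ubar` is a blow-up limit of `u` at `x₀`, i.e. an `H¹_loc ∩ C⁰_loc` limit of
`u(x_n + t_n ·)/√(H(x_n,u,t_n))` for some `x_n → x₀` and `t_n → 0⁺`. -/
def BlowupLimit {N d : ℕ} (u ubar : Fin d → EuclideanSpace ℝ (Fin N) → ℝ)
    (x₀ : EuclideanSpace ℝ (Fin N)) : Prop :=
  ∃ (xs : ℕ → EuclideanSpace ℝ (Fin N)) (ts : ℕ → ℝ),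
    Tendsto xs atTop (𝓝 x₀) ∧ (∀ n, 0 < ts n) ∧ Tendsto ts atTop (𝓝 0) ∧
    ∀ K : Set (EuclideanSpace ℝ (Fin N)), IsCompact K → ∀ i,
      TendstoUniformlyOn
        (fun n x => u i (xs n + ts n • x) / Real.sqrt (Hfn u (xs n) (ts n)))
        (ubar i) atTop K ∧
      Tendsto (fun n => ∫ x in K,
        ‖gradient (fun y => u i (xs n + ts n • y) / Real.sqrt (Hfn u (xs n) (ts n))) x
          - gradient (ubar i) x‖^2) atTop (𝓝 0)


section

/-- Euclidean space -/
abbrev Eu (N : ℕ) := EuclideanSpace ℝ (Fin N)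

/-- partial derivative in direction `e` -/
def pd {N : ℕ} (e : Eu N) (v : Eu N → ℝ) (x : Eu N) : ℝ := fderiv ℝ v x e

/-- basis vector -/
def ev {N : ℕ} (k : Fin N) : Eu N := EuclideanSpace.single k 1

lemma basisFun_ev {N : ℕ} (k : Fin N) : EuclideanSpace.basisFun (Fin N) ℝ k = ev k := by
  simp [ev]

lemma lapl_eq_laplacian {N : ℕ} (u : Eu N → ℝ) (x : Eu N) :
    lapl u x = Laplacian.laplacian u x := by
  rw [InnerProductSpace.laplacian_eq_iteratedFDeriv_orthonormalBasis u
    (EuclideanSpace.basisFun (Fin N) ℝ)]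
  simp [lapl]

lemma pd_pd_eq {N : ℕ} {v : Eu N → ℝ} {x : Eu N} (h : DifferentiableAt ℝ (fderiv ℝ v) x)
    (e : Eu N) : iteratedFDeriv ℝ 2 v x ![e, e] = pd e (pd e v) x := by
  rw [iteratedFDeriv_two_apply]
  simp only [Matrix.cons_val_zero, Matrix.cons_val_one]
  have : HasFDerivAt (pd e v) ((fderiv ℝ (fderiv ℝ v) x).flip e) x := by
    have h1 := h.hasFDerivAt.clm_apply (hasFDerivAt_const e x)
    have h2 : fderiv ℝ v x ∘SL (0 : Eu N →L[ℝ] Eu N) + (fderiv ℝ (fderiv ℝ v) x).flip e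
        = (fderiv ℝ (fderiv ℝ v) x).flip e := by simp
    rw [h2] at h1
    exact h1
  simp only [pd] at this ⊢
  rw [this.fderiv]; rfl

lemma diff_fderiv {N : ℕ} {v : Eu N → ℝ} {x : Eu N} (h : ContDiffAt ℝ 2 v x) :
    DifferentiableAt ℝ (fderiv ℝ v) x := by
  have := h.fderiv_right (m := 1) (by norm_num)
  exact this.differentiableAt (by norm_num)

lemma lapl_eq_sum_basis {N : ℕ} {v : Eu N → ℝ} {x : Eu N}
    (h : DifferentiableAt ℝ (fderiv ℝ v) x) (b : OrthonormalBasis (Fin N) ℝ (Eu N)) :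
    lapl v x = ∑ k, pd (b k) (pd (b k) v) x := by
  rw [lapl_eq_laplacian, InnerProductSpace.laplacian_eq_iteratedFDeriv_orthonormalBasis v b]
  exact Finset.sum_congr rfl fun k _ => pd_pd_eq h _

lemma lapl_eq_sum {N : ℕ} {v : Eu N → ℝ} {x : Eu N}
    (h : DifferentiableAt ℝ (fderiv ℝ v) x) :
    lapl v x = ∑ k, pd (ev k) (pd (ev k) v) x := by
  rw [lapl_eq_sum_basis h (EuclideanSpace.basisFun (Fin N) ℝ)]
  simp only [basisFun_ev]

lemma diff_pd {N : ℕ} {v : Eu N → ℝ} {x : Eu N} (h : ContDiffAt ℝ 2 v x) (e : Eu N) :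
    DifferentiableAt ℝ (pd e v) x := by
  exact (diff_fderiv h).clm_apply (differentiableAt_const e)

lemma cd_pd {N : ℕ} {v : Eu N → ℝ} {s : Set (Eu N)} (hs : IsOpen s)
    (h : ContDiffOn ℝ 2 v s) (e : Eu N) :
    ContDiffOn ℝ 1 (pd e v) s := by
  have := h.fderiv_of_isOpen (m := 1) hs (by norm_num)
  exact this.clm_apply contDiffOn_const

lemma cd_at {N : ℕ} {v : Eu N → ℝ} {s : Set (Eu N)} (hs : IsOpen s) {n : WithTop ℕ∞}
    (h : ContDiffOn ℝ n v s) {x : Eu N} (hx : x ∈ s) : ContDiffAt ℝ n v x :=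
  h.contDiffAt (hs.mem_nhds hx)

/-- second-order max test in a direction -/
lemma pd_pd_nonpos {N : ℕ} {ψ : Eu N → ℝ} {z : Eu N} (h : ContDiffAt ℝ 2 ψ z)
    (hm : IsLocalMax ψ z) (e : Eu N) : pd e (pd e ψ) z ≤ 0 := by
  by_contra! hpos
  set g : ℝ → ℝ := fun t => ψ (z + t • e) with hg
  have hl : ∀ t : ℝ, HasDerivAt (fun t : ℝ => z + t • e) e t := by
    intro t
    simpa using ((hasDerivAt_id t).smul_const e).const_add z
  have hc : Tendsto (fun t : ℝ => z + t • e) (𝓝 0) (𝓝 z) := by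
    have := (hl 0).continuousAt.tendsto
    simpa using this
  have hev : ∀ᶠ y in 𝓝 z, DifferentiableAt ℝ ψ y := by
    filter_upwards [h.eventually (by norm_num)] with y hy
    exact hy.differentiableAt (by norm_num)
  have hd : ∀ᶠ t in 𝓝 (0:ℝ), HasDerivAt g (pd e ψ (z + t • e)) t := by
    filter_upwards [hc.eventually hev] with t ht
    exact ht.hasFDerivAt.comp_hasDerivAt t (hl t)
  have hd2 : HasDerivAt (fun t : ℝ => pd e ψ (z + t • e)) (pd e (pd e ψ) z) 0 := by
    have h1 : HasFDerivAt (pd e ψ) (fderiv ℝ (pd e ψ) z) (z + (0:ℝ) • e) := by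
      simpa using (diff_pd h e).hasFDerivAt
    exact h1.comp_hasDerivAt (0:ℝ) (hl 0)
  have hdg : deriv g =ᶠ[𝓝 0] fun t => pd e ψ (z + t • e) := by
    filter_upwards [hd] with t ht using ht.deriv
  have hdd : deriv (deriv g) 0 = pd e (pd e ψ) z := by
    rw [hdg.deriv_eq, hd2.deriv]
  have hgm : IsLocalMax g 0 := by
    have : IsLocalMax ψ (z + (0:ℝ) • e) := by simpa using hm
    have hc' : ContinuousAt (fun t : ℝ => z + t • e) 0 := (hl 0).continuousAt
    exact IsLocalMax.comp_continuous (g := fun t : ℝ => z + t • e) this hc'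
  have hgmin : IsLocalMin g 0 := by
    apply isLocalMin_of_deriv_deriv_pos
    · rw [hdd]; exact hpos
    · exact hgm.deriv_eq_zero
    · exact hd.self_of_nhds.continuousAt
  have hconst : g =ᶠ[𝓝 0] fun _ => g 0 := by
    filter_upwards [hgm, hgmin] with t h1 h2
    exact le_antisymm h1 h2
  have : deriv (deriv g) 0 = 0 := by
    have h1 : deriv g =ᶠ[𝓝 0] deriv (fun _ => g 0) := hconst.deriv
    rw [h1.deriv_eq]; simp
  linarith

lemma lapl_nonpos_of_max {N : ℕ} {ψ : Eu N → ℝ} {z : Eu N} (h : ContDiffAt ℝ 2 ψ z)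
    (hm : IsLocalMax ψ z) : lapl ψ z ≤ 0 := by
  rw [lapl_eq_sum (diff_fderiv h)]
  exact Finset.sum_nonpos fun k _ => pd_pd_nonpos h hm _

lemma lapl_add {N : ℕ} {u v : Eu N → ℝ} {x : Eu N} (hu : ContDiffAt ℝ 2 u x)
    (hv : ContDiffAt ℝ 2 v x) : lapl (fun y => u y + v y) x = lapl u x + lapl v x := by
  simp only [lapl_eq_laplacian]
  exact hu.laplacian_add hv

lemma lapl_sub {N : ℕ} {u v : Eu N → ℝ} {x : Eu N} (hu : ContDiffAt ℝ 2 u x)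
    (hv : ContDiffAt ℝ 2 v x) : lapl (fun y => u y - v y) x = lapl u x - lapl v x := by
  simp only [lapl_eq_laplacian]
  exact hu.laplacian_sub hv

lemma lapl_const_mul {N : ℕ} {u : Eu N → ℝ} {x : Eu N} (c : ℝ) (hu : ContDiffAt ℝ 2 u x) :
    lapl (fun y => c * u y) x = c * lapl u x := by
  simp only [lapl_eq_laplacian]
  exact InnerProductSpace.laplacian_smul c hu

lemma lapl_neg {N : ℕ} {u : Eu N → ℝ} {x : Eu N} :
    lapl (fun y => - u y) x = - lapl u x := by
  simp only [lapl_eq_laplacian]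
  have := congrFun (InnerProductSpace.laplacian_neg (f := u)) x
  exact this

lemma lapl_const {N : ℕ} {x : Eu N} (c : ℝ) : lapl (fun _ : Eu N => c) x = 0 := by
  simp only [lapl_eq_laplacian]
  have := InnerProductSpace.laplacian_const (E := Eu N) (c := c)
  exact congrFun this x

lemma lapl_congr {N : ℕ} {u v : Eu N → ℝ} {x : Eu N} (h : u =ᶠ[𝓝 x] v) :
    lapl u x = lapl v x := by
  simp only [lapl_eq_laplacian]
  exact (InnerProductSpace.laplacian_congr_nhds h).eq_of_nhds

lemma pd_comp_aff {N : ℕ} {v : Eu N → ℝ} (x0 : Eu N) (r : ℝ) (L : Eu N ≃ₗᵢ[ℝ] Eu N) {y : Eu N}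
    (h : DifferentiableAt ℝ v (x0 + r • L y)) (e : Eu N) :
    pd e (fun z => v (x0 + r • L z)) y = r * pd (L e) v (x0 + r • L y) := by
  have hl : HasFDerivAt (fun z : Eu N => x0 + r • L z) (r • (L : Eu N →L[ℝ] Eu N)) y := by
    exact ((L : Eu N →L[ℝ] Eu N).hasFDerivAt.const_smul r).const_add x0
  have := h.hasFDerivAt.comp y hl
  simp only [pd]
  have h2 : fderiv ℝ (fun z => v (x0 + r • L z)) y = _ := this.fderiv
  rw [h2]; simp

lemma aff_cont {N : ℕ} (x0 : Eu N) (r : ℝ) (L : Eu N ≃ₗᵢ[ℝ] Eu N) :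
    Continuous (fun z : Eu N => x0 + r • L z) := by fun_prop

lemma cd_comp_aff {N : ℕ} {v : Eu N → ℝ} (x0 : Eu N) (r : ℝ) (L : Eu N ≃ₗᵢ[ℝ] Eu N) {y : Eu N}
    {n : WithTop ℕ∞}
    (h : ContDiffAt ℝ n v (x0 + r • L y)) : ContDiffAt ℝ n (fun z => v (x0 + r • L z)) y := by
  have : ContDiffAt ℝ n (fun z : Eu N => x0 + r • L z) y := by
    apply contDiffAt_const.add
    apply ContDiffAt.const_smul
    exact (L : Eu N →L[ℝ] Eu N).contDiff.contDiffAt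
  exact ContDiffAt.comp y h this

lemma lapl_comp_aff {N : ℕ} {v : Eu N → ℝ} (x0 : Eu N) (r : ℝ) (L : Eu N ≃ₗᵢ[ℝ] Eu N) {y : Eu N}
    (h : ContDiffAt ℝ 2 v (x0 + r • L y)) :
    lapl (fun z => v (x0 + r • L z)) y = r ^ 2 * lapl v (x0 + r • L y) := by
  rw [lapl_eq_sum_basis (diff_fderiv (cd_comp_aff x0 r L h)) (EuclideanSpace.basisFun (Fin N) ℝ),
    lapl_eq_sum_basis (diff_fderiv h) ((EuclideanSpace.basisFun (Fin N) ℝ).map L), Finset.mul_sum]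
  refine Finset.sum_congr rfl fun k _ => ?_
  set e := EuclideanSpace.basisFun (Fin N) ℝ k
  have he : ((EuclideanSpace.basisFun (Fin N) ℝ).map L) k = L e := by simp [e]
  rw [he]
  have h1 : pd e (fun z => v (x0 + r • L z)) =ᶠ[𝓝 y]
      fun z => r * pd (L e) v (x0 + r • L z) := by
    have hev := (aff_cont x0 r L).continuousAt.eventually (h.eventually (by norm_num))
    filter_upwards [hev] with z hz
    exact pd_comp_aff x0 r L (hz.differentiableAt (by norm_num)) e
  have h2 : pd e (pd e (fun z => v (x0 + r • L z))) y
      = pd e (fun z => r * pd (L e) v (x0 + r • L z)) y := by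
    simp only [pd]
    rw [Filter.EventuallyEq.fderiv_eq h1]; rfl
  rw [h2]
  have h3 := pd_comp_aff x0 r L (diff_pd h (L e)) e
  have h4 : DifferentiableAt ℝ (fun z => pd (L e) v (x0 + r • L z)) y := by
    apply DifferentiableAt.comp (g := pd (L e) v) y (diff_pd h (L e))
    fun_prop
  have : pd e (fun z => r * pd (L e) v (x0 + r • L z)) y
      = r * pd e (fun z => pd (L e) v (x0 + r • L z)) y := by
    simp only [pd] at h4 ⊢
    rw [fderiv_const_mul h4]; simp
  rw [this, h3]; ring

/-- affine scaling without rotation -/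
lemma lapl_comp_scale {N : ℕ} {v : Eu N → ℝ} (x0 : Eu N) (r : ℝ) {y : Eu N}
    (h : ContDiffAt ℝ 2 v (x0 + r • y)) :
    lapl (fun z => v (x0 + r • z)) y = r ^ 2 * lapl v (x0 + r • y) :=
  lapl_comp_aff x0 r (LinearIsometryEquiv.refl ℝ (Eu N)) h

lemma cd_comp_scale {N : ℕ} {v : Eu N → ℝ} (x0 : Eu N) (r : ℝ) {y : Eu N} {n : WithTop ℕ∞}
    (h : ContDiffAt ℝ n v (x0 + r • y)) : ContDiffAt ℝ n (fun z => v (x0 + r • z)) y :=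
  cd_comp_aff x0 r (LinearIsometryEquiv.refl ℝ (Eu N)) h

/-- squared gradient -/
def grad2 {N : ℕ} (v : Eu N → ℝ) (x : Eu N) : ℝ := ∑ k, (pd (ev k) v x) ^ 2

lemma pd_chain {N : ℕ} {g : Eu N → ℝ} {x : Eu N} {φ : ℝ → ℝ} {a : ℝ}
    (hφ : HasDerivAt φ a (g x)) (hg : DifferentiableAt ℝ g x) (e : Eu N) :
    pd e (fun y => φ (g y)) x = a * pd e g x := by
  have := hφ.comp_hasFDerivAt x hg.hasFDerivAt
  simp only [pd]
  have h2 : fderiv ℝ (fun y => φ (g y)) x = _ := this.fderiv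
  rw [h2]; simp

lemma lapl_chain {N : ℕ} {g : Eu N → ℝ} {x : Eu N} {φ φ' : ℝ → ℝ} {φ'' : ℝ}
    (h1 : ∀ᶠ t in 𝓝 (g x), HasDerivAt φ (φ' t) t) (h2 : HasDerivAt φ' φ'' (g x))
    (hg : ContDiffAt ℝ 2 g x) :
    lapl (fun y => φ (g y)) x = φ'' * grad2 g x + φ' (g x) * lapl g x := by
  have hgc : ContinuousAt g x := hg.continuousAt
  have hev : ∀ᶠ y in 𝓝 x, DifferentiableAt ℝ g y := by
    filter_upwards [hg.eventually (by norm_num)] with y hy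
    exact hy.differentiableAt (by norm_num)
  have hfd : fderiv ℝ (fun y => φ (g y)) =ᶠ[𝓝 x] fun y => φ' (g y) • fderiv ℝ g y := by
    filter_upwards [hev, hgc.eventually h1] with y hy hy1
    exact (hy1.comp_hasFDerivAt y hy.hasFDerivAt).fderiv
  have hφg : DifferentiableAt ℝ (fun y => φ' (g y)) x :=
    (h2.comp_hasFDerivAt x hev.self_of_nhds.hasFDerivAt).differentiableAt
  have hdiff : DifferentiableAt ℝ (fderiv ℝ (fun y => φ (g y))) x := by
    rw [hfd.differentiableAt_iff]
    exact hφg.smul (diff_fderiv hg)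
  rw [lapl_eq_sum hdiff, lapl_eq_sum (diff_fderiv hg), grad2, Finset.mul_sum, Finset.mul_sum,
    ← Finset.sum_add_distrib]
  refine Finset.sum_congr rfl fun k _ => ?_
  have h3 : pd (ev k) (fun y => φ (g y)) =ᶠ[𝓝 x] fun y => φ' (g y) * pd (ev k) g y := by
    filter_upwards [hfd] with y hy
    simp [pd, hy]
  have h4 : pd (ev k) (pd (ev k) (fun y => φ (g y))) x
      = pd (ev k) (fun y => φ' (g y) * pd (ev k) g y) x := by
    conv_lhs => rw [pd]
    rw [h3.fderiv_eq]; rfl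
  rw [h4]
  have h5 := pd_chain h2 hev.self_of_nhds (ev k)
  have h6 := diff_pd hg (ev k)
  have h7 : pd (ev k) (fun y => φ' (g y) * pd (ev k) g y) x
     = φ' (g x) * pd (ev k) (pd (ev k) g) x + pd (ev k) g x * pd (ev k) (fun y => φ' (g y)) x := by
    conv_lhs => rw [pd]
    rw [fderiv_fun_mul hφg h6]; simp [pd]
  rw [h7, h5]; ring

lemma pd_coord {N : ℕ} (e : Eu N) (k : Fin N) (x : Eu N) : pd e (fun y : Eu N => y k) x = e k := by
  have : HasFDerivAt (fun y : Eu N => y k) (EuclideanSpace.proj k : Eu N →L[ℝ] ℝ) x :=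
    (EuclideanSpace.proj k : Eu N →L[ℝ] ℝ).hasFDerivAt
  simp only [pd]; rw [this.fderiv]; simp

lemma pd_inner {N : ℕ} (e a : Eu N) (x : Eu N) : pd e (fun y : Eu N => ⟪a, y⟫) x = ⟪a, e⟫ := by
  have : HasFDerivAt (fun y : Eu N => ⟪a, y⟫) (innerSL ℝ a) x := (innerSL ℝ a).hasFDerivAt
  simp only [pd]; rw [this.fderiv]; simp

lemma cd_inner {N : ℕ} (a : Eu N) {n : WithTop ℕ∞} : ContDiff ℝ n (fun y : Eu N => ⟪a, y⟫) :=
  (innerSL ℝ a).contDiff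

lemma lapl_inner {N : ℕ} (a : Eu N) (x : Eu N) : lapl (fun y : Eu N => ⟪a, y⟫) x = 0 := by
  rw [lapl_eq_sum (diff_fderiv (cd_inner a).contDiffAt)]
  apply Finset.sum_eq_zero
  intro k _
  have : pd (ev k) (fun y : Eu N => ⟪a, y⟫) = fun _ => ⟪a, ev k⟫ := by
    ext x; exact pd_inner _ _ _
  rw [this]; simp [pd]

lemma sum_inner_ev_sq {N : ℕ} (a : Eu N) : ∑ k, ⟪a, ev k⟫ ^ 2 = ‖a‖ ^ 2 := by
  have h := (EuclideanSpace.basisFun (Fin N) ℝ).sum_sq_norm_inner_left a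
  simp only [basisFun_ev, Real.norm_eq_abs, sq_abs] at h
  exact h

lemma sum_inner_mul {N : ℕ} (a b : Eu N) : ∑ k, ⟪a, ev k⟫ * ⟪b, ev k⟫ = ⟪a, b⟫ := by
  have h := (EuclideanSpace.basisFun (Fin N) ℝ).sum_inner_mul_inner a b
  simp only [basisFun_ev] at h
  rw [← h]
  exact Finset.sum_congr rfl fun k _ => by rw [real_inner_comm b]

lemma grad2_inner {N : ℕ} (a : Eu N) (x : Eu N) : grad2 (fun y : Eu N => ⟪a, y⟫) x = ‖a‖ ^ 2 := by
  simp only [grad2, pd_inner]; exact sum_inner_ev_sq a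

/-- functions of a linear coordinate -/
lemma lapl_ridge {N : ℕ} (a : Eu N) (c : ℝ) {x : Eu N} {φ φ' : ℝ → ℝ} {φ'' : ℝ}
    (h1 : ∀ᶠ t in 𝓝 (⟪a, x⟫ + c), HasDerivAt φ (φ' t) t) (h2 : HasDerivAt φ' φ'' (⟪a, x⟫ + c)) :
    lapl (fun y => φ (⟪a, y⟫ + c)) x = φ'' * ‖a‖ ^ 2 := by
  have hc : ContDiffAt ℝ 2 (fun y : Eu N => ⟪a, y⟫ + c) x :=
    ((cd_inner a).add contDiff_const).contDiffAt
  have := lapl_chain (g := fun y : Eu N => ⟪a, y⟫ + c) h1 h2 hc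
  rw [this]
  have h3 : lapl (fun y : Eu N => ⟪a, y⟫ + c) x = 0 := by
    rw [lapl_add (cd_inner a).contDiffAt contDiffAt_const, lapl_inner, lapl_const]; simp
  have h4 : grad2 (fun y : Eu N => ⟪a, y⟫ + c) x = ‖a‖ ^ 2 := by
    rw [← grad2_inner a x]
    simp only [grad2, pd, fderiv_add_const]
  rw [h3, h4]; simp

lemma lapl_sq {N : ℕ} {g : Eu N → ℝ} {x : Eu N} (hg : ContDiffAt ℝ 2 g x) :
    lapl (fun y => g y ^ 2) x = 2 * grad2 g x + 2 * g x * lapl g x := by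
  have := lapl_chain (g := g) (x := x) (φ := fun t => t ^ 2) (φ' := fun t => 2 * t) (φ'' := 2)
    (Eventually.of_forall fun t => by simpa using hasDerivAt_pow 2 t)
    (by simpa using (hasDerivAt_id (g x)).const_mul 2) hg
  rw [this]

lemma inner_ev {N : ℕ} (x : Eu N) (k : Fin N) : ⟪x, ev k⟫ = x k := by
  simp [ev, EuclideanSpace.inner_single_right]

lemma norm_ev {N : ℕ} (k : Fin N) : ‖(ev k : Eu N)‖ = 1 := by simp [ev]

lemma normsq_eq {N : ℕ} (x : Eu N) : ‖x‖ ^ 2 = ∑ k, (x k) ^ 2 := by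
  rw [← sum_inner_ev_sq]; simp [inner_ev]

lemma cd_normsq {N : ℕ} (x0 : Eu N) {n : WithTop ℕ∞} :
    ContDiff ℝ n (fun y : Eu N => ‖y - x0‖ ^ 2) := by
  exact (contDiff_id.sub contDiff_const).norm_sq ℝ

lemma pd_normsq {N : ℕ} (x0 e x : Eu N) :
    pd e (fun y : Eu N => ‖y - x0‖ ^ 2) x = 2 * ⟪x - x0, e⟫ := by
  have h : HasFDerivAt (fun y : Eu N => y - x0) (ContinuousLinearMap.id ℝ (Eu N)) x :=
    (hasFDerivAt_id x).sub_const x0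
  have := h.norm_sq
  simp only [pd]; rw [this.fderiv]; simp [inner_sub_left]

lemma lapl_normsq {N : ℕ} (x0 x : Eu N) : lapl (fun y : Eu N => ‖y - x0‖ ^ 2) x = 2 * N := by
  rw [lapl_eq_sum (diff_fderiv (cd_normsq x0).contDiffAt)]
  have : ∀ k : Fin N, pd (ev k) (pd (ev k) (fun y : Eu N => ‖y - x0‖ ^ 2)) x = 2 := by
    intro k
    have h1 : pd (ev k) (fun y : Eu N => ‖y - x0‖ ^ 2) = fun y => 2 * ⟪ev k, y⟫ - 2 * ⟪ev k, x0⟫ := by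
      ext y; rw [pd_normsq, real_inner_comm, inner_sub_right]; ring
    rw [h1]
    have h2 : pd (ev k) (fun y : Eu N => 2 * ⟪ev k, y⟫ - 2 * ⟪ev k, x0⟫) x
        = 2 * pd (ev k) (fun y : Eu N => ⟪ev k, y⟫) x := by
      simp only [pd]
      rw [fderiv_sub_const, fderiv_const_mul ((cd_inner (n := 1) (ev k)).differentiable (by norm_num) x)]
      simp
    rw [h2, pd_inner, real_inner_self_eq_norm_sq, norm_ev]; norm_num
  simp [this]; ring

end

section

lemma lapl_continuousAt {N : ℕ} {v : Eu N → ℝ} {x : Eu N} (h : ContDiffAt ℝ 2 v x) :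
    ContinuousAt (lapl v) x := by
  have h1 : ContDiffAt ℝ 0 (iteratedFDeriv ℝ 2 v) x := h.iteratedFDeriv_right (by norm_num)
  have h2 := h1.continuousAt
  unfold lapl
  apply tendsto_finset_sum
  intro i _
  exact (ContinuousMultilinearMap.apply ℝ (fun _ : Fin 2 => Eu N) ℝ
    ![EuclideanSpace.single i 1, EuclideanSpace.single i 1]).continuous.continuousAt.tendsto.comp h2

/-- locally uniformly approximable by almost harmonic functions -/
def LocHarm {N : ℕ} (V : Eu N → ℝ) (x0 : Eu N) : Prop :=
  ∃ r : ℝ, 0 < r ∧ ∀ ε : ℝ, 0 < ε → ∃ w : Eu N → ℝ, ContDiffOn ℝ 2 w (ball x0 r) ∧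
    ∀ x ∈ ball x0 r, |w x - V x| ≤ ε ∧ |lapl w x| ≤ ε

lemma LocHarm.sub {N : ℕ} {V W : Eu N → ℝ} {x0 : Eu N} (hV : LocHarm V x0) (hW : LocHarm W x0) :
    LocHarm (fun x => V x - W x) x0 := by
  obtain ⟨r, hr, h⟩ := hV
  obtain ⟨s, hs, g⟩ := hW
  refine ⟨min r s, lt_min hr hs, fun ε hε => ?_⟩
  obtain ⟨w, hw, h1⟩ := h (ε / 2) (by linarith)
  obtain ⟨z, hz, h2⟩ := g (ε / 2) (by linarith)
  have b1 : ball x0 (min r s) ⊆ ball x0 r := ball_subset_ball (min_le_left _ _)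
  have b2 : ball x0 (min r s) ⊆ ball x0 s := ball_subset_ball (min_le_right _ _)
  refine ⟨fun x => w x - z x, (hw.mono b1).sub (hz.mono b2), fun x hx => ?_⟩
  obtain ⟨h3, h4⟩ := h1 x (b1 hx)
  obtain ⟨h5, h6⟩ := h2 x (b2 hx)
  rw [lapl_sub (cd_at isOpen_ball hw (b1 hx)) (cd_at isOpen_ball hz (b2 hx))]
  rw [abs_le] at h3 h4 h5 h6
  refine ⟨abs_le.2 ⟨?_, ?_⟩, abs_le.2 ⟨?_, ?_⟩⟩ <;> linarith

lemma LocHarm.neg {N : ℕ} {V : Eu N → ℝ} {x0 : Eu N} (hV : LocHarm V x0) :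
    LocHarm (fun x => - V x) x0 := by
  obtain ⟨r, hr, h⟩ := hV
  refine ⟨r, hr, fun ε hε => ?_⟩
  obtain ⟨w, hw, h1⟩ := h ε hε
  refine ⟨fun x => - w x, hw.neg, fun x hx => ?_⟩
  obtain ⟨h3, h4⟩ := h1 x hx
  rw [lapl_neg, abs_neg]
  refine ⟨?_, h4⟩
  rw [abs_le] at *
  constructor <;> linarith

lemma LocHarm.comp {N : ℕ} {V : Eu N → ℝ} {x0 : Eu N} (hV : LocHarm V x0)
    (L : Eu N ≃ₗᵢ[ℝ] Eu N) : LocHarm (fun x => V (x0 + L x)) 0 := by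
  obtain ⟨r, hr, h⟩ := hV
  refine ⟨r, hr, fun ε hε => ?_⟩
  obtain ⟨w, hw, h1⟩ := h ε hε
  have hb : ∀ x ∈ ball (0 : Eu N) r, x0 + L x ∈ ball x0 r := by
    intro x hx
    simpa [mem_ball, dist_eq_norm] using hx
  have hc : ∀ x ∈ ball (0 : Eu N) r, ContDiffAt ℝ 2 w (x0 + (1:ℝ) • L x) := by
    intro x hx
    rw [one_smul]; exact cd_at isOpen_ball hw (hb x hx)
  refine ⟨fun x => w (x0 + (1:ℝ) • L x), fun x hx => ?_, fun x hx => ?_⟩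
  · exact (cd_comp_aff x0 1 L (hc x hx)).contDiffWithinAt
  · rw [lapl_comp_aff x0 1 L (hc x hx)]
    simpa using h1 _ (hb x hx)

/-- viscosity test -/
lemma LocHarm.test {N : ℕ} {V φ : Eu N → ℝ} {x0 : Eu N} (hV : LocHarm V x0)
    (hφ : ContDiffAt ℝ 2 φ x0) (hm : ∀ᶠ x in 𝓝 x0, V x - φ x ≤ V x0 - φ x0) :
    0 ≤ lapl φ x0 := by
  by_contra! hneg
  obtain ⟨r, hr, h⟩ := hV
  set a := - lapl φ x0 with ha
  have hapos : 0 < a := by linarith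
  have hev : ∀ᶠ x in 𝓝 x0, lapl φ x < - (a / 2) :=
    (lapl_continuousAt hφ).eventually_lt continuousAt_const (by linarith)
  have hall := hm.and (hev.and ((hφ.eventually (by norm_num)).and (ball_mem_nhds x0 hr)))
  obtain ⟨ρ0, hρ0, hball⟩ := Metric.eventually_nhds_iff_ball.1 hall
  set ρ := ρ0 / 2 with hρ
  have hρp : 0 < ρ := by positivity
  set σ := a / (8 * (N + 1)) with hσ
  have hσp : 0 < σ := by positivity
  have hσN : 2 * N * σ ≤ a / 4 := by
    rw [hσ]
    rw [mul_div_assoc', div_le_div_iff₀ (by positivity) (by norm_num)]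
    nlinarith [hapos]
  set ε := min (a / 8) (σ * ρ ^ 2 / 4) with hε
  have hεp : 0 < ε := lt_min (by positivity) (by positivity)
  obtain ⟨w, hw, hw1⟩ := h ε hεp
  have hsub : closedBall x0 ρ ⊆ ball x0 ρ0 := closedBall_subset_ball (by linarith)
  have hcd : ∀ x ∈ closedBall x0 ρ, ContDiffAt ℝ 2 (fun y => w y - φ y - σ * ‖y - x0‖ ^ 2) x := by
    intro x hx
    have := hball x (hsub hx)
    exact ((cd_at isOpen_ball hw this.2.2.2).sub this.2.2.1).sub
      (contDiffAt_const.mul (cd_normsq x0).contDiffAt)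
  have hcont : ContinuousOn (fun y => w y - φ y - σ * ‖y - x0‖ ^ 2) (closedBall x0 ρ) :=
    fun x hx => (hcd x hx).continuousAt.continuousWithinAt
  obtain ⟨z, hz, hzm⟩ := (isCompact_closedBall x0 ρ).exists_isMaxOn
    ⟨x0, mem_closedBall_self hρp.le⟩ hcont
  have hx0 := hzm (mem_closedBall_self hρp.le)
  simp only [mem_setOf_eq, sub_self, norm_zero] at hx0
  have hx0' := hball x0 (mem_ball_self hρ0)
  have hz' := hball z (hsub hz)
  have e1 := abs_le.1 (hw1 x0 hx0'.2.2.2).1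
  have e2 := abs_le.1 (hw1 z hz'.2.2.2).1
  have e3 := abs_le.1 (hw1 z hz'.2.2.2).2
  have hεa : ε ≤ a / 8 := min_le_left _ _
  have hεs : ε ≤ σ * ρ ^ 2 / 4 := min_le_right _ _
  have hzin : z ∈ ball x0 ρ := by
    rw [mem_ball, dist_eq_norm]
    by_contra! hge
    have : ρ ^ 2 ≤ ‖z - x0‖ ^ 2 := by gcongr
    have h5 : σ * ρ ^ 2 ≤ σ * ‖z - x0‖ ^ 2 := by gcongr
    have := hz'.1
    nlinarith [mul_pos hσp (pow_pos hρp 2)]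
  have hloc : IsLocalMax (fun y => w y - φ y - σ * ‖y - x0‖ ^ 2) z :=
    hzm.isLocalMax (mem_of_superset (isOpen_ball.mem_nhds hzin) ball_subset_closedBall)
  have hl := lapl_nonpos_of_max (hcd z hz) hloc
  have c1 := cd_at isOpen_ball hw hz'.2.2.2
  have c2 := hz'.2.2.1
  rw [lapl_sub (c1.sub c2) (contDiffAt_const.mul (cd_normsq x0).contDiffAt), lapl_sub c1 c2,
    lapl_const_mul σ (cd_normsq x0).contDiffAt, lapl_normsq] at hl
  have := hz'.2.1
  linarith

lemma refl_formula {N : ℕ} (e : Eu N) (he : ‖e‖ = 1) (η : Eu N) :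
    (Submodule.reflection (ℝ ∙ e)ᗮ) η = η - (2 * ⟪e, η⟫) • e := by
  rw [Submodule.reflection_orthogonal_apply, Submodule.reflection_singleton_apply, he]
  simp only [RCLike.ofReal_real_eq_id, id, one_pow, div_one]
  simp only [neg_sub]
  rw [two_smul, two_mul, add_smul]

set_option maxHeartbeats 1000000 in
theorem liouville {N : ℕ} {V : Eu N → ℝ} {C α : ℝ} (hα0 : 0 < α) (hα1 : α < 1)
    (hV : ∀ x y, |V x - V y| ≤ C * dist x y ^ α)
    {U : Set (Eu N)} (hU : IsOpen U) (hd : Dense U) {ψ : Eu N → ℝ} {C' : ℝ}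
    (hψ0 : ∀ x ∈ U, 0 ≤ ψ x) (hψ : ContDiffOn ℝ 2 ψ U) (hψl : ∀ x ∈ U, lapl ψ x ≤ C')
    (hcomp : ∀ c : ℝ, IsCompact {x ∈ U | ψ x ≤ c}) (hharm : ∀ x ∈ U, LocHarm V x) :
    ∀ x y, V x = V y := by
  -- continuity
  have hVc : Continuous V := by
    rw [continuous_iff_continuousAt]
    intro x
    rw [ContinuousAt, tendsto_iff_dist_tendsto_zero]
    have h1 : Tendsto (fun y => C * dist y x ^ α) (𝓝 x) (𝓝 0) := by
      have : ContinuousAt (fun y => C * dist y x ^ α) x := by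
        apply continuousAt_const.mul
        exact (continuous_id.dist continuous_const).continuousAt.rpow_const (Or.inr hα0.le)
      have h2 := this.tendsto
      simpa [Real.zero_rpow hα0.ne'] using h2
    refine squeeze_zero (fun _ => dist_nonneg) (fun y => ?_) h1
    rw [Real.dist_eq]; exact hV y x
  suffices hle : ∀ a ∈ U, ∀ b ∈ U, V a ≤ V b by
    have heq : ∀ a ∈ U, ∀ b ∈ U, V a = V b := fun a ha b hb => le_antisymm (hle a ha b hb) (hle b hb a ha)
    intro x y
    rcases U.eq_empty_or_nonempty with h0 | ⟨b, hb⟩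
    · exfalso
      have := hd x
      rw [h0] at this; simpa using this
    · have : V = fun _ => V b := Continuous.ext_on hd hVc continuous_const fun a ha => heq a ha b hb
      rw [this]
  intro a ha b hb
  by_contra! hlt
  set Δ0 := V a - V b with hΔ0
  have hΔp : 0 < Δ0 := by linarith
  have hab : 0 < dist a b := by
    rw [dist_pos]; rintro rfl; linarith
  have hCpos : 0 < C := by
    by_contra! hC
    have h1 := hV a b
    have h2 : C * dist a b ^ α ≤ 0 := mul_nonpos_of_nonpos_of_nonneg hC (by positivity)
    have h3 := abs_le.1 (h1.trans h2)
    linarith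
  set α' := (1 + α) / 2 with hα'
  have hα'1 : α' < 1 := by rw [hα']; linarith
  have hαα' : α < α' := by rw [hα']; linarith
  have hα'0 : 0 < α' := by linarith
  set κ := Δ0 / (4 * dist a b ^ α') with hκ
  have hκp : 0 < κ := by positivity
  have hκab : κ * dist a b ^ α' = Δ0 / 4 := by
    rw [hκ]; field_simp
  set r0 := (C / κ) ^ (1 / (α' - α)) with hr0
  have hr0p : 0 < r0 := by positivity
  have hr0b : ∀ r : ℝ, 0 < r → 0 < C * r ^ α - κ * r ^ α' → r ≤ r0 := by
    intro r hr h
    have h1 : r ^ (α' - α) ≤ C / κ := by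
      rw [Real.rpow_sub hr, div_le_div_iff₀ (by positivity) hκp]
      linarith
    calc r = (r ^ (α' - α)) ^ (1 / (α' - α)) := by
          rw [← Real.rpow_mul hr.le, mul_one_div_cancel (by linarith), Real.rpow_one]
      _ ≤ r0 := by
          rw [hr0]; apply Real.rpow_le_rpow (by positivity) h1
          apply one_div_nonneg.2; linarith
  set B := C * r0 ^ α with hB
  have hBp : 0 < B := by positivity
  set g0 := 4 * κ * α' * (1 - α') * r0 ^ (α' - 2) with hg0
  have hg0p : 0 < g0 := by
    have : 0 < 1 - α' := by linarith
    positivity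
  set ε := min (Δ0 / (4 * (ψ a + ψ b + 1))) (g0 / (4 * (|C'| + 1))) with hε
  have hψa := hψ0 a ha
  have hψb := hψ0 b hb
  have hεp : 0 < ε := lt_min (by positivity) (by positivity)
  have hε1 : ε * (ψ a + ψ b) ≤ Δ0 / 4 := by
    have h1 : ε ≤ Δ0 / (4 * (ψ a + ψ b + 1)) := min_le_left _ _
    rw [le_div_iff₀ (by positivity)] at h1
    nlinarith
  have hε2 : 2 * ε * C' < g0 := by
    have h1 : ε ≤ g0 / (4 * (|C'| + 1)) := min_le_right _ _
    rw [le_div_iff₀ (by positivity)] at h1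
    have := le_abs_self C'
    nlinarith
  set Φ : Eu N × Eu N → ℝ := fun q => V q.1 - V q.2 - κ * dist q.1 q.2 ^ α' - ε * (ψ q.1 + ψ q.2)
    with hΦ
  have hΦab : 0 < Φ (a, b) := by
    simp only [hΦ]; rw [hκab]; linarith
  have hpos : ∀ x ∈ U, ∀ y ∈ U, 0 < Φ (x, y) → 0 < dist x y ∧ dist x y ≤ r0 ∧
      ψ x ≤ B / ε ∧ ψ y ≤ B / ε := by
    intro x hx y hy h
    simp only [hΦ] at h
    have h1 := hψ0 x hx
    have h2 := hψ0 y hy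
    have h3 : 0 ≤ ε * (ψ x + ψ y) := by positivity
    have h4 : 0 ≤ κ * dist x y ^ α' := by positivity
    have h5 := (abs_le.1 (hV x y)).2
    have hpd : 0 < dist x y := by
      rw [dist_pos]; rintro rfl
      linarith
    have hr := hr0b _ hpd (by linarith)
    have h6 : C * dist x y ^ α ≤ B := by
      rw [hB]; gcongr
    refine ⟨hpd, hr, ?_, ?_⟩
    · rw [le_div_iff₀ hεp]; nlinarith
    · rw [le_div_iff₀ hεp]; nlinarith
  set S := {x ∈ U | ψ x ≤ B / ε} with hS
  have hSc : IsCompact (S ×ˢ S) := (hcomp _).prod (hcomp _)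
  have habS : (a, b) ∈ S ×ˢ S := by
    have := hpos a ha b hb hΦab
    exact ⟨⟨ha, this.2.2.1⟩, ⟨hb, this.2.2.2⟩⟩
  have hψS : ContinuousOn ψ S := hψ.continuousOn.mono fun x hx => hx.1
  have hΦc : ContinuousOn Φ (S ×ˢ S) := by
    have h1 : ContinuousOn (fun q : Eu N × Eu N => ψ q.1) (S ×ˢ S) :=
      hψS.comp continuousOn_fst fun q hq => hq.1
    have h2 : ContinuousOn (fun q : Eu N × Eu N => ψ q.2) (S ×ˢ S) :=
      hψS.comp continuousOn_snd fun q hq => hq.2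
    have h3 : Continuous (fun q : Eu N × Eu N => V q.1 - V q.2 - κ * dist q.1 q.2 ^ α') := by
      refine ((hVc.comp continuous_fst).sub (hVc.comp continuous_snd)).sub
        (continuous_const.mul ?_)
      exact (continuous_fst.dist continuous_snd).rpow_const fun _ => Or.inr hα'0.le
    exact h3.continuousOn.sub (continuousOn_const.mul (h1.add h2))
  obtain ⟨⟨xb, yb⟩, hxyS, hmax⟩ := hSc.exists_isMaxOn ⟨_, habS⟩ hΦc
  have hge : 0 < Φ (xb, yb) := lt_of_lt_of_le hΦab (hmax habS)
  have hglob : ∀ x ∈ U, ∀ y ∈ U, Φ (x, y) ≤ Φ (xb, yb) := by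
    intro x hx y hy
    by_cases h : 0 < Φ (x, y)
    · have h1 := hpos x hx y hy h
      exact hmax (show (x, y) ∈ S ×ˢ S from ⟨⟨hx, h1.2.2.1⟩, ⟨hy, h1.2.2.2⟩⟩)
    · linarith
  have hxU : xb ∈ U := hxyS.1.1
  have hyU : yb ∈ U := hxyS.2.1
  obtain ⟨hrp, hrr0, -, -⟩ := hpos xb hxU yb hyU hge
  set r := dist xb yb with hr
  set e : Eu N := r⁻¹ • (xb - yb) with he
  have hrn : ‖xb - yb‖ = r := by rw [hr, dist_eq_norm]
  have hen : ‖e‖ = 1 := by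
    rw [he, norm_smul, hrn, norm_inv, Real.norm_of_nonneg hrp.le, inv_mul_cancel₀ hrp.ne']
  have hre : xb - yb = r • e := by rw [he, smul_smul, mul_inv_cancel₀ hrp.ne', one_smul]
  set R : Eu N ≃ₗᵢ[ℝ] Eu N := Submodule.reflection (ℝ ∙ e)ᗮ with hR
  set I : Eu N ≃ₗᵢ[ℝ] Eu N := LinearIsometryEquiv.refl ℝ (Eu N) with hI
  set θ : Eu N → ℝ := fun η => V (xb + R η) - V (yb + I η) with hθ
  have hθh : LocHarm θ 0 := ((hharm xb hxU).comp R).sub ((hharm yb hyU).comp I)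
  set φ1 : Eu N → ℝ := fun η => κ * (⟪(-2 : ℝ) • e, η⟫ + r) ^ α' with hφ1
  set ψ1 : Eu N → ℝ := fun η => ψ (xb + (1:ℝ) • R η) with hψ1
  set ψ2 : Eu N → ℝ := fun η => ψ (yb + (1:ℝ) • I η) with hψ2
  have hin0 : ⟪(-2 : ℝ) • e, (0 : Eu N)⟫ + r = r := by simp
  have cφ0 : ContDiffAt ℝ 2 (fun η : Eu N => (⟪(-2 : ℝ) • e, η⟫ + r) ^ α') 0 := by
    apply ContDiffAt.rpow_const_of_ne
    · exact ((cd_inner _).add contDiff_const).contDiffAt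
    · rw [hin0]; exact hrp.ne'
  have cφ1 : ContDiffAt ℝ 2 φ1 0 := contDiffAt_const.mul cφ0
  have cx : ContDiffAt ℝ 2 ψ (xb + (1:ℝ) • R 0) := by simpa using cd_at hU hψ hxU
  have cy : ContDiffAt ℝ 2 ψ (yb + (1:ℝ) • I 0) := by simpa using cd_at hU hψ hyU
  have cψ1 : ContDiffAt ℝ 2 ψ1 0 := cd_comp_aff xb 1 R cx
  have cψ2 : ContDiffAt ℝ 2 ψ2 0 := cd_comp_aff yb 1 I cy
  have cψ : ContDiffAt ℝ 2 (fun η => ψ1 η + ψ2 η) 0 := cψ1.add cψ2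
  have cφ : ContDiffAt ℝ 2 (fun η => φ1 η + ε * (ψ1 η + ψ2 η)) 0 :=
    cφ1.add (contDiffAt_const.mul cψ)
  have htest := hθh.test cφ (by
    have e1 : ∀ᶠ η in 𝓝 (0 : Eu N), xb + R η ∈ U := by
      have : ContinuousAt (fun η : Eu N => xb + R η) 0 := by fun_prop
      exact this.eventually (by simpa using hU.mem_nhds hxU)
    have e2 : ∀ᶠ η in 𝓝 (0 : Eu N), yb + I η ∈ U := by
      have : ContinuousAt (fun η : Eu N => yb + I η) 0 := by fun_prop
      exact this.eventually (by simpa using hU.mem_nhds hyU)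
    have e3 : ∀ᶠ η in 𝓝 (0 : Eu N), 0 < ⟪(-2 : ℝ) • e, η⟫ + r := by
      have : ContinuousAt (fun η : Eu N => ⟪(-2 : ℝ) • e, η⟫ + r) 0 := by fun_prop
      exact this.eventually (lt_mem_nhds (by simpa using hrp))
    filter_upwards [e1, e2, e3] with η h1 h2 h3
    have h4 := hglob _ h1 _ h2
    have hdist : dist (xb + R η) (yb + I η) = ⟪(-2 : ℝ) • e, η⟫ + r := by
      have : xb + R η - (yb + I η) = (⟪(-2 : ℝ) • e, η⟫ + r) • e := by
        rw [hR, refl_formula e hen, hI]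
        simp only [LinearIsometryEquiv.coe_refl, id, inner_smul_left]
        have : xb + (η - (2 * ⟪e, η⟫) • e) - (yb + η) = (xb - yb) - (2 * ⟪e, η⟫) • e := by abel
        rw [this, hre, ← sub_smul]
        congr 1
        simp; ring
      rw [dist_eq_norm, this, norm_smul, hen, mul_one, Real.norm_of_nonneg h3.le]
    simp only [hΦ, hdist] at h4
    simp only [hθ, hφ1, hψ1, hψ2, one_smul, map_zero, add_zero, inner_zero_right, zero_add]
    rw [← hr] at h4
    linarith)
  rw [lapl_add cφ1 (contDiffAt_const.mul cψ), lapl_const_mul ε cψ, lapl_add cψ1 cψ2,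
    lapl_const_mul κ cφ0] at htest
  have l1 : lapl ψ1 0 ≤ C' := by
    rw [hψ1, lapl_comp_aff xb 1 R cx]
    simpa using hψl xb hxU
  have l2 : lapl ψ2 0 ≤ C' := by
    rw [hψ2, lapl_comp_aff yb 1 I cy]
    simpa using hψl yb hyU
  have l3 := lapl_ridge ((-2 : ℝ) • e) r (x := 0) (φ := fun t => t ^ α')
    (φ' := fun t => α' * t ^ (α' - 1)) (φ'' := α' * ((α' - 1) * r ^ (α' - 1 - 1)))
    (by
      rw [hin0]
      filter_upwards [lt_mem_nhds hrp] with t ht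
      exact Real.hasDerivAt_rpow_const (Or.inl ht.ne'))
    (by
      rw [hin0]
      exact (Real.hasDerivAt_rpow_const (Or.inl hrp.ne')).const_mul α')
  have hn4 : ‖(-2 : ℝ) • e‖ ^ 2 = 4 := by rw [norm_smul, hen]; norm_num
  rw [hn4] at l3
  rw [l3] at htest
  have l4 : r0 ^ (α' - 2) ≤ r ^ (α' - 1 - 1) := by
    rw [show α' - 1 - 1 = α' - 2 by ring]
    exact Real.rpow_le_rpow_of_nonpos hrp hrr0 (by linarith)
  have l5 : g0 ≤ 4 * κ * α' * (1 - α') * r ^ (α' - 1 - 1) := by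
    rw [hg0]
    have : 0 ≤ 1 - α' := by linarith
    gcongr
  have l6 : ε * (lapl ψ1 0 + lapl ψ2 0) ≤ 2 * ε * C' := by
    have := mul_le_mul_of_nonneg_left (add_le_add l1 l2) hεp.le
    linarith
  have l7 : κ * (α' * ((α' - 1) * r ^ (α' - 1 - 1)) * 4)
      = - (4 * κ * α' * (1 - α') * r ^ (α' - 1 - 1)) := by ring
  rw [l7] at htest
  linarith

theorem liouville_univ {N : ℕ} {V : Eu N → ℝ} {C α : ℝ} (hα0 : 0 < α) (hα1 : α < 1)
    (hV : ∀ x y, |V x - V y| ≤ C * dist x y ^ α) (hharm : ∀ x, LocHarm V x) :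
    ∀ x y, V x = V y := by
  refine liouville hα0 hα1 hV isOpen_univ dense_univ (ψ := fun x => ‖x - 0‖ ^ 2) (C' := 2 * N)
    (fun x _ => by positivity) (cd_normsq 0).contDiffOn (fun x _ => (lapl_normsq 0 x).le) ?_
    (fun x _ => hharm x)
  intro c
  apply Metric.isCompact_of_isClosed_isBounded
  · simp only [mem_univ, true_and]
    exact isClosed_le (by fun_prop) continuous_const
  · refine (isBounded_closedBall (x := (0 : Eu N)) (r := |c| + 1)).subset ?_
    rintro x ⟨-, hx⟩
    simp only [sub_zero] at hx
    rw [mem_closedBall_zero_iff]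
    have := le_abs_self c
    have := abs_nonneg c
    nlinarith [norm_nonneg x]

theorem liouville_codim2 {N : ℕ} {V : Eu N → ℝ} {C α : ℝ} (hα0 : 0 < α) (hα1 : α < 1)
    (hV : ∀ x y, |V x - V y| ≤ C * dist x y ^ α) {a b : Eu N} (ha : ‖a‖ = 1) (hb : ‖b‖ = 1)
    (hab : ⟪a, b⟫ = 0)
    (hharm : ∀ x, (⟪a, x⟫ ≠ 0 ∨ ⟪b, x⟫ ≠ 0) → LocHarm V x) :
    ∀ x y, V x = V y := by
  set q : Eu N → ℝ := fun x => ⟪a, x⟫ ^ 2 + ⟪b, x⟫ ^ 2 with hq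
  have hqc : Continuous q := by fun_prop
  have hq0 : ∀ x, 0 ≤ q x := fun x => by positivity
  have hqcd : ∀ x, ContDiffAt ℝ 2 q x := fun x =>
    (((cd_inner a).pow 2).add ((cd_inner b).pow 2)).contDiffAt
  have hqn : ∀ x, q x ≤ ‖x‖ ^ 2 := by
    intro x
    have h0 : 0 ≤ ‖x - (⟪a, x⟫ • a + ⟪b, x⟫ • b)‖ ^ 2 := by positivity
    rw [norm_sub_sq_real, norm_add_sq_real, inner_add_right, inner_smul_right, inner_smul_right,
      norm_smul, norm_smul, ha, hb, inner_smul_left, inner_smul_right, hab,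
      real_inner_comm a x, real_inner_comm b x] at h0
    simp only [Real.norm_eq_abs, mul_one, sq_abs] at h0
    simp only [hq]
    simp at h0
    linarith
  have hql : ∀ x, lapl q x = 4 := by
    intro x
    rw [hq, lapl_add ((cd_inner a).pow 2).contDiffAt ((cd_inner b).pow 2).contDiffAt,
      lapl_sq (cd_inner a).contDiffAt, lapl_sq (cd_inner b).contDiffAt, grad2_inner, grad2_inner,
      lapl_inner, lapl_inner, ha, hb]; norm_num
  have hqg : ∀ x, grad2 q x = 4 * q x := by
    intro x
    have hpd : ∀ k, pd (ev k) q x = 2 * ⟪⟪a, x⟫ • a + ⟪b, x⟫ • b, ev k⟫ := by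
      intro k
      have h1 : ∀ c : Eu N, pd (ev k) (fun y => ⟪c, y⟫ ^ 2) x = 2 * ⟪c, x⟫ * ⟪c, ev k⟫ := by
        intro c
        rw [pd_chain (g := fun y => ⟪c, y⟫) (φ := fun t => t ^ 2) (a := 2 * ⟪c, x⟫)
          (by simpa using hasDerivAt_pow 2 (⟪c, x⟫))
          ((cd_inner (n := 1) c).differentiable (by norm_num) x), pd_inner]
      have h2 : pd (ev k) q x = pd (ev k) (fun y => ⟪a, y⟫ ^ 2) x + pd (ev k) (fun y => ⟪b, y⟫ ^ 2) x := by
        simp only [pd, hq]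
        rw [fderiv_fun_add]
        · simp
        · exact ((cd_inner (n := 1) a).pow 2).differentiable (by norm_num) x
        · exact ((cd_inner (n := 1) b).pow 2).differentiable (by norm_num) x
      rw [h2, h1, h1, inner_add_left, inner_smul_left, inner_smul_left]
      simp; ring
    simp only [grad2, hpd, mul_pow]
    rw [← Finset.mul_sum, sum_inner_ev_sq, norm_add_sq_real, norm_smul, norm_smul, ha, hb,
      inner_smul_left, inner_smul_right, hab]
    simp only [hq, mul_zero, mul_one, Real.norm_eq_abs, sq_abs, add_zero]; norm_num
  set U : Set (Eu N) := {x | 0 < q x} with hU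
  have hUo : IsOpen U := isOpen_lt continuous_const hqc
  set ψ : Eu N → ℝ := fun x => ‖x - 0‖ ^ 2 - 1 / 2 * Real.log (q x) with hψ
  have hlogle : ∀ x ∈ U, Real.log (q x) ≤ q x - 1 := fun x hx => Real.log_le_sub_one_of_pos hx
  have clog : ∀ x ∈ U, ContDiffAt ℝ 2 (fun x => Real.log (q x)) x := fun x hx =>
    (hqcd x).log (ne_of_gt hx)
  have hψcd : ∀ x ∈ U, ContDiffAt ℝ 2 ψ x := fun x hx =>
    (cd_normsq 0).contDiffAt.sub (contDiffAt_const.mul (clog x hx))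
  have hψon : ContDiffOn ℝ 2 ψ U := fun x hx => (hψcd x hx).contDiffWithinAt
  refine liouville hα0 hα1 hV hUo ?_ (ψ := ψ) (C' := 2 * N) ?_ hψon ?_ ?_ ?_
  · -- dense
    intro x
    rw [mem_closure_iff_nhds]
    intro t ht
    have hc : ContinuousAt (fun s : ℝ => x + s • a) 0 := by fun_prop
    have h1 : ∀ᶠ s in 𝓝 (0:ℝ), x + s • a ∈ t := hc.eventually (by simpa using ht)
    have h2 : ∃ᶠ s in 𝓝 (0:ℝ), ⟪a, x⟫ + s ≠ 0 := by
      have h3 : ∃ᶠ s in 𝓝 (0:ℝ), s ≠ - ⟪a, x⟫ := by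
        intro h4
        simp only [not_not] at h4
        have h5 : ({- ⟪a, x⟫} : Set ℝ) ∈ 𝓝 (0:ℝ) := by
          filter_upwards [h4] with s hs
          simpa using hs
        have h6 : (0 : ℝ) = - ⟪a, x⟫ := by simpa using mem_of_mem_nhds h5
        rw [← h6] at h5
        obtain ⟨ε, hε, hb⟩ := Metric.mem_nhds_iff.1 h5
        have : ε / 2 ∈ ({0} : Set ℝ) := hb (by
          rw [mem_ball, Real.dist_eq, sub_zero, abs_of_pos (by linarith)]; linarith)
        simp at this; linarith
      refine h3.mono fun s hs h => hs (by linarith)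
    obtain ⟨s, hs1, hs2⟩ := (h2.and_eventually h1).exists
    refine ⟨x + s • a, hs2, ?_⟩
    have : ⟪a, x + s • a⟫ ≠ 0 := by
      rw [inner_add_right, inner_smul_right, real_inner_self_eq_norm_sq, ha]; simpa using hs1
    simp only [hU, mem_setOf_eq, hq]
    positivity
  · intro x hx
    have := hlogle x hx
    have := hqn x
    have := hq0 x
    simp only [hψ, sub_zero]; linarith
  · intro x hx
    rw [hψ, lapl_sub (cd_normsq 0).contDiffAt (contDiffAt_const.mul (clog x hx)), lapl_normsq,
      lapl_const_mul _ (clog x hx)]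
    have hx' : 0 < q x := hx
    have := lapl_chain (g := q) (x := x) (φ := Real.log) (φ' := fun t => t⁻¹)
      (φ'' := -(q x ^ 2)⁻¹)
      (by
        filter_upwards [lt_mem_nhds hx'] with t ht
        exact Real.hasDerivAt_log ht.ne')
      (hasDerivAt_inv hx'.ne') (hqcd x)
    rw [this, hqg, hql]
    apply le_of_eq
    field_simp
    ring
  · intro c
    apply Metric.isCompact_of_isClosed_isBounded
    · have : {x | x ∈ U ∧ ψ x ≤ c} = {x | Real.exp (- (2 * c)) ≤ q x} ∩ {x | ψ x ≤ c} ∩ {x | Real.exp (- (2 * c)) ≤ q x} := by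
        ext x
        simp only [mem_setOf_eq, mem_inter_iff]
        constructor
        · rintro ⟨h1, h2⟩
          have h3 : Real.exp (- (2 * c)) ≤ q x := by
            rw [← Real.le_log_iff_exp_le h1]
            simp only [hψ] at h2
            nlinarith [sq_nonneg ‖x - 0‖]
          exact ⟨⟨h3, h2⟩, h3⟩
        · rintro ⟨⟨h1, h2⟩, -⟩
          exact ⟨lt_of_lt_of_le (Real.exp_pos _) h1, h2⟩
      rw [this, inter_assoc, inter_comm {x | ψ x ≤ c}, ← inter_assoc, inter_self]
      have hcl : IsClosed {x | Real.exp (- (2 * c)) ≤ q x} := isClosed_le continuous_const hqc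
      have hco : ContinuousOn ψ {x | Real.exp (- (2 * c)) ≤ q x} :=
        hψon.continuousOn.mono fun x hx => lt_of_lt_of_le (Real.exp_pos _) hx
      exact hco.preimage_isClosed_of_isClosed hcl isClosed_Iic
    · refine (isBounded_closedBall (x := (0 : Eu N)) (r := 2 * |c| + 1)).subset ?_
      rintro x ⟨h1, hx⟩
      have h2 := hlogle x h1
      have h3 := hqn x
      simp only [hψ, sub_zero] at hx
      rw [mem_closedBall_zero_iff]
      have := le_abs_self c
      have := abs_nonneg c
      nlinarith [norm_nonneg x]
  · intro x hx
    apply hharm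
    by_contra! h
    have : q x = 0 := by simp [hq, h.1, h.2]
    have hx' : 0 < q x := hx
    linarith

end

section

structure CplOK {d : ℕ} (A : Fin d → Fin d → ℝ) (g : Fin d → ℕ) : Prop where
  symm : ∀ i j, A i j = A j i
  zero : ∀ i j, i ≠ j → g i = g j → A i j = 0
  pos : ∀ i j, g i ≠ g j → 0 < A i j

lemma CplOK.nonneg {d : ℕ} {A : Fin d → Fin d → ℝ} {g : Fin d → ℕ} (h : CplOK A g) {i j : Fin d}
    (hij : i ≠ j) : 0 ≤ A i j := by
  by_cases hg : g i = g j
  · rw [h.zero i j hij hg]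
  · exact (h.pos i j hg).le

/-- the coupling term -/
def coup {d : ℕ} (A : Fin d → Fin d → ℝ) (p : ℝ) (s : Fin d → ℝ) (i : Fin d) : ℝ :=
  ∑ j ∈ Finset.univ.erase i, A i j * s i * |s i| ^ (p - 1) * |s j| ^ (p + 1)

/-- the potential -/
def Wf {d : ℕ} (A : Fin d → Fin d → ℝ) (p : ℝ) (s : Fin d → ℝ) : ℝ :=
  (1 / (2 * (p + 1))) * ∑ i, ∑ j ∈ Finset.univ.erase i, A i j * (|s i| ^ (p + 1) * |s j| ^ (p + 1))

lemma mul_mul_abs {p : ℝ} (hp : 0 < p) (t : ℝ) : t * (t * |t| ^ (p - 1)) = |t| ^ (p + 1) := by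
  by_cases h : t = 0
  · subst h
    rw [abs_zero, Real.zero_rpow (show p + 1 ≠ 0 by linarith)]; simp
  · have h1 : 0 < |t| := abs_pos.2 h
    rw [show p + 1 = (p - 1) + 2 by ring, Real.rpow_add h1, Real.rpow_two, sq_abs]; ring

lemma abs_mul_abs {p : ℝ} (hp : 0 < p) (t : ℝ) : |t * |t| ^ (p - 1)| = |t| ^ p := by
  by_cases h : t = 0
  · subst h
    rw [abs_zero, Real.zero_rpow hp.ne']; simp
  · have h1 : 0 < |t| := abs_pos.2 h
    rw [abs_mul, abs_of_pos (Real.rpow_pos_of_pos h1 _)]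
    nth_rewrite 1 [← Real.rpow_one |t|]
    rw [← Real.rpow_add h1]; congr 1; ring

lemma sum_mul_coup {d : ℕ} (A : Fin d → Fin d → ℝ) {p : ℝ} (hp : 0 < p) (s : Fin d → ℝ) :
    ∑ i, s i * coup A p s i = (2 * p + 2) * Wf A p s := by
  have h1 : (2 * p + 2) * Wf A p s
      = ∑ i, ∑ j ∈ Finset.univ.erase i, A i j * (|s i| ^ (p + 1) * |s j| ^ (p + 1)) := by
    unfold Wf
    rw [← mul_assoc, show (2 * p + 2) * (1 / (2 * (p + 1))) = 1 by field_simp, one_mul]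
  rw [h1]
  refine Finset.sum_congr rfl fun i _ => ?_
  rw [coup, Finset.mul_sum]
  refine Finset.sum_congr rfl fun j _ => ?_
  rw [← mul_mul_abs hp (s i)]; ring

lemma Wf_nonneg {d : ℕ} {A : Fin d → Fin d → ℝ} {g : Fin d → ℕ} (h : CplOK A g) {p : ℝ}
    (hp : 0 < p) (s : Fin d → ℝ) : 0 ≤ Wf A p s := by
  unfold Wf
  apply mul_nonneg (by positivity)
  refine Finset.sum_nonneg fun i _ => Finset.sum_nonneg fun j hj => ?_
  have := h.nonneg (Finset.ne_of_mem_erase hj).symm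
  positivity

lemma Wf_continuous {d : ℕ} (A : Fin d → Fin d → ℝ) {p : ℝ} (hp : 0 < p) :
    Continuous (Wf A p) := by
  unfold Wf
  refine continuous_const.mul (continuous_finset_sum _ fun i _ => continuous_finset_sum _ fun j _ =>
    continuous_const.mul ?_)
  have : ∀ k : Fin d, Continuous fun s : Fin d → ℝ => |s k| ^ (p + 1) := fun k =>
    (continuous_apply k).abs.rpow_const fun _ => Or.inr (by linarith)
  exact (this i).mul (this j)

lemma hasFDerivAt_Wf {N d : ℕ} {A : Fin d → Fin d → ℝ} {g : Fin d → ℕ} (hA : CplOK A g) {p : ℝ}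
    (hp : 0 < p) {v : Fin d → Eu N → ℝ} {x : Eu N} (hv : ∀ i, DifferentiableAt ℝ (v i) x)
    (e : Eu N) :
    pd e (fun y => Wf A p fun j => v j y) x = ∑ i, coup A p (fun j => v j x) i * pd e (v i) x := by
  have h1 : ∀ i, HasFDerivAt (fun y => |v i y| ^ (p + 1))
      (((p + 1) * |v i x| ^ (p - 1) * v i x) • fderiv ℝ (v i) x) x := by
    intro i
    have := (hasDerivAt_abs_rpow (v i x) (show 1 < p + 1 by linarith)).comp_hasFDerivAt x
      (hv i).hasFDerivAt
    rw [show p + 1 - 2 = p - 1 by ring] at this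
    exact this
  have h2 : HasFDerivAt (fun y => Wf A p fun j => v j y) _ x :=
    (HasFDerivAt.fun_sum fun i (_ : i ∈ Finset.univ) => HasFDerivAt.fun_sum
      fun j (_ : j ∈ Finset.univ.erase i) =>
        ((h1 i).mul (h1 j)).const_mul (A i j)).const_mul (1 / (2 * (p + 1)))
  unfold pd
  rw [h2.fderiv]
  simp only [_root_.smul_apply, ContinuousLinearMap.sum_apply, ContinuousLinearMap.add_apply,
    smul_eq_mul]
  set t : Fin d → Fin d → ℝ := fun i j =>
    A i j * (v i x * |v i x| ^ (p - 1)) * |v j x| ^ (p + 1) * fderiv ℝ (v i) x e with ht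
  have hL : ∀ i, ∑ j ∈ Finset.univ.erase i, A i j * (|v i x| ^ (p + 1) *
      ((p + 1) * |v j x| ^ (p - 1) * v j x * fderiv ℝ (v j) x e) +
      |v j x| ^ (p + 1) * ((p + 1) * |v i x| ^ (p - 1) * v i x * fderiv ℝ (v i) x e))
      = (p + 1) * (∑ j ∈ Finset.univ.erase i, t j i + ∑ j ∈ Finset.univ.erase i, t i j) := by
    intro i
    rw [← Finset.sum_add_distrib, Finset.mul_sum]
    refine Finset.sum_congr rfl fun j _ => ?_
    simp only [ht]
    rw [hA.symm j i]; ring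
  rw [Finset.sum_congr rfl fun i _ => hL i, ← Finset.mul_sum, Finset.sum_add_distrib]
  have hsw : ∑ i, ∑ j ∈ Finset.univ.erase i, t j i = ∑ i, ∑ j ∈ Finset.univ.erase i, t i j := by
    apply Finset.sum_comm'
    intro a b
    simp [eq_comm]
  rw [hsw, ← two_mul]
  have hR : ∀ i, coup A p (fun j => v j x) i * fderiv ℝ (v i) x e = ∑ j ∈ Finset.univ.erase i, t i j := by
    intro i
    rw [coup, Finset.sum_mul]
    refine Finset.sum_congr rfl fun j _ => ?_
    simp only [ht]; ring
  rw [Finset.sum_congr rfl fun i _ => hR i]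
  field_simp

lemma cd_Wf {N d : ℕ} (A : Fin d → Fin d → ℝ) {p : ℝ}
    (hp : 0 < p) {v : Fin d → Eu N → ℝ} {s : Set (Eu N)} (hv : ∀ i, ContDiffOn ℝ 2 (v i) s) :
    ContDiffOn ℝ 1 (fun y => Wf A p fun j => v j y) s := by
  have h1 : ∀ i, ContDiffOn ℝ 1 (fun y => |v i y| ^ (p + 1)) s := by
    intro i
    have h2 : ContDiff ℝ 1 fun t : ℝ => ‖t‖ ^ (p + 1) := contDiff_norm_rpow (by linarith)
    exact h2.comp_contDiffOn ((hv i).of_le (by norm_num))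
  unfold Wf
  exact contDiffOn_const.mul (ContDiffOn.sum fun i _ => ContDiffOn.sum fun j _ =>
    contDiffOn_const.mul ((h1 i).mul (h1 j)))

lemma coup_scale {d : ℕ} (A : Fin d → Fin d → ℝ) {p : ℝ} (s : Fin d → ℝ) {l : ℝ}
    (hl : 0 < l) (i : Fin d) :
    l ^ (2 * p) * coup A p (fun j => s j / l) i = coup A p s i / l := by
  unfold coup
  rw [Finset.mul_sum, Finset.sum_div]
  refine Finset.sum_congr rfl fun j _ => ?_
  rw [abs_div, abs_div, abs_of_pos hl, Real.div_rpow (abs_nonneg _) hl.le,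
    Real.div_rpow (abs_nonneg _) hl.le]
  have : l ^ (2 * p) = l ^ (p - 1) * l ^ (p + 1) := by
    rw [← Real.rpow_add hl]; congr 1; ring
  rw [this]
  have h1 := Real.rpow_pos_of_pos hl (p - 1)
  have h2 := Real.rpow_pos_of_pos hl (p + 1)
  field_simp

lemma abs_coup_le {d : ℕ} (A : Fin d → Fin d → ℝ) {p : ℝ} (hp : 0 < p) (s : Fin d → ℝ) {B : ℝ}
    (hB : ∀ j, |s j| ≤ B) (i : Fin d) :
    |coup A p s i| ≤ (∑ k, ∑ j, |A k j|) * (B ^ p * B ^ (p + 1)) := by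
  have hB0 : 0 ≤ B := (abs_nonneg _).trans (hB i)
  have h1 : |coup A p s i| ≤ ∑ j, |A i j| * (B ^ p * B ^ (p + 1)) := by
    unfold coup
    refine (Finset.abs_sum_le_sum_abs _ _).trans ?_
    refine (Finset.sum_le_sum_of_subset_of_nonneg (Finset.erase_subset _ _)
      fun _ _ _ => abs_nonneg _).trans (Finset.sum_le_sum fun j _ => ?_)
    rw [show A i j * s i * |s i| ^ (p - 1) * |s j| ^ (p + 1)
      = A i j * ((s i * |s i| ^ (p - 1)) * |s j| ^ (p + 1)) by ring, abs_mul, abs_mul,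
      abs_mul_abs hp, abs_of_nonneg (Real.rpow_nonneg (abs_nonneg (s j)) _)]
    have := hB i
    have := hB j
    gcongr
  refine h1.trans ?_
  rw [← Finset.sum_mul]
  apply mul_le_mul_of_nonneg_right _ (by positivity)
  exact Finset.single_le_sum (f := fun k => ∑ j, |A k j|)
    (fun k _ => Finset.sum_nonneg fun j _ => abs_nonneg _) (Finset.mem_univ i)

/-- approximate solutions -/
def ASOn {N d : ℕ} (A : Fin d → Fin d → ℝ) (p M ε : ℝ) (S : Set (Eu N))
    (v : Fin d → Eu N → ℝ) : Prop :=
  ∀ i, ContDiffOn ℝ 2 (v i) S ∧ ∀ x ∈ S, |lapl (v i) x - M * coup A p (fun j => v j x) i| ≤ ε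

lemma ASOn.mono {N d : ℕ} {A : Fin d → Fin d → ℝ} {p M ε ε' : ℝ} {S S' : Set (Eu N)}
    {v : Fin d → Eu N → ℝ} (h : ASOn A p M ε S v) (hε : ε ≤ ε') (hS : S' ⊆ S) :
    ASOn A p M ε' S' v := fun i =>
  ⟨(h i).1.mono hS, fun x hx => ((h i).2 x (hS hx)).trans hε⟩

lemma ASOn.rescale {N d : ℕ} {A : Fin d → Fin d → ℝ} {p M ε : ℝ} {S : Set (Eu N)} (hS : IsOpen S)
    {v : Fin d → Eu N → ℝ} (h : ASOn A p M ε S v) (x0 : Eu N) (r : ℝ) {l : ℝ} (hl : 0 < l)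
    {S' : Set (Eu N)} (hS' : ∀ x ∈ S', x0 + r • x ∈ S) :
    ASOn A p (M * r ^ 2 * l ^ (2 * p)) (ε * r ^ 2 / l) S' (fun i x => v i (x0 + r • x) / l) := by
  intro i
  have hc : ∀ x ∈ S', ContDiffAt ℝ 2 (fun z => v i (x0 + r • z)) x := fun x hx =>
    cd_comp_scale x0 r (cd_at hS (h i).1 (hS' x hx))
  refine ⟨fun x hx => ((hc x hx).div_const l).contDiffWithinAt, fun x hx => ?_⟩
  have h1 : lapl (fun x => v i (x0 + r • x) / l) x = l⁻¹ * (r ^ 2 * lapl (v i) (x0 + r • x)) := by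
    rw [← lapl_comp_scale x0 r (cd_at hS (h i).1 (hS' x hx)), ← lapl_const_mul _ (hc x hx)]
    congr 1; ext y; rw [div_eq_inv_mul]
  have h2 := (h i).2 _ (hS' x hx)
  have h3 := coup_scale A (p := p) (fun j => v j (x0 + r • x)) hl i
  rw [h1, mul_assoc (M * r ^ 2), h3]
  have : l⁻¹ * (r ^ 2 * lapl (v i) (x0 + r • x)) -
      M * r ^ 2 * (coup A p (fun j => v j (x0 + r • x)) i / l)
      = (lapl (v i) (x0 + r • x) - M * coup A p (fun j => v j (x0 + r • x)) i) * (r ^ 2 / l) := by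
    field_simp
  rw [this, abs_mul, abs_of_nonneg (show 0 ≤ r ^ 2 / l by positivity), mul_div_assoc]
  gcongr

lemma lemmaA {N d : ℕ} {A : Fin d → Fin d → ℝ} {g : Fin d → ℕ} (hA : CplOK A g) {p : ℝ}
    (hp : 0 < p) {M ε : ℝ} (hM : 0 ≤ M) {x0 : Eu N} {ρ : ℝ} (hρ : 0 < ρ)
    {v : Fin d → Eu N → ℝ} (h : ASOn A p M ε (ball x0 ρ) v) {i j : Fin d} (hij : g i ≠ g j)
    {s ω : ℝ} (hs : 0 < s) (hω : 0 < ω) (hj : ∀ x ∈ ball x0 ρ, s ≤ |v j x|)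
    (hi : ∀ x ∈ ball x0 ρ, |v i x - v i x0| ≤ ω) :
    M * A i j * s ^ (p + 1) * |v i x0| ^ p ≤ ε + 16 * N * ω / ρ ^ 2 := by
  have hε : 0 ≤ ε := (abs_nonneg _).trans ((h i).2 x0 (mem_ball_self hρ))
  by_cases h0 : v i x0 = 0
  · rw [h0, abs_zero, Real.zero_rpow hp.ne', mul_zero]
    positivity
  obtain ⟨τ, hτ, hτ1⟩ : ∃ τ : ℝ, τ * v i x0 = |v i x0| ∧ (τ = 1 ∨ τ = -1) := by
    rcases le_total 0 (v i x0) with h1 | h1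
    · exact ⟨1, by rw [abs_of_nonneg h1, one_mul], Or.inl rfl⟩
    · exact ⟨-1, by rw [abs_of_nonpos h1]; ring, Or.inr rfl⟩
  have hτa : |τ| = 1 := by rcases hτ1 with rfl | rfl <;> simp
  set a := |v i x0| with ha
  have hap : 0 < a := abs_pos.2 h0
  set c := 8 * ω / ρ ^ 2 with hc
  set ψ : Eu N → ℝ := fun x => τ * v i x - c * ‖x - x0‖ ^ 2 with hψ
  have hsub : closedBall x0 (ρ / 2) ⊆ ball x0 ρ := closedBall_subset_ball (by linarith)
  have cv : ∀ x ∈ ball x0 ρ, ContDiffAt ℝ 2 (v i) x := fun x hx => cd_at isOpen_ball (h i).1 hx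
  have cψ : ∀ x ∈ ball x0 ρ, ContDiffAt ℝ 2 ψ x := fun x hx =>
    (contDiffAt_const.mul (cv x hx)).sub (contDiffAt_const.mul (cd_normsq x0).contDiffAt)
  obtain ⟨z, hz, hzm⟩ := (isCompact_closedBall x0 (ρ / 2)).exists_isMaxOn
    ⟨x0, mem_closedBall_self (by linarith)⟩
    (fun x hx => (cψ x (hsub hx)).continuousAt.continuousWithinAt)
  have hx0 := hzm (mem_closedBall_self (by linarith))
  simp only [hψ, mem_setOf_eq, sub_self, norm_zero, hτ] at hx0
  have hzb := hsub hz
  have hd : τ * v i z - a ≤ ω := by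
    rw [← hτ, ← mul_sub]
    calc _ ≤ |τ * (v i z - v i x0)| := le_abs_self _
      _ ≤ ω := by rw [abs_mul, hτa, one_mul]; exact hi z hzb
  have hzin : z ∈ ball x0 (ρ / 2) := by
    rw [mem_ball, dist_eq_norm]
    by_contra! hge
    have h5 : (ρ / 2) ^ 2 ≤ ‖z - x0‖ ^ 2 := by gcongr
    have h6 : c * (ρ / 2) ^ 2 ≤ c * ‖z - x0‖ ^ 2 := by gcongr
    have h7 : c * (ρ / 2) ^ 2 = 2 * ω := by rw [hc]; field_simp; norm_num
    linarith
  have hloc : IsLocalMax ψ z :=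
    hzm.isLocalMax (mem_of_superset (isOpen_ball.mem_nhds hzin) ball_subset_closedBall)
  have hl := lapl_nonpos_of_max (cψ z hzb) hloc
  rw [hψ, lapl_sub (contDiffAt_const.mul (cv z hzb)) (contDiffAt_const.mul (cd_normsq x0).contDiffAt),
    lapl_const_mul _ (cv z hzb), lapl_const_mul c (cd_normsq x0).contDiffAt, lapl_normsq] at hl
  have hza : a ≤ τ * v i z := by
    have : 0 ≤ c * ‖z - x0‖ ^ 2 := by positivity
    linarith
  have habs : |v i z| = τ * v i z := by
    have : |τ * v i z| = |v i z| := by rw [abs_mul, hτa, one_mul]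
    rw [← this, abs_of_nonneg (by linarith)]
  have hcoup : A i j * s ^ (p + 1) * a ^ p ≤ τ * coup A p (fun k => v k z) i := by
    unfold coup
    rw [Finset.mul_sum]
    have hterm : ∀ k, τ * (A i k * v i z * |v i z| ^ (p - 1) * |v k z| ^ (p + 1))
        = A i k * |v i z| ^ p * |v k z| ^ (p + 1) := by
      intro k
      have hpos : 0 < |v i z| := by rw [habs]; linarith
      have : |v i z| ^ p = |v i z| * |v i z| ^ (p - 1) := by
        nth_rewrite 2 [← Real.rpow_one |v i z|]
        rw [← Real.rpow_add hpos]; congr 1; ring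
      rw [this]
      nth_rewrite 2 [habs]
      ring
    rw [Finset.sum_congr rfl fun k _ => hterm k]
    have hji : j ∈ Finset.univ.erase i := by
      rw [Finset.mem_erase]; exact ⟨fun h => hij (by rw [h]), Finset.mem_univ _⟩
    refine le_trans ?_ (Finset.single_le_sum (f := fun k => A i k * |v i z| ^ p * |v k z| ^ (p + 1))
      (fun k hk => ?_) hji)
    · have h1 : a ^ p ≤ |v i z| ^ p := by
        rw [habs]; exact Real.rpow_le_rpow hap.le hza hp.le
      have h2 : s ^ (p + 1) ≤ |v j z| ^ (p + 1) :=
        Real.rpow_le_rpow hs.le (hj z hzb) (by linarith)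
      have h3 := hA.pos i j hij
      calc A i j * s ^ (p + 1) * a ^ p = A i j * a ^ p * s ^ (p + 1) := by ring
        _ ≤ _ := by gcongr
    · have := hA.nonneg (Finset.ne_of_mem_erase hk).symm
      positivity
  have h3 : τ * (M * coup A p (fun k => v k z) i) - ε ≤ τ * lapl (v i) z := by
    have h4 := (h i).2 z hzb
    have h5 : |τ * (M * coup A p (fun k => v k z) i - lapl (v i) z)| ≤ ε := by
      rw [abs_mul, hτa, one_mul, abs_sub_comm]; exact h4
    have := (abs_le.1 h5).2
    linarith
  have h4 := mul_le_mul_of_nonneg_left hcoup hM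
  have h5 : c * (2 * N) = 16 * N * ω / ρ ^ 2 := by rw [hc]; ring
  nlinarith

lemma lemmaB {d : ℕ} {A : Fin d → Fin d → ℝ} {g : Fin d → ℕ} (hA : CplOK A g) {p : ℝ}
    (hp : 0 < p) {M : ℝ} (hM : 0 ≤ M) {s : Fin d → ℝ} {σ B δ : ℝ} (hσ : 0 < σ) (hB : 0 < B)
    (hb : ∀ l, |s l| ≤ B * σ) {j : Fin d}
    (hδ : ∀ i, g i ≠ g j → M * σ ^ (p + 1) * |s i| ^ p ≤ δ) (hδ0 : 0 ≤ δ) (k : Fin d) :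
    |M * coup A p s k| ≤ (∑ a, ∑ b, |A a b|) * B ^ (p + 1) * δ := by
  have key : ∀ l ∈ Finset.univ.erase k,
      |M * (A k l * s k * |s k| ^ (p - 1) * |s l| ^ (p + 1))| ≤ |A k l| * B ^ (p + 1) * δ := by
    intro l hl
    have hkl : k ≠ l := (Finset.ne_of_mem_erase hl).symm
    have e1 : |M * (A k l * s k * |s k| ^ (p - 1) * |s l| ^ (p + 1))|
        = |A k l| * (M * |s k| ^ p * |s l| ^ (p + 1)) := by
      rw [show M * (A k l * s k * |s k| ^ (p - 1) * |s l| ^ (p + 1))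
        = A k l * (M * ((s k * |s k| ^ (p - 1)) * |s l| ^ (p + 1))) by ring, abs_mul, abs_mul, abs_mul,
        abs_mul_abs hp, abs_of_nonneg (Real.rpow_nonneg (abs_nonneg (s l)) _), abs_of_nonneg hM]
      ring
    rw [e1]
    by_cases hg : g k = g l
    · rw [hA.zero k l hkl hg]; simp
    rw [mul_assoc |A k l| (B ^ (p+1)) δ]
    apply mul_le_mul_of_nonneg_left _ (abs_nonneg _)
    have hBσ : (B * σ) ^ (p + 1) = B ^ (p + 1) * σ ^ (p + 1) := Real.mul_rpow hB.le hσ.le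
    by_cases hkj : g k = g j
    · have hlj : g l ≠ g j := fun h => hg (hkj.trans h.symm)
      have e2 : |s k| ^ p * |s l| ^ (p + 1) ≤ (B * σ) ^ (p + 1) * |s l| ^ p := by
        by_cases hl0 : s l = 0
        · rw [hl0, abs_zero, Real.zero_rpow (by linarith), Real.zero_rpow hp.ne']; simp
        have hlp : 0 < |s l| := abs_pos.2 hl0
        rw [Real.rpow_add hlp, Real.rpow_one, Real.rpow_add (by positivity), Real.rpow_one]
        have h1 : |s k| ^ p ≤ (B * σ) ^ p := Real.rpow_le_rpow (abs_nonneg _) (hb k) hp.le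
        calc |s k| ^ p * (|s l| ^ p * |s l|) ≤ (B * σ) ^ p * (|s l| ^ p * (B * σ)) := by
              gcongr; exact hb l
          _ = _ := by ring
      calc M * |s k| ^ p * |s l| ^ (p + 1) = M * (|s k| ^ p * |s l| ^ (p + 1)) := by ring
        _ ≤ M * ((B * σ) ^ (p + 1) * |s l| ^ p) := by gcongr
        _ = B ^ (p + 1) * (M * σ ^ (p + 1) * |s l| ^ p) := by rw [hBσ]; ring
        _ ≤ B ^ (p + 1) * δ := by gcongr; exact hδ l hlj
    · have h1 : |s l| ^ (p + 1) ≤ (B * σ) ^ (p + 1) :=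
        Real.rpow_le_rpow (abs_nonneg _) (hb l) (by linarith)
      calc M * |s k| ^ p * |s l| ^ (p + 1) ≤ M * |s k| ^ p * (B * σ) ^ (p + 1) := by gcongr
        _ = B ^ (p + 1) * (M * σ ^ (p + 1) * |s k| ^ p) := by rw [hBσ]; ring
        _ ≤ B ^ (p + 1) * δ := by gcongr; exact hδ k hkj
  unfold coup
  rw [Finset.mul_sum]
  refine (Finset.abs_sum_le_sum_abs _ _).trans ((Finset.sum_le_sum key).trans ?_)
  rw [← Finset.sum_mul, ← Finset.sum_mul]
  have h1 : ∑ l ∈ Finset.univ.erase k, |A k l| ≤ ∑ a, ∑ b, |A a b| :=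
    (Finset.sum_le_sum_of_subset_of_nonneg (Finset.erase_subset _ _)
      fun _ _ _ => abs_nonneg _).trans
      (Finset.single_le_sum (f := fun k => ∑ j, |A k j|)
        (fun k _ => Finset.sum_nonneg fun j _ => abs_nonneg _) (Finset.mem_univ k))
  gcongr

end

section

/-- the weight `(τ - |x|²)_+^k` -/
def wt {N : ℕ} (τ : ℝ) (k : ℕ) (x : Eu N) : ℝ := (max (τ - ‖x‖ ^ 2) 0) ^ k

lemma hasDerivAt_maxpow (m : ℕ) (s : ℝ) :
    HasDerivAt (fun s : ℝ => (max s 0) ^ (m + 2)) ((m + 2 : ℕ) * (max s 0) ^ (m + 1)) s := by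
  rcases lt_trichotomy s 0 with h | h | h
  · rw [max_eq_right h.le]
    have : (fun s : ℝ => (max s 0) ^ (m + 2)) =ᶠ[𝓝 s] fun _ => 0 := by
      filter_upwards [gt_mem_nhds h] with t ht
      rw [max_eq_right ht.le]; simp
    simpa using (hasDerivAt_const s (0:ℝ)).congr_of_eventuallyEq this
  · subst h
    rw [hasDerivAt_iff_isLittleO]
    simp only [max_self, ne_eq, Nat.add_eq_zero_iff, one_ne_zero, and_false, not_false_eq_true, zero_pow, OfNat.ofNat_ne_zero,
      sub_zero, mul_zero, smul_zero]
    have h1 : (fun t : ℝ => t ^ (m + 2)) =o[𝓝 0] fun t : ℝ => t := by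
      have := Asymptotics.isLittleO_pow_pow (𝕜 := ℝ) (show 1 < m + 2 by omega)
      simpa using this
    refine Asymptotics.IsBigO.trans_isLittleO ?_ h1
    refine Asymptotics.IsBigO.of_bound 1 (Eventually.of_forall fun t => ?_)
    rw [one_mul, norm_pow, norm_pow]
    gcongr
    rw [Real.norm_eq_abs, Real.norm_eq_abs, abs_of_nonneg (le_max_right _ _)]
    exact max_le (le_abs_self _) (abs_nonneg _)
  · rw [max_eq_left h.le]
    have : (fun s : ℝ => (max s 0) ^ (m + 2)) =ᶠ[𝓝 s] fun s => s ^ (m + 2) := by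
      filter_upwards [lt_mem_nhds h] with t ht
      rw [max_eq_left ht.le]
    simpa using (hasDerivAt_pow (m + 2) s).congr_of_eventuallyEq this

lemma wt_nonneg {N : ℕ} (τ : ℝ) (k : ℕ) (x : Eu N) : 0 ≤ wt τ k x :=
  pow_nonneg (le_max_right _ _) _

lemma wt_continuous {N : ℕ} (τ : ℝ) (k : ℕ) : Continuous (wt τ k : Eu N → ℝ) := by
  unfold wt; fun_prop

lemma wt_zero {N : ℕ} {τ : ℝ} {k : ℕ} {x : Eu N} (h : τ ≤ ‖x‖ ^ 2) : wt τ (k + 1) x = 0 := by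
  unfold wt; rw [max_eq_right (by linarith)]; simp

lemma wt_pos {N : ℕ} {τ : ℝ} {k : ℕ} {x : Eu N} (h : ‖x‖ ^ 2 < τ) : 0 < wt τ k x := by
  unfold wt; rw [max_eq_left (by linarith)]; exact pow_pos (by linarith) _

lemma wt_mul {N : ℕ} (τ : ℝ) (k : ℕ) (x : Eu N) :
    wt τ (k + 1) x * ‖x‖ ^ 2 = τ * wt τ (k + 1) x - wt τ (k + 2) x := by
  rcases le_total τ (‖x‖ ^ 2) with h | h
  · rw [wt_zero h, show k + 2 = (k + 1) + 1 from rfl, wt_zero h]; simp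
  · unfold wt; rw [max_eq_left (by linarith)]; ring

lemma wt_le {N : ℕ} {τ : ℝ} (hτ : 0 ≤ τ) (k : ℕ) (x : Eu N) : wt τ k x ≤ τ ^ k := by
  unfold wt
  have : 0 ≤ ‖x‖ ^ 2 := by positivity
  exact pow_le_pow_left₀ (le_max_right _ _) (max_le (by linarith) hτ) _

lemma pd_wt {N : ℕ} (τ : ℝ) (m : ℕ) (x : Eu N) :
    HasFDerivAt (wt τ (m + 2) : Eu N → ℝ)
      ((((m + 2 : ℕ) : ℝ) * wt τ (m + 1) x) • (-(2 • innerSL ℝ x : Eu N →L[ℝ] ℝ))) x := by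
  have h1 : HasFDerivAt (fun y : Eu N => τ - ‖y‖ ^ 2) (-(2 • innerSL ℝ x)) x := by
    have := (hasStrictFDerivAt_norm_sq x).hasFDerivAt.const_sub τ
    simpa using this
  exact (hasDerivAt_maxpow m (τ - ‖x‖ ^ 2)).comp_hasFDerivAt x h1

lemma tsupport_wt {N : ℕ} {τ : ℝ} (k : ℕ) : tsupport (wt τ (k + 1) : Eu N → ℝ) ⊆
    {x | ‖x‖ ^ 2 ≤ τ} := by
  apply closure_minimal
  · intro x hx
    by_contra hc
    exact hx (wt_zero (not_le.1 hc).le)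
  · exact isClosed_le (by fun_prop) continuous_const

/-- continuity of weighted functions -/
lemma wt_mul_cont {N : ℕ} {τ R : ℝ} (hR : 0 ≤ R) (hτ : τ < R ^ 2) (k : ℕ) {g : Eu N → ℝ}
    (hg : ContinuousOn g (ball 0 R)) : Continuous fun x => wt τ (k + 1) x * g x := by
  rw [continuous_iff_continuousAt]
  intro x
  by_cases hx : ‖x‖ < R
  · exact (wt_continuous τ (k+1)).continuousAt.mul
      (hg.continuousAt (isOpen_ball.mem_nhds (by simpa using hx)))
  · have h1 : τ < ‖x‖ ^ 2 := hτ.trans_le (by gcongr; linarith)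
    have : (fun x : Eu N => wt τ (k + 1) x * g x) =ᶠ[𝓝 x] fun _ => 0 := by
      have : ∀ᶠ y in 𝓝 x, τ < ‖y‖ ^ 2 :=
        (continuous_norm.pow 2).continuousAt.eventually (lt_mem_nhds h1)
      filter_upwards [this] with y hy
      rw [wt_zero hy.le, zero_mul]
    exact (continuousAt_const).congr this.symm

lemma wt_mul_supp {N : ℕ} {τ : ℝ} (k : ℕ) (g : Eu N → ℝ) :
    HasCompactSupport fun x => wt τ (k + 1) x * g x := by
  apply HasCompactSupport.of_support_subset_isCompact (K := closedBall 0 (Real.sqrt τ))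
    (isCompact_closedBall _ _)
  intro x hx
  by_contra hc
  apply hx
  have : τ ≤ ‖x‖ ^ 2 := by
    simp only [mem_closedBall, dist_zero_right, not_le] at hc
    exact (Real.sqrt_le_left (norm_nonneg x)).1 hc.le
  simp only [wt_zero this, zero_mul]

lemma wt_mul_int {N : ℕ} {τ R : ℝ} (hR : 0 ≤ R) (hτ : τ < R ^ 2) (k : ℕ) {g : Eu N → ℝ}
    (hg : ContinuousOn g (ball 0 R)) : Integrable fun x => wt τ (k + 1) x * g x :=
  (wt_mul_cont hR hτ k hg).integrable_of_hasCompactSupport (wt_mul_supp k g)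

/-- weighted divergence identity in one direction -/
lemma wt_parts {N : ℕ} {τ R : ℝ} (hR : 0 ≤ R) (hτ : τ < R ^ 2) (m : ℕ) {Y : Eu N → ℝ}
    (hY : ContDiffOn ℝ 1 Y (ball 0 R)) (e : Eu N) :
    ∫ x, wt τ (m + 2) x * pd e Y x = 2 * ((m:ℝ) + 2) * ∫ x, wt τ (m + 1) x * (⟪x, e⟫ * Y x) := by
  have hc : ContinuousOn Y (ball 0 R) := hY.continuousOn
  have hc' : ContinuousOn (pd e Y) (ball 0 R) :=
    (hY.continuousOn_fderiv_of_isOpen isOpen_ball le_rfl).clm_apply continuousOn_const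
  have hc2 : ContinuousOn (fun x => ⟪x, e⟫ * Y x) (ball 0 R) :=
    (Continuous.continuousOn (by fun_prop)).mul hc
  set F : Eu N → ℝ := fun x => wt τ (m + 2) x * Y x with hF
  have hd : ∀ x, HasFDerivAt F (wt τ (m + 2) x • fderiv ℝ Y x +
      Y x • ((((m + 2 : ℕ) : ℝ) * wt τ (m + 1) x) • (-(2 • innerSL ℝ x : Eu N →L[ℝ] ℝ)))) x := by
    intro x
    by_cases hx : ‖x‖ < R
    · have hYd : HasFDerivAt Y (fderiv ℝ Y x) x :=
        ((cd_at isOpen_ball hY (by simpa using hx)).differentiableAt (by norm_num)).hasFDerivAt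
      exact (pd_wt τ m x).mul hYd
    · have h1 : τ < ‖x‖ ^ 2 := hτ.trans_le (by gcongr; linarith)
      have : F =ᶠ[𝓝 x] fun _ => 0 := by
        have : ∀ᶠ y in 𝓝 x, τ < ‖y‖ ^ 2 :=
          (continuous_norm.pow 2).continuousAt.eventually (lt_mem_nhds h1)
        filter_upwards [this] with y hy
        rw [hF]; simp only [show m + 2 = (m + 1) + 1 from rfl, wt_zero hy.le, zero_mul]
      rw [show m + 2 = (m + 1) + 1 from rfl, wt_zero h1.le, wt_zero h1.le]
      simpa using (hasFDerivAt_const (0:ℝ) x).congr_of_eventuallyEq this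
  have hfd : ∀ x, fderiv ℝ F x e = wt τ (m + 2) x * pd e Y x
      - 2 * ((m:ℝ) + 2) * (wt τ (m + 1) x * (⟪x, e⟫ * Y x)) := by
    intro x
    rw [(hd x).fderiv]
    simp [pd]; ring
  have i1 := wt_mul_int hR hτ (m + 1) hc'
  have i2 := (wt_mul_int hR hτ m hc2).const_mul (2 * ((m:ℝ) + 2))
  have hz : ∫ x, (1:ℝ) * fderiv ℝ F x e = - ∫ x, fderiv ℝ (fun _ : Eu N => (1:ℝ)) x e * F x := by
    apply integral_mul_fderiv_eq_neg_fderiv_mul_of_integrable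
    · simp
    · simp only [one_mul, hfd]
      exact i1.sub i2
    · simp only [one_mul]
      exact wt_mul_int hR hτ (m + 1) hc
    · fun_prop
    · exact fun x _ => (hd x).differentiableAt
  simp only [one_mul, hfd, fderiv_fun_const, Pi.zero_apply, ContinuousLinearMap.zero_apply, zero_mul, integral_zero,
    neg_zero] at hz
  rw [integral_sub i1 i2, integral_const_mul] at hz
  linarith

end

section

/-- weighted moment -/
def mo {N : ℕ} (τ : ℝ) (k : ℕ) (g : Eu N → ℝ) : ℝ := ∫ x, wt τ k x * g x

lemma mo_add {N : ℕ} {τ R : ℝ} (hR : 0 ≤ R) (hτ : τ < R ^ 2) (k : ℕ) {g h : Eu N → ℝ}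
    (hg : ContinuousOn g (ball 0 R)) (hh : ContinuousOn h (ball 0 R)) :
    mo τ (k + 1) (fun x => g x + h x) = mo τ (k + 1) g + mo τ (k + 1) h := by
  unfold mo
  rw [← integral_add (wt_mul_int hR hτ k hg) (wt_mul_int hR hτ k hh)]
  congr 1; ext x; ring

lemma mo_cmul {N : ℕ} (τ : ℝ) (k : ℕ) (c : ℝ) (g : Eu N → ℝ) :
    mo τ k (fun x => c * g x) = c * mo τ k g := by
  unfold mo
  rw [← integral_const_mul]; congr 1; ext x; ring

lemma mo_sub {N : ℕ} {τ R : ℝ} (hR : 0 ≤ R) (hτ : τ < R ^ 2) (k : ℕ) {g h : Eu N → ℝ}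
    (hg : ContinuousOn g (ball 0 R)) (hh : ContinuousOn h (ball 0 R)) :
    mo τ (k + 1) (fun x => g x - h x) = mo τ (k + 1) g - mo τ (k + 1) h := by
  unfold mo
  rw [← integral_sub (wt_mul_int hR hτ k hg) (wt_mul_int hR hτ k hh)]
  congr 1; ext x; ring

lemma mo_sum {N : ℕ} {ι : Type*} (s : Finset ι) {τ R : ℝ} (hR : 0 ≤ R) (hτ : τ < R ^ 2) (k : ℕ)
    {g : ι → Eu N → ℝ} (hg : ∀ i, ContinuousOn (g i) (ball 0 R)) :
    mo τ (k + 1) (fun x => ∑ i ∈ s, g i x) = ∑ i ∈ s, mo τ (k + 1) (g i) := by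
  unfold mo
  rw [← integral_finset_sum s fun i _ => wt_mul_int hR hτ k (hg i)]
  congr 1; ext x; rw [Finset.mul_sum]

lemma mo_congr {N : ℕ} {τ R : ℝ} (hR : 0 ≤ R) (hτ : τ < R ^ 2) (k : ℕ) {g h : Eu N → ℝ}
    (hgh : ∀ x ∈ ball 0 R, g x = h x) : mo τ (k + 1) g = mo τ (k + 1) h := by
  unfold mo
  congr 1; ext x
  by_cases hx : ‖x‖ < R
  · rw [hgh x (by simpa using hx)]
  · rw [wt_zero (hτ.le.trans (by gcongr; linarith))]; simp

lemma mo_mono {N : ℕ} {τ R : ℝ} (hR : 0 ≤ R) (hτ : τ < R ^ 2) (k : ℕ) {g h : Eu N → ℝ}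
    (hg : ContinuousOn g (ball 0 R)) (hh : ContinuousOn h (ball 0 R))
    (hgh : ∀ x ∈ ball 0 R, g x ≤ h x) : mo τ (k + 1) g ≤ mo τ (k + 1) h := by
  unfold mo
  apply integral_mono (wt_mul_int hR hτ k hg) (wt_mul_int hR hτ k hh)
  intro x
  by_cases hx : ‖x‖ < R
  · exact mul_le_mul_of_nonneg_left (hgh x (by simpa using hx)) (wt_nonneg _ _ _)
  · simp only []
    rw [wt_zero (hτ.le.trans (by gcongr; linarith))]; simp

lemma mo_nonneg {N : ℕ} {τ R : ℝ} (hR : 0 ≤ R) (hτ : τ < R ^ 2) (k : ℕ) {h : Eu N → ℝ}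
    (hh : ∀ x ∈ ball 0 R, 0 ≤ h x) : 0 ≤ mo τ (k + 1) h := by
  unfold mo
  apply integral_nonneg
  intro x
  by_cases hx : ‖x‖ < R
  · exact mul_nonneg (wt_nonneg _ _ _) (hh x (by simpa using hx))
  · simp only [Pi.zero_apply]
    rw [wt_zero (hτ.le.trans (by gcongr; linarith))]; simp

lemma pd_mul {N : ℕ} {f g : Eu N → ℝ} {x : Eu N} (hf : DifferentiableAt ℝ f x)
    (hg : DifferentiableAt ℝ g x) (e : Eu N) :
    pd e (fun y => f y * g y) x = f x * pd e g x + pd e f x * g x := by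
  simp only [pd]; rw [fderiv_fun_mul hf hg]; simp; ring

lemma pd_sum {N : ℕ} {ι : Type*} (s : Finset ι) {f : ι → Eu N → ℝ} {x : Eu N}
    (hf : ∀ i, DifferentiableAt ℝ (f i) x) (e : Eu N) :
    pd e (fun y => ∑ i ∈ s, f i y) x = ∑ i ∈ s, pd e (f i) x := by
  simp only [pd]; rw [fderiv_fun_sum fun i _ => hf i]; simp

lemma pd_sub' {N : ℕ} {f g : Eu N → ℝ} {x : Eu N} (hf : DifferentiableAt ℝ f x)
    (hg : DifferentiableAt ℝ g x) (e : Eu N) :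
    pd e (fun y => f y - g y) x = pd e f x - pd e g x := by
  simp only [pd]; rw [fderiv_fun_sub hf hg]; simp

lemma pd_cmul {N : ℕ} {g : Eu N → ℝ} {x : Eu N} (c : ℝ)
    (hg : DifferentiableAt ℝ g x) (e : Eu N) :
    pd e (fun y => c * g y) x = c * pd e g x := by
  simp only [pd]; rw [fderiv_const_mul hg]; simp

lemma pd_comm {N : ℕ} {v : Eu N → ℝ} {x : Eu N} (h : ContDiffAt ℝ 2 v x) (a b : Eu N) :
    pd a (pd b v) x = pd b (pd a v) x := by
  have key : ∀ a b : Eu N, pd a (pd b v) x = fderiv ℝ (fderiv ℝ v) x a b := by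
    intro a b
    have h1 := (diff_fderiv h).hasFDerivAt.clm_apply (hasFDerivAt_const b x)
    conv_lhs => rw [pd]
    have h2 : fderiv ℝ (pd b v) x = _ := h1.fderiv
    rw [h2]; simp
  rw [key, key]
  exact (h.isSymmSndFDerivAt (by simp)) a b

lemma rd_eq {N : ℕ} (v : Eu N → ℝ) (x e : Eu N) : pd e v x = ∑ k, e k * pd (ev k) v x := by
  simp only [pd]
  have : e = ∑ k, e k • (ev k : Eu N) := by
    have := (EuclideanSpace.basisFun (Fin N) ℝ).sum_repr e
    simp only [basisFun_ev] at this
    simp only [EuclideanSpace.basisFun_repr] at this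
    exact this.symm
  conv_lhs => rw [this]
  simp

lemma coord_cd {N : ℕ} (k : Fin N) {n : WithTop ℕ∞} : ContDiff ℝ n (fun y : Eu N => y k) :=
  (EuclideanSpace.proj k : Eu N →L[ℝ] ℝ).contDiff

lemma coord_diff {N : ℕ} (k : Fin N) (x : Eu N) : DifferentiableAt ℝ (fun y : Eu N => y k) x :=
  (coord_cd (n := 1) k).differentiable (by norm_num) x

lemma cont_pd {N : ℕ} {R : ℝ} {g : Eu N → ℝ} (hg : ContDiffOn ℝ 1 g (ball 0 R)) (e : Eu N) :
    ContinuousOn (pd e g) (ball 0 R) :=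
  (hg.continuousOn_fderiv_of_isOpen isOpen_ball le_rfl).clm_apply continuousOn_const

lemma cont_rd {N : ℕ} {R : ℝ} {g : Eu N → ℝ} (hg : ContDiffOn ℝ 1 g (ball 0 R)) :
    ContinuousOn (fun x => pd x g x) (ball 0 R) :=
  (hg.continuousOn_fderiv_of_isOpen isOpen_ball le_rfl).clm_apply continuousOn_id

lemma cont_grad2 {N : ℕ} {R : ℝ} {g : Eu N → ℝ} (hg : ContDiffOn ℝ 1 g (ball 0 R)) :
    ContinuousOn (grad2 g) (ball 0 R) :=
  continuousOn_finset_sum _ fun k _ => (cont_pd hg (ev k)).pow 2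

lemma cont_lapl {N : ℕ} {R : ℝ} {g : Eu N → ℝ} (hg : ContDiffOn ℝ 2 g (ball 0 R)) :
    ContinuousOn (lapl g) (ball 0 R) := fun x hx =>
  (lapl_continuousAt (cd_at isOpen_ball hg hx)).continuousWithinAt

lemma mo_parts {N : ℕ} {τ R : ℝ} (hR : 0 ≤ R) (hτ : τ < R ^ 2) (m : ℕ) {Y : Fin N → Eu N → ℝ}
    (hY : ∀ k, ContDiffOn ℝ 1 (Y k) (ball 0 R)) :
    mo τ (m + 2) (fun x => ∑ k, pd (ev k) (Y k) x)
      = 2 * ((m:ℝ) + 2) * mo τ (m + 1) (fun x => ∑ k, x k * Y k x) := by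
  rw [mo_sum _ hR hτ (m + 1) fun k => cont_pd (hY k) (ev k),
    mo_sum _ hR hτ m fun k => (coord_cd (n := 1) k).continuous.continuousOn.fun_mul (hY k).continuousOn,
    Finset.mul_sum]
  refine Finset.sum_congr rfl fun k _ => ?_
  have := wt_parts hR hτ m (hY k) (ev k)
  simp only [inner_ev] at this
  exact this

lemma mo_normsq {N : ℕ} {τ R : ℝ} (hR : 0 ≤ R) (hτ : τ < R ^ 2) (m : ℕ) {g : Eu N → ℝ}
    (hg : ContinuousOn g (ball 0 R)) :
    mo τ (m + 1) (fun x => ‖x‖ ^ 2 * g x) = τ * mo τ (m + 1) g - mo τ (m + 2) g := by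
  unfold mo
  rw [← integral_const_mul, ← integral_sub ((wt_mul_int hR hτ m hg).const_mul _)
    (wt_mul_int hR hτ (m + 1) hg)]
  congr 1; ext x
  rw [← mul_assoc, wt_mul]; ring

lemma G1 {N : ℕ} {τ R : ℝ} (hR : 0 ≤ R) (hτ : τ < R ^ 2) (m : ℕ) {g : Eu N → ℝ}
    (hg : ContDiffOn ℝ 1 g (ball 0 R)) :
    mo τ (m + 2) (fun x => pd x g x)
      = 2 * ((m:ℝ) + 2) * τ * mo τ (m + 1) g - (2 * ((m:ℝ) + 2) + N) * mo τ (m + 2) g := by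
  have h1 := mo_parts hR hτ m (Y := fun k x => x k * g x) fun k => (coord_cd k).contDiffOn.mul hg
  have h2 : mo τ (m + 2) (fun x => ∑ k, pd (ev k) (fun x : Eu N => x k * g x) x)
      = mo τ (m + 2) fun x => pd x g x + N * g x := by
    apply mo_congr hR hτ (m + 1)
    intro x hx
    have hd : DifferentiableAt ℝ g x := (cd_at isOpen_ball hg hx).differentiableAt (by norm_num)
    rw [rd_eq g x x]
    have : ∀ k : Fin N, pd (ev k) (fun x : Eu N => x k * g x) x = x k * pd (ev k) g x + g x := by
      intro k
      rw [pd_mul (coord_diff k x) hd, pd_coord]; simp [ev]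
    rw [Finset.sum_congr rfl fun k _ => this k, Finset.sum_add_distrib]; simp
  rw [h2, mo_add hR hτ (m + 1) (cont_rd hg) (hg.continuousOn.const_mul _ ), mo_cmul] at h1
  have h3 : mo τ (m + 1) (fun x => ∑ k, x k * (x k * g x))
      = τ * mo τ (m + 1) g - mo τ (m + 2) g := by
    rw [← mo_normsq hR hτ m hg.continuousOn]
    congr 1; ext x
    rw [normsq_eq, Finset.sum_mul]; exact Finset.sum_congr rfl fun k _ => by ring
  rw [h3] at h1
  linarith

lemma G2 {N : ℕ} {τ R : ℝ} (hR : 0 ≤ R) (hτ : τ < R ^ 2) (m : ℕ) {g : Eu N → ℝ}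
    (hg : ContDiffOn ℝ 2 g (ball 0 R)) :
    mo τ (m + 2) (lapl g) = 2 * ((m:ℝ) + 2) * mo τ (m + 1) (fun x => pd x g x) := by
  have h1 := mo_parts hR hτ m (Y := fun k x => pd (ev k) g x) fun k => cd_pd isOpen_ball hg (ev k)
  simp only [← rd_eq] at h1
  rw [← h1]
  apply mo_congr hR hτ (m + 1)
  intro x hx
  exact lapl_eq_sum (diff_fderiv (cd_at isOpen_ball hg hx))

lemma G3 {N : ℕ} {τ R : ℝ} (hR : 0 ≤ R) (hτ : τ < R ^ 2) (m : ℕ) {g : Eu N → ℝ}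
    (hg : ContDiffOn ℝ 2 g (ball 0 R)) :
    mo τ (m + 3) (lapl g) = 2 * ((m:ℝ) + 3) * (2 * ((m:ℝ) + 2) * τ * mo τ (m + 1) g
      - (2 * ((m:ℝ) + 2) + N) * mo τ (m + 2) g) := by
  have := G2 hR hτ (m + 1) hg
  rw [show m + 3 = m + 1 + 2 from rfl, this, G1 hR hτ m (hg.of_le (by norm_num))]
  push_cast; ring

lemma stress {N : ℕ} {τ R : ℝ} (hR : 0 ≤ R) (hτ : τ < R ^ 2) (m : ℕ) {v : Eu N → ℝ}
    (hv : ContDiffOn ℝ 2 v (ball 0 R)) :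
    mo τ (m + 2) (fun x => lapl v x * pd x v x) + (1 - (N:ℝ) / 2) * mo τ (m + 2) (grad2 v)
      = 2 * ((m:ℝ) + 2) * (mo τ (m + 1) (fun x => (pd x v x) ^ 2)
        - (1 / 2) * (τ * mo τ (m + 1) (grad2 v) - mo τ (m + 2) (grad2 v))) := by
  have hv1 : ContDiffOn ℝ 1 v (ball 0 R) := hv.of_le (by norm_num)
  have hp : ∀ k, ContDiffOn ℝ 1 (pd (ev k) v) (ball 0 R) := fun k => cd_pd isOpen_ball hv _
  have hr : ContDiffOn ℝ 1 (fun x => ∑ l, x l * pd (ev l) v x) (ball 0 R) :=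
    ContDiffOn.sum fun l _ => (coord_cd l).contDiffOn.mul (hp l)
  have hg2 : ContDiffOn ℝ 1 (fun x => ∑ l, pd (ev l) v x * pd (ev l) v x) (ball 0 R) :=
    ContDiffOn.sum fun l _ => (hp l).mul (hp l)
  have h1 := mo_parts hR hτ m (Y := fun k x => (∑ l, x l * pd (ev l) v x) * pd (ev k) v x
    - (1 / 2) * (x k * ∑ l, pd (ev l) v x * pd (ev l) v x)) fun k =>
      (hr.mul (hp k)).sub (contDiffOn_const.mul ((coord_cd k).contDiffOn.mul hg2))
  have hG : ∀ x, ∑ l, pd (ev l) v x * pd (ev l) v x = grad2 v x := fun x => by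
    unfold grad2; exact Finset.sum_congr rfl fun l _ => by ring
  have h2 : mo τ (m + 2) (fun x => ∑ k, pd (ev k) (fun x : Eu N => (∑ l, x l * pd (ev l) v x) * pd (ev k) v x
    - (1 / 2) * (x k * ∑ l, pd (ev l) v x * pd (ev l) v x)) x)
      = mo τ (m + 2) fun x => lapl v x * pd x v x + (1 - (N:ℝ) / 2) * grad2 v x := by
    apply mo_congr hR hτ (m + 1)
    intro x hx
    have hc := cd_at isOpen_ball hv hx
    have hpd : ∀ k, DifferentiableAt ℝ (pd (ev k) v) x := fun k => diff_pd hc _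
    have hxl : ∀ l : Fin N, DifferentiableAt ℝ (fun x : Eu N => x l * pd (ev l) v x) x := fun l =>
      (coord_diff l x).mul (hpd l)
    have hll : ∀ l : Fin N, DifferentiableAt ℝ (fun x : Eu N => pd (ev l) v x * pd (ev l) v x) x :=
      fun l => (hpd l).mul (hpd l)
    have hrd : DifferentiableAt ℝ (fun x : Eu N => ∑ l, x l * pd (ev l) v x) x :=
      DifferentiableAt.fun_sum fun l _ => hxl l
    have hgd : DifferentiableAt ℝ (fun x : Eu N => ∑ l, pd (ev l) v x * pd (ev l) v x) x :=
      DifferentiableAt.fun_sum fun l _ => hll l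
    have e1 : ∀ k : Fin N, pd (ev k) (fun x : Eu N => ∑ l, x l * pd (ev l) v x) x
        = pd (ev k) v x + ∑ l, x l * pd (ev k) (pd (ev l) v) x := by
      intro k
      rw [pd_sum _ hxl]
      have : ∀ l : Fin N, pd (ev k) (fun x : Eu N => x l * pd (ev l) v x) x
          = x l * pd (ev k) (pd (ev l) v) x + (if l = k then pd (ev l) v x else 0) := by
        intro l
        rw [pd_mul (coord_diff l x) (hpd l), pd_coord]
        simp [ev, Pi.single_apply]
      rw [Finset.sum_congr rfl fun l _ => this l, Finset.sum_add_distrib]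
      simp; ring
    have e2 : ∀ k : Fin N, pd (ev k) (fun x : Eu N => ∑ l, pd (ev l) v x * pd (ev l) v x) x
        = 2 * ∑ l, pd (ev l) v x * pd (ev k) (pd (ev l) v) x := by
      intro k
      rw [pd_sum _ hll, Finset.mul_sum]
      refine Finset.sum_congr rfl fun l _ => ?_
      rw [pd_mul (hpd l) (hpd l)]; ring
    have e3 : ∀ k : Fin N, pd (ev k) (fun x : Eu N => (∑ l, x l * pd (ev l) v x) * pd (ev k) v x
        - (1 / 2) * (x k * ∑ l, pd (ev l) v x * pd (ev l) v x)) x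
        = (∑ l, x l * pd (ev l) v x) * pd (ev k) (pd (ev k) v) x
          + pd (ev k) v x ^ 2 + (∑ l, x l * pd (ev k) (pd (ev l) v) x * pd (ev k) v x)
          - (1 / 2) * grad2 v x - ∑ l, x k * pd (ev k) (pd (ev l) v) x * pd (ev l) v x := by
      intro k
      rw [pd_sub' (hrd.fun_mul (hpd k)) (((coord_diff k x).fun_mul hgd).const_mul _), pd_mul hrd (hpd k),
        pd_cmul _ ((coord_diff k x).fun_mul hgd), pd_mul (coord_diff k x) hgd, e1, e2, hG, pd_coord]
      have : ∑ l, x k * pd (ev k) (pd (ev l) v) x * pd (ev l) v x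
          = x k * ∑ l, pd (ev l) v x * pd (ev k) (pd (ev l) v) x := by
        rw [Finset.mul_sum]; exact Finset.sum_congr rfl fun l _ => by ring
      rw [this, ← Finset.sum_mul]
      simp [ev]; ring
    rw [Finset.sum_congr rfl fun k _ => e3 k]
    simp only [Finset.sum_sub_distrib, Finset.sum_add_distrib]
    rw [← Finset.mul_sum, ← lapl_eq_sum (diff_fderiv hc), ← rd_eq]
    have hsw : ∑ k, ∑ l, x k * pd (ev k) (pd (ev l) v) x * pd (ev l) v x
        = ∑ k, ∑ l, x l * pd (ev k) (pd (ev l) v) x * pd (ev k) v x := by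
      rw [Finset.sum_comm]
      refine Finset.sum_congr rfl fun k _ => Finset.sum_congr rfl fun l _ => ?_
      rw [pd_comm hc]
    rw [hsw]
    have : ∑ k, pd (ev k) v x ^ 2 = grad2 v x := rfl
    rw [this]
    simp; ring
  have c1 : ContinuousOn (fun x => lapl v x * pd x v x) (ball 0 R) := (cont_lapl hv).mul (cont_rd hv1)
  rw [h2, mo_add hR hτ (m + 1) c1 ((cont_grad2 hv1).const_mul _), mo_cmul] at h1
  have h3 : mo τ (m + 1) (fun x => ∑ k, x k * ((∑ l, x l * pd (ev l) v x) * pd (ev k) v x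
    - (1 / 2) * (x k * ∑ l, pd (ev l) v x * pd (ev l) v x)))
      = mo τ (m + 1) (fun x => (pd x v x) ^ 2)
        - (1 / 2) * (τ * mo τ (m + 1) (grad2 v) - mo τ (m + 2) (grad2 v)) := by
    have hn : ContinuousOn (fun x : Eu N => ‖x‖ ^ 2 * grad2 v x) (ball 0 R) :=
      (continuous_norm.pow 2).continuousOn.fun_mul (cont_grad2 hv1)
    rw [← mo_normsq hR hτ m (cont_grad2 hv1), ← mo_cmul,
      ← mo_sub hR hτ m ((cont_rd hv1).fun_pow 2) (hn.const_mul _)]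
    congr 1; ext x
    rw [hG, ← rd_eq, normsq_eq, Finset.sum_mul, Finset.mul_sum, sq (pd x v x)]
    nth_rewrite 3 [rd_eq]
    rw [Finset.mul_sum, ← Finset.sum_sub_distrib]
    exact Finset.sum_congr rfl fun k _ => by ring
  rw [h3] at h1
  exact h1

end

section

lemma mo_abs_le {N : ℕ} {τ R : ℝ} (hR : 0 ≤ R) (hτ : τ < R ^ 2) (k : ℕ) {g h : Eu N → ℝ}
    (hg : ContinuousOn g (ball 0 R)) (hh : ContinuousOn h (ball 0 R))
    (hgh : ∀ x ∈ ball 0 R, |g x| ≤ h x) : |mo τ (k + 1) g| ≤ mo τ (k + 1) h := by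
  rw [abs_le]
  constructor
  · have h1 := mo_mono hR hτ k (hh.const_mul (-1)) hg fun x hx => by
      have := (abs_le.1 (hgh x hx)).1; linarith
    rw [mo_cmul] at h1; linarith
  · exact mo_mono hR hτ k hg hh fun x hx => (abs_le.1 (hgh x hx)).2

lemma mo_tendsto {N : ℕ} {τ R : ℝ} (hR : 0 ≤ R) (hτ : τ < R ^ 2) (k : ℕ) {g : ℕ → Eu N → ℝ}
    {h : Eu N → ℝ} {l : Filter ℕ}
    (hg : ∀ᶠ n in l, ContinuousOn (g n) (ball 0 R)) (hh : ContinuousOn h (ball 0 R))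
    (hgh : ∀ δ : ℝ, 0 < δ → ∀ᶠ n in l, ∀ x ∈ ball 0 R, |g n x - h x| ≤ δ) :
    Tendsto (fun n => mo τ (k + 1) (g n)) l (𝓝 (mo τ (k + 1) h)) := by
  rw [Metric.tendsto_nhds]
  intro ε hε
  set c := mo (N := N) τ (k + 1) (fun _ => 1) with hc
  have hc0 : 0 ≤ c := mo_nonneg hR hτ k fun _ _ => zero_le_one
  filter_upwards [hg, hgh (ε / (2 * (c + 1))) (by positivity)] with n h1 h2
  rw [Real.dist_eq, ← mo_sub hR hτ k h1 hh]
  have h3 := mo_abs_le hR hτ k (h1.sub hh) (h := fun _ => ε / (2 * (c + 1)) * 1) continuousOn_const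
    fun x hx => by simpa using h2 x hx
  rw [mo_cmul, ← hc] at h3
  refine lt_of_le_of_lt h3 ?_
  rw [div_mul_eq_mul_div, div_lt_iff₀ (by positivity)]
  nlinarith

/-- sum of squares -/
def sqs {N d : ℕ} (V : Fin d → Eu N → ℝ) (x : Eu N) : ℝ := ∑ i, V i x ^ 2


lemma rd_sq_le {N : ℕ} (f : Eu N → ℝ) (x : Eu N) : (pd x f x) ^ 2 ≤ ‖x‖ ^ 2 * grad2 f x := by
  rw [rd_eq, normsq_eq, grad2]
  exact Finset.sum_mul_sq_le_sq_mul_sq _ _ _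

lemma fin_D {N d : ℕ} {A : Fin d → Fin d → ℝ} {p : ℝ} (hp : 0 < p)
  {M ε : ℝ} {v : Fin d → Eu N → ℝ} {τ R : ℝ} (hR : 0 ≤ R) (hτ : τ < R ^ 2)
  (h : ASOn A p M ε (ball 0 R) v) (k : ℕ) :
    (1 / 2) * mo τ (k + 1) (lapl (sqs v)) = mo τ (k + 1) (fun x => ∑ i, grad2 (v i) x)
      + (2 * p + 2) * mo τ (k + 1) (fun x => M * Wf A p fun j => v j x)
      + mo τ (k + 1) (fun x => ∑ i, v i x * (lapl (v i) x - M * coup A p (fun j => v j x) i)) := by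
  have hv1 : ∀ i, ContDiffOn ℝ 1 (v i) (ball 0 R) := fun i => (h i).1.of_le (by norm_num)
  have cW : ContinuousOn (fun x => Wf A p fun j => v j x) (ball 0 R) :=
    (cd_Wf A hp fun i => (h i).1).continuousOn
  have cg : ContinuousOn (fun x => ∑ i, grad2 (v i) x) (ball 0 R) :=
    continuousOn_finset_sum _ fun i _ => cont_grad2 (hv1 i)
  have cl : ContinuousOn (fun x => ∑ i, v i x * lapl (v i) x) (ball 0 R) :=
    continuousOn_finset_sum _ fun i _ => (h i).1.continuousOn.fun_mul (cont_lapl (h i).1)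
  have e1 : ∀ x, ∑ i, v i x * (lapl (v i) x - M * coup A p (fun j => v j x) i)
      = ∑ i, v i x * lapl (v i) x - (2 * p + 2) * (M * Wf A p fun j => v j x) := by
    intro x
    rw [show (2 * p + 2) * (M * Wf A p fun j => v j x)
      = M * ((2 * p + 2) * Wf A p fun j => v j x) by ring, ← sum_mul_coup A hp, Finset.mul_sum,
      ← Finset.sum_sub_distrib]
    exact Finset.sum_congr rfl fun i _ => by ring
  have cMW : ContinuousOn (fun x => M * Wf A p fun j => v j x) (ball 0 R) := cW.const_mul _
  simp only [e1]
  rw [mo_sub hR hτ k cl (cMW.const_mul _), mo_cmul τ (k+1) (2*p+2) (fun x => M * Wf A p fun j => v j x)]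
  have e2 : mo τ (k + 1) (lapl (sqs v)) = mo τ (k + 1) fun x => 2 * (∑ i, grad2 (v i) x +
      ∑ i, v i x * lapl (v i) x) := by
    apply mo_congr hR hτ k
    intro x hx
    have : ∀ i, ContDiffAt ℝ 2 (fun y => v i y ^ 2) x := fun i => (cd_at isOpen_ball (h i).1 hx).pow 2
    unfold sqs
    have hs : lapl (fun x => ∑ i, v i x ^ 2) x = ∑ i, lapl (fun y => v i y ^ 2) x := by
      have key : ∀ s : Finset (Fin d), lapl (fun x => ∑ i ∈ s, v i x ^ 2) x
          = ∑ i ∈ s, lapl (fun y => v i y ^ 2) x := by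
        intro s
        induction s using Finset.induction_on with
        | empty => simp [lapl_const]
        | insert a s ha ih =>
          simp only [Finset.sum_insert ha]
          rw [← ih]
          exact lapl_add (this a) (ContDiffAt.sum fun i _ => this i)
      exact key _
    rw [hs, Finset.sum_congr rfl fun i _ => lapl_sq (cd_at isOpen_ball (h i).1 hx),
      ← Finset.sum_add_distrib, Finset.mul_sum]
    exact Finset.sum_congr rfl fun i _ => by ring
  rw [e2, mo_cmul τ (k+1) 2 _, mo_add hR hτ k cg cl]
  ring

lemma cd_sqs {N d : ℕ} {v : Fin d → Eu N → ℝ} {R : ℝ} (hv : ∀ i, ContDiffOn ℝ 2 (v i) (ball 0 R)) : ContDiffOn ℝ 2 (sqs v) (ball 0 R) :=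
  ContDiffOn.sum fun i _ => (hv i).pow 2

lemma fin_I {N d : ℕ} {v : Fin d → Eu N → ℝ} {τ R : ℝ} (hR : 0 ≤ R) (hτ : τ < R ^ 2) (hv : ∀ i, ContDiffOn ℝ 2 (v i) (ball 0 R)) :
    4 * mo τ 3 (fun x => ∑ i, v i x * pd x (v i) x)
      = 2 * (6 * τ * mo τ 2 (sqs v) - (6 + N) * mo τ 3 (sqs v)) := by
  have h1 := G1 hR hτ 1 ((cd_sqs hv).of_le (by norm_num))
  have h2 : mo τ 3 (fun x => pd x (sqs v) x) = mo τ 3 fun x => 2 * ∑ i, v i x * pd x (v i) x := by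
    apply mo_congr hR hτ 2
    intro x hx
    have hd : ∀ i, DifferentiableAt ℝ (v i) x := fun i =>
      (cd_at isOpen_ball (hv i) hx).differentiableAt (by norm_num)
    unfold sqs
    simp only [sq]
    rw [pd_sum _ (fun i => (hd i).fun_mul (hd i)), Finset.mul_sum]
    refine Finset.sum_congr rfl fun i _ => ?_
    rw [pd_mul (hd i) (hd i)]; ring
  rw [mo_cmul] at h2
  norm_num at h1
  rw [h2] at h1
  linear_combination 2 * h1

lemma fin_J {N d : ℕ} {A : Fin d → Fin d → ℝ} {g : Fin d → ℕ} (hA : CplOK A g) {p : ℝ} (hp : 0 < p)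
  {M ε : ℝ} {v : Fin d → Eu N → ℝ} {τ R : ℝ} (hR : 0 ≤ R) (hτ : τ < R ^ 2)
  (h : ASOn A p M ε (ball 0 R) v) :
    8 * mo τ 3 (fun x => ∑ i, (pd x (v i) x) ^ 2)
      = mo τ 4 (fun x => ∑ i, (lapl (v i) x - M * coup A p (fun j => v j x) i) * pd x (v i) x)
       + 8 * τ * mo τ 3 (fun x => M * Wf A p fun j => v j x)
       - (8 + N) * mo τ 4 (fun x => M * Wf A p fun j => v j x)
       + 4 * τ * mo τ 3 (fun x => ∑ i, grad2 (v i) x)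
       - (3 + (N:ℝ) / 2) * mo τ 4 (fun x => ∑ i, grad2 (v i) x) := by
  have hv1 : ∀ i, ContDiffOn ℝ 1 (v i) (ball 0 R) := fun i => (h i).1.of_le (by norm_num)
  have cdW : ContDiffOn ℝ 1 (fun x => M * Wf A p fun j => v j x) (ball 0 R) :=
    contDiffOn_const.mul (cd_Wf A hp fun i => (h i).1)
  have hW := G1 hR hτ 2 cdW
  have hS : ∀ i, _ := fun i => stress hR hτ 2 (h i).1
  have hS' := Finset.sum_congr (s₁ := Finset.univ) rfl fun i _ => hS i
  simp only [Finset.sum_add_distrib, ← Finset.mul_sum, Finset.sum_sub_distrib] at hS'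
  rw [← mo_sum _ hR hτ 3 fun i => (cont_lapl (h i).1).fun_mul (cont_rd (hv1 i)),
    ← mo_sum _ hR hτ 3 fun i => cont_grad2 (hv1 i),
    ← mo_sum _ hR hτ 2 fun i => cont_grad2 (hv1 i),
    ← mo_sum _ hR hτ 2 fun i => (cont_rd (hv1 i)).fun_pow 2] at hS'
  have cl : ContinuousOn (fun x => ∑ i, lapl (v i) x * pd x (v i) x) (ball 0 R) :=
    continuousOn_finset_sum _ fun i _ => (cont_lapl (h i).1).fun_mul (cont_rd (hv1 i))
  have e1 : mo τ 4 (fun x => ∑ i, (lapl (v i) x - M * coup A p (fun j => v j x) i) * pd x (v i) x)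
      = mo τ 4 (fun x => ∑ i, lapl (v i) x * pd x (v i) x
        - pd x (fun x => M * Wf A p fun j => v j x) x) := by
    apply mo_congr hR hτ 3
    intro x hx
    have hd : ∀ i, DifferentiableAt ℝ (v i) x := fun i =>
      (cd_at isOpen_ball (h i).1 hx).differentiableAt (by norm_num)
    rw [pd_cmul _ ((cd_at isOpen_ball (cd_Wf A hp fun i => (h i).1) hx).differentiableAt (by norm_num)),
      hasFDerivAt_Wf hA hp hd, Finset.mul_sum, ← Finset.sum_sub_distrib]
    exact Finset.sum_congr rfl fun i _ => by ring
  rw [mo_sub hR hτ 3 cl (cont_rd cdW)] at e1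
  norm_num at hS' hW e1
  linear_combination (-1) * e1 + hW - hS'

end

section

lemma exists_bd {N d : ℕ} {V : Fin d → Eu N → ℝ} (hV : ∀ i, Continuous (V i)) (R : ℝ) :
    ∃ B : ℝ, 0 ≤ B ∧ ∀ i, ∀ x ∈ closedBall (0 : Eu N) R, |V i x| ≤ B := by
  have h1 : ∀ i, ∃ B, ∀ x ∈ closedBall (0 : Eu N) R, |V i x| ≤ B := fun i => by
    obtain ⟨B, hB⟩ := (isCompact_closedBall (0 : Eu N) R).exists_bound_of_continuousOn
      (hV i).continuousOn
    exact ⟨B, hB⟩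
  choose B hB using h1
  refine ⟨∑ i, |B i|, Finset.sum_nonneg fun i _ => abs_nonneg _, fun i x hx => ?_⟩
  refine (hB i x hx).trans ((le_abs_self _).trans ?_)
  exact Finset.single_le_sum (f := fun i => |B i|) (fun i _ => abs_nonneg _) (Finset.mem_univ i)

lemma unif_comp {N d : ℕ} {l : Filter ℕ} {v : ℕ → Fin d → Eu N → ℝ} {V : Fin d → Eu N → ℝ}
    {S : Set (Eu N)} {B : ℝ} (hB0 : 0 ≤ B) (hB : ∀ i, ∀ x ∈ S, |V i x| ≤ B)
    (hc : ∀ δ : ℝ, 0 < δ → ∀ᶠ n in l, ∀ i, ∀ x ∈ S, |v n i x - V i x| ≤ δ)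
    {F : (Fin d → ℝ) → ℝ} (hF : Continuous F) :
    ∀ δ : ℝ, 0 < δ → ∀ᶠ n in l, ∀ x ∈ S, |F (fun j => v n j x) - F (fun j => V j x)| ≤ δ := by
  intro δ hδ
  have hu := (isCompact_closedBall (0 : Fin d → ℝ) (B + 1)).uniformContinuousOn_of_continuous
    hF.continuousOn
  rw [Metric.uniformContinuousOn_iff] at hu
  obtain ⟨η, hη, h⟩ := hu δ hδ
  filter_upwards [hc (min (η / 2) 1) (by positivity)] with n hn x hx
  have := h (fun j => v n j x) ?_ (fun j => V j x) ?_ ?_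
  · rw [Real.dist_eq] at this; exact this.le
  · rw [mem_closedBall_zero_iff, pi_norm_le_iff_of_nonneg (by positivity)]
    intro i
    rw [Real.norm_eq_abs]
    have h1 := hn i x hx
    have h2 := hB i x hx
    have h3 := min_le_right (η / 2) 1
    have := abs_sub_abs_le_abs_sub (v n i x) (V i x)
    linarith
  · rw [mem_closedBall_zero_iff, pi_norm_le_iff_of_nonneg (by positivity)]
    intro i
    rw [Real.norm_eq_abs]
    linarith [hB i x hx]
  · refine lt_of_le_of_lt ((dist_pi_le_iff (r := η / 2) (by positivity)).2 fun i => ?_) (by linarith)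
    rw [Real.dist_eq]
    exact (hn i x hx).trans (min_le_left _ _)

lemma sqs_continuous {N d : ℕ} {V : Fin d → Eu N → ℝ} (hV : ∀ i, Continuous (V i)) :
    Continuous (sqs V) := continuous_finset_sum _ fun i _ => (hV i).pow 2

lemma mo_abs_le' {N : ℕ} {τ R : ℝ} (hR : 0 ≤ R) (hτ : τ < R ^ 2) (k : ℕ) {g h : Eu N → ℝ}
    (hh : ContinuousOn h (ball 0 R))
    (hgh : ∀ x ∈ ball 0 R, |g x| ≤ h x) : |mo τ (k + 1) g| ≤ mo τ (k + 1) h := by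
  unfold mo
  refine (norm_integral_le_integral_norm (fun x => wt τ (k + 1) x * g x)).trans ?_
  refine integral_mono_of_nonneg
      (Eventually.of_forall fun x => norm_nonneg (wt τ (k + 1) x * g x)) (wt_mul_int hR hτ k hh)
      (Eventually.of_forall fun x => ?_)
  simp only [Real.norm_eq_abs, abs_mul, abs_of_nonneg (wt_nonneg τ (k+1) x)]
  by_cases hx : x ∈ ball (0 : Eu N) R
  · exact mul_le_mul_of_nonneg_left (hgh x hx) (wt_nonneg _ _ _)
  · rw [wt_zero (hτ.le.trans _)]
    · simp
    · rw [mem_ball_zero_iff, not_lt] at hx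
      gcongr

/-- approximation data -/
structure Apx {N d : ℕ} (A : Fin d → Fin d → ℝ) (p : ℝ) (V : Fin d → Eu N → ℝ) (P : Eu N → ℝ)
    (v : ℕ → Fin d → Eu N → ℝ) (M ε : ℕ → ℝ) : Prop where
  M0 : ∀ n, 0 ≤ M n
  ε0 : Tendsto ε atTop (𝓝 0)
  as : ∀ R : ℝ, ∀ᶠ n in atTop, ASOn A p (M n) (ε n) (ball 0 R) (v n)
  conv : ∀ R δ : ℝ, 0 < δ → ∀ᶠ n in atTop, ∀ i, ∀ x ∈ ball 0 R, |v n i x - V i x| ≤ δ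
  mom : ∀ τ : ℝ, 0 < τ → ∀ k : ℕ, Tendsto (fun n => mo τ (k + 1)
    (fun x => M n * Wf A p fun j => v n j x)) atTop (𝓝 (mo τ (k + 1) P))
  Vc : ∀ i, Continuous (V i)
  Pc : Continuous P
  P0 : ∀ x, 0 ≤ P x

lemma exists_R (τ : ℝ) : ∃ R : ℝ, 0 ≤ R ∧ τ < R ^ 2 :=
  ⟨|τ| + 1, by positivity, by nlinarith [le_abs_self τ, abs_nonneg τ]⟩

section
variable {N d : ℕ} {A : Fin d → Fin d → ℝ} {g : Fin d → ℕ} {p : ℝ}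
  {V : Fin d → Eu N → ℝ} {P : Eu N → ℝ} {v : ℕ → Fin d → Eu N → ℝ} {M ε : ℕ → ℝ}

lemma Apx.t_sqs (h : Apx A p V P v M ε) (τ : ℝ) (k : ℕ) :
    Tendsto (fun n => mo τ (k + 1) (sqs (v n))) atTop (𝓝 (mo τ (k + 1) (sqs V))) := by
  obtain ⟨R, hR, hτ⟩ := exists_R τ
  obtain ⟨B, hB0, hB⟩ := exists_bd h.Vc R
  refine mo_tendsto hR hτ k ?_ (sqs_continuous h.Vc).continuousOn ?_
  · filter_upwards [h.as R] with n hn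
    exact (cd_sqs fun i => (hn i).1).continuousOn
  · exact unif_comp hB0 (fun i x hx => hB i x (ball_subset_closedBall hx)) (h.conv R)
      (F := fun s => ∑ i, s i ^ 2) (by fun_prop)

lemma Apx.t_r (h : Apx A p V P v M ε) (τ : ℝ) (k : ℕ) :
    Tendsto (fun n => mo τ (k + 1) (fun x => ∑ i, v n i x * (lapl (v n i) x
      - M n * coup A p (fun j => v n j x) i))) atTop (𝓝 0) := by
  obtain ⟨R, hR, hτ⟩ := exists_R τ
  obtain ⟨B, hB0, hB⟩ := exists_bd h.Vc R
  have := mo_abs_le (N := N) hR hτ k (g := fun _ => 1) (h := fun _ => 1) continuousOn_const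
    continuousOn_const (by simp)
  have hb : Tendsto (fun n => ε n * (d * (B + 1)) * mo (N := N) τ (k + 1) (fun _ => 1)) atTop (𝓝 0) := by
    have := (h.ε0.mul_const ((d : ℝ) * (B + 1))).mul_const (mo (N := N) τ (k + 1) (fun _ => 1))
    simpa using this
  refine squeeze_zero_norm' ?_ hb
  filter_upwards [h.as R, h.conv R 1 one_pos] with n h1 h2
  rw [Real.norm_eq_abs, ← mo_cmul]
  by_cases hc : ∀ x ∈ ball (0 : Eu N) R, |∑ i, v n i x * (lapl (v n i) x
      - M n * coup A p (fun j => v n j x) i)| ≤ ε n * (d * (B + 1)) * 1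
  swap
  · exfalso
    apply hc
    intro x hx
    refine (Finset.abs_sum_le_sum_abs _ _).trans ?_
    have : ∀ i ∈ Finset.univ, |v n i x * (lapl (v n i) x - M n * coup A p (fun j => v n j x) i)|
        ≤ (B + 1) * ε n := by
      intro i _
      rw [abs_mul]
      have a1 := h2 i x hx
      have a2 := hB i x (ball_subset_closedBall hx)
      have a3 := abs_sub_abs_le_abs_sub (v n i x) (V i x)
      exact mul_le_mul (by linarith) ((h1 i).2 x hx) (abs_nonneg _) (by linarith)
    refine (Finset.sum_le_sum this).trans (le_of_eq ?_)
    simp; ring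
  · exact mo_abs_le' hR hτ k continuousOn_const hc

/-- limit Dirichlet energies -/
def Dl (p : ℝ) (V : Fin d → Eu N → ℝ) (P : Eu N → ℝ) (τ : ℝ) (m : ℕ) : ℝ :=
  ((m:ℝ) + 3) * (2 * ((m:ℝ) + 2) * τ * mo τ (m + 1) (sqs V)
      - (2 * ((m:ℝ) + 2) + N) * mo τ (m + 2) (sqs V)) - (2 * p + 2) * mo τ (m + 3) P

lemma Apx.t_D (hp : 0 < p) (h : Apx A p V P v M ε) {τ : ℝ} (hτ0 : 0 < τ) (m : ℕ) :
    Tendsto (fun n => mo τ (m + 3) (fun x => ∑ i, grad2 (v n i) x)) atTop (𝓝 (Dl p V P τ m)) := by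
  obtain ⟨R, hR, hτ⟩ := exists_R τ
  have t1 := ((((h.t_sqs τ m).const_mul (2 * ((m:ℝ) + 2) * τ)).sub ((h.t_sqs τ (m+1)).const_mul
    (2 * ((m:ℝ) + 2) + N))).const_mul ((m:ℝ) + 3)).sub ((h.mom τ hτ0 (m+2)).const_mul (2 * p + 2))
  have t2 := t1.sub (h.t_r τ (m + 2))
  rw [sub_zero] at t2
  refine Tendsto.congr' ?_ t2
  filter_upwards [h.as R] with n hn
  have h1 := fin_D hp hR hτ hn (m + 2)
  have h2 := G3 hR hτ m (cd_sqs fun i => (hn i).1)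
  rw [show m + 2 + 1 = m + 3 from rfl] at h1 ⊢
  rw [h2] at h1
  linear_combination h1

/-- limit of the radial energy (2J) -/
def Jl (p : ℝ) (V : Fin d → Eu N → ℝ) (P : Eu N → ℝ) (τ : ℝ) : ℝ :=
  (1/2) * (8 * τ * mo τ 3 P - (8 + N) * mo τ 4 P + 4 * τ * Dl p V P τ 0
    - (3 + (N:ℝ) / 2) * Dl p V P τ 1)

def Il (V : Fin d → Eu N → ℝ) (τ : ℝ) : ℝ :=
  2 * (6 * τ * mo τ 2 (sqs V) - (6 + N) * mo τ 3 (sqs V))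

lemma Apx.t_r' (hp : 0 < p) (h : Apx A p V P v M ε) {τ : ℝ} (hτ0 : 0 < τ) :
    Tendsto (fun n => mo τ 4 (fun x => ∑ i, (lapl (v n i) x
      - M n * coup A p (fun j => v n j x) i) * pd x (v n i) x)) atTop (𝓝 0) := by
  obtain ⟨R, hR, hτ⟩ := exists_R τ
  have hb : Tendsto (fun n => ε n * (d * mo (N := N) τ 4 (fun _ => 1) + R ^ 2 *
      mo τ 4 (fun x => ∑ i, grad2 (v n i) x))) atTop (𝓝 0) := by
    have := h.ε0.mul (((h.t_D hp hτ0 1).const_mul (R ^ 2)).const_add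
      (d * mo (N := N) τ 4 (fun _ => 1)))
    simpa using this
  refine squeeze_zero_norm' ?_ hb
  filter_upwards [h.as R] with n h1
  have hv1 : ∀ i, ContDiffOn ℝ 1 (v n i) (ball 0 R) := fun i => (h1 i).1.of_le (by norm_num)
  have cg : ContinuousOn (fun x => ∑ i, grad2 (v n i) x) (ball 0 R) :=
    continuousOn_finset_sum _ fun i _ => cont_grad2 (hv1 i)
  rw [Real.norm_eq_abs]
  have e : ε n * (d * mo (N := N) τ 4 (fun _ => 1) + R ^ 2 * mo τ 4 (fun x => ∑ i, grad2 (v n i) x))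
      = mo τ 4 (fun x => ε n * (d * 1 + R ^ 2 * ∑ i, grad2 (v n i) x)) := by
    rw [mo_cmul, mo_add hR hτ 3 (by fun_prop) (cg.const_mul _), mo_cmul, mo_cmul]
  rw [e]
  have hpt : ∀ x ∈ ball (0 : Eu N) R, |∑ i, (lapl (v n i) x
      - M n * coup A p (fun j => v n j x) i) * pd x (v n i) x|
      ≤ ε n * (d * 1 + R ^ 2 * ∑ i, grad2 (v n i) x) := by
    intro x hx
    refine (Finset.abs_sum_le_sum_abs _ _).trans ?_
    have : ∀ i ∈ Finset.univ, |(lapl (v n i) x - M n * coup A p (fun j => v n j x) i)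
        * pd x (v n i) x| ≤ ε n * (1 + R ^ 2 * grad2 (v n i) x) := by
      intro i _
      rw [abs_mul]
      have g0 : 0 ≤ grad2 (v n i) x := Finset.sum_nonneg fun _ _ => sq_nonneg _
      have a1 := rd_sq_le (v n i) x
      have a2 : ‖x‖ ^ 2 ≤ R ^ 2 := by
        have := (mem_ball_zero_iff.1 hx).le
        gcongr
      have a3 : |pd x (v n i) x| ≤ 1 + R ^ 2 * grad2 (v n i) x := by
        have : ‖x‖ ^ 2 * grad2 (v n i) x ≤ R ^ 2 * grad2 (v n i) x := by gcongr
        nlinarith [sq_abs (pd x (v n i) x), sq_nonneg (|pd x (v n i) x| - 1)]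
      exact mul_le_mul ((h1 i).2 x hx) a3 (abs_nonneg _)
        ((abs_nonneg _).trans ((h1 i).2 x hx))
    refine (Finset.sum_le_sum this).trans (le_of_eq ?_)
    rw [← Finset.mul_sum, Finset.sum_add_distrib, Finset.mul_sum]; simp
  exact mo_abs_le' hR hτ 3 ((cg.const_mul (R ^ 2)).const_add (d * 1) |>.const_mul (ε n)) hpt

lemma Apx.t_J (hA : CplOK A g) (hp : 0 < p) (h : Apx A p V P v M ε) {τ : ℝ} (hτ0 : 0 < τ) :
    Tendsto (fun n => 4 * mo τ 3 (fun x => ∑ i, (pd x (v n i) x) ^ 2)) atTop (𝓝 (Jl p V P τ)) := by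
  obtain ⟨R, hR, hτ⟩ := exists_R τ
  have t1 := ((((((h.mom τ hτ0 2).const_mul (8 * τ)).sub ((h.mom τ hτ0 3).const_mul (8 + (N:ℝ)))).add
    ((h.t_D hp hτ0 0).const_mul (4 * τ))).sub ((h.t_D hp hτ0 1).const_mul (3 + (N:ℝ)/2))).const_mul
    (1/2)).add ((h.t_r' hp hτ0).const_mul (1/2))
  rw [mul_zero, add_zero] at t1
  refine Tendsto.congr' ?_ t1
  filter_upwards [h.as R] with n hn
  have h1 := fin_J hA hp hR hτ hn
  norm_num at h1 ⊢
  linear_combination (-1/2) * h1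

lemma Apx.t_I (h : Apx A p V P v M ε) {τ : ℝ} :
    Tendsto (fun n => 4 * mo τ 3 (fun x => ∑ i, v n i x * pd x (v n i) x)) atTop (𝓝 (Il V τ)) := by
  obtain ⟨R, hR, hτ⟩ := exists_R τ
  have t1 := (((h.t_sqs τ 1).const_mul (6 * τ)).sub ((h.t_sqs τ 2).const_mul (6 + (N:ℝ)))).const_mul 2
  refine Tendsto.congr' ?_ t1
  filter_upwards [h.as R] with n hn
  exact (fin_I hR hτ fun i => (hn i).1).symm

lemma Apx.t_C (hA : CplOK A g) (hp : 0 < p) (h : Apx A p V P v M ε) {τ : ℝ} (hτ0 : 0 < τ) (c : ℝ) :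
    Tendsto (fun n => 4 * mo τ 3 (fun x => ∑ i, (pd x (v n i) x - c * v n i x) ^ 2)) atTop
      (𝓝 (Jl p V P τ - 2 * c * Il V τ + c ^ 2 * (4 * mo τ 3 (sqs V)))) := by
  obtain ⟨R, hR, hτ⟩ := exists_R τ
  have t1 := ((h.t_J hA hp hτ0).sub ((h.t_I (τ := τ)).const_mul (2 * c))).add
    (((h.t_sqs τ 2).const_mul 4).const_mul (c ^ 2))
  refine Tendsto.congr' ?_ t1
  filter_upwards [h.as R] with n hn
  have hv1 : ∀ i, ContDiffOn ℝ 1 (v n i) (ball 0 R) := fun i => (hn i).1.of_le (by norm_num)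
  have c1 : ContinuousOn (fun x => ∑ i, (pd x (v n i) x) ^ 2) (ball 0 R) :=
    continuousOn_finset_sum _ fun i _ => (cont_rd (hv1 i)).pow 2
  have c2 : ContinuousOn (fun x => ∑ i, v n i x * pd x (v n i) x) (ball 0 R) :=
    continuousOn_finset_sum _ fun i _ => (hv1 i).continuousOn.mul (cont_rd (hv1 i))
  have c3 := (cd_sqs fun i => (hn i).1).continuousOn
  have e : (fun x => ∑ i, (pd x (v n i) x - c * v n i x) ^ 2) = fun x =>
      (∑ i, (pd x (v n i) x) ^ 2 - (2 * c) * ∑ i, v n i x * pd x (v n i) x) + c ^ 2 * sqs (v n) x := by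
    ext x
    rw [sqs, Finset.mul_sum, Finset.mul_sum, ← Finset.sum_sub_distrib, ← Finset.sum_add_distrib]
    exact Finset.sum_congr rfl fun i _ => by ring
  have e2 := mo_add hR hτ 2 (c1.fun_sub (c2.const_mul (2 * c))) (c3.const_mul (c ^ 2))
  have e3 := mo_sub hR hτ 2 c1 (c2.const_mul (2 * c))
  rw [mo_cmul] at e2 e3
  simp only [Nat.reduceAdd] at e2 e3 ⊢
  rw [e, e2, e3]
  ring

lemma Apx.C_nonneg (hA : CplOK A g) (hp : 0 < p) (h : Apx A p V P v M ε) {τ : ℝ} (hτ0 : 0 < τ) (c : ℝ) :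
    0 ≤ Jl p V P τ - 2 * c * Il V τ + c ^ 2 * (4 * mo τ 3 (sqs V)) := by
  obtain ⟨R, hR, hτ⟩ := exists_R τ
  refine ge_of_tendsto' (h.t_C hA hp hτ0 c) fun n => ?_
  have := mo_nonneg (N := N) hR hτ 2 (h := fun x => ∑ i, (pd x (v n i) x - c * v n i x) ^ 2)
    fun x _ => Finset.sum_nonneg fun i _ => sq_nonneg _
  norm_num at this ⊢
  linarith

lemma Apx.D_nonneg (hp : 0 < p) (h : Apx A p V P v M ε) {τ : ℝ} (hτ0 : 0 < τ) (m : ℕ) :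
    0 ≤ Dl p V P τ m := by
  obtain ⟨R, hR, hτ⟩ := exists_R τ
  refine ge_of_tendsto' (h.t_D hp hτ0 m) fun n => ?_
  exact mo_nonneg (N := N) hR hτ (m+2) fun x _ =>
    Finset.sum_nonneg fun i _ => Finset.sum_nonneg fun k _ => sq_nonneg _

end

lemma mo_deriv {N : ℕ} {g : Eu N → ℝ} (hg : Continuous g) (k : ℕ) (τ : ℝ) :
    HasDerivAt (fun τ => mo τ (k + 2) g) (((k:ℝ) + 2) * mo τ (k + 1) g) τ := by
  obtain ⟨R, hR, hτ⟩ := exists_R (τ + 1)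
  have hF : ∀ t, Integrable fun x => wt t (k + 2) x * g x := fun t => by
    obtain ⟨R, hR, hτ⟩ := exists_R t
    exact wt_mul_int hR hτ (k+1) hg.continuousOn
  have key := hasDerivAt_integral_of_dominated_loc_of_deriv_le (μ := volume)
    (F := fun t (x : Eu N) => wt t (k + 2) x * g x)
    (F' := fun t x => (((k:ℝ) + 2) * wt t (k + 1) x) * g x) (x₀ := τ) (s := ball τ 1)
    (bound := fun x => wt (τ + 1) (k + 1) x * (((k:ℝ) + 2) * |g x|))
    (ball_mem_nhds τ one_pos) (Eventually.of_forall fun t => (hF t).aestronglyMeasurable)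
    (hF τ) ?_ ?_ ?_ ?_
  · have e : ((k:ℝ) + 2) * mo τ (k + 1) g = ∫ x, (((k:ℝ) + 2) * wt τ (k + 1) x) * g x := by
      rw [mo, ← integral_const_mul]; simp only [mul_assoc]
    rw [e]; exact key.2
  · exact ((continuous_const.mul (wt_continuous _ _)).mul hg).aestronglyMeasurable
  · refine Eventually.of_forall fun x t ht => ?_
    rw [Real.norm_eq_abs, abs_mul, abs_mul, abs_of_nonneg (wt_nonneg _ _ _),
      abs_of_nonneg (by positivity : (0:ℝ) ≤ (k:ℝ) + 2)]
    have : wt t (k + 1) x ≤ wt (τ + 1) (k + 1) x := by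
      unfold wt
      have : t ≤ τ + 1 := by rw [mem_ball, Real.dist_eq] at ht; linarith [(abs_lt.1 ht).2]
      gcongr
    calc ((k:ℝ) + 2) * wt t (k + 1) x * |g x| = wt t (k + 1) x * (((k:ℝ) + 2) * |g x|) := by ring
      _ ≤ _ := by gcongr
  · exact wt_mul_int hR hτ k (continuous_const.mul hg.abs).continuousOn
  · refine Eventually.of_forall fun x t _ => ?_
    have h1 := hasDerivAt_maxpow k (t - ‖x‖ ^ 2)
    have h2 := h1.comp t ((hasDerivAt_id t).sub_const (‖x‖ ^ 2))
    have h3 := h2.mul_const (g x)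
    have e : (fun t => wt t (k + 2) x * g x) = fun t => (max (t - ‖x‖ ^ 2) 0) ^ (k + 2) * g x := rfl
    simp only [e]
    refine h3.congr_deriv ?_
    unfold wt; push_cast; ring

end

section

/-- monotonicity of quotient by a power -/
lemma mono_pow_quot {H H' : ℝ → ℝ} {s : Set ℝ} (hs : Convex ℝ s) (hpos : ∀ t ∈ s, 0 < t)
    (hd : ∀ t ∈ s, HasDerivAt H (H' t) t) {a : ℝ} (h : ∀ t ∈ s, a * H t ≤ t * H' t) :
    MonotoneOn (fun t => H t * t ^ (-a)) s := by
  have hd' : ∀ t ∈ s, HasDerivAt (fun t => H t * t ^ (-a))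
      (H' t * t ^ (-a) + H t * (-a * t ^ (-a - 1))) t := fun t ht =>
    (hd t ht).mul (Real.hasDerivAt_rpow_const (Or.inl (hpos t ht).ne'))
  refine monotoneOn_of_deriv_nonneg hs (fun t ht => (hd' t ht).continuousAt.continuousWithinAt)
    (fun t ht => (hd' t (interior_subset ht)).differentiableAt.differentiableWithinAt) fun t ht => ?_
  have ht := interior_subset ht
  rw [(hd' t ht).deriv]
  have h0 := hpos t ht
  have e : t ^ (-a) = t * t ^ (-a - 1) := by
    rw [mul_comm, ← Real.rpow_add_one h0.ne']; congr 1; ring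
  rw [e]
  have h1 := Real.rpow_pos_of_pos h0 (-a - 1)
  have h2 := h t ht
  nlinarith

lemma ode_growth {H E H' E' I J Q : ℝ → ℝ} {κ ρ C : ℝ}
    (hH : ∀ t, 0 < t → HasDerivAt H (H' t) t) (hE : ∀ t, 0 < t → HasDerivAt E (E' t) t)
    (hI : ∀ t, 0 < t → I t = t * H' t - κ * H t)
    (hJ : ∀ t, 0 < t → 2 * J t = t * E' t - κ * E t - 2 * Q t)
    (hQ : ∀ t, 0 < t → 0 ≤ Q t) (hEI : ∀ t, 0 < t → E t ≤ 2 * I t) (hE0 : ∀ t, 0 < t → 0 ≤ E t)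
    (hcs : ∀ t, 0 < t → ∀ c, 0 ≤ J t - 2 * c * I t + c ^ 2 * H t)
    (hH0 : ∀ t, 0 < t → 0 ≤ H t) (hH'0 : ∀ t, 0 < t → 0 ≤ H' t)
    (hgr : ∀ t, 1 ≤ t → H t ≤ C * t ^ (κ + ρ)) : ∀ t, 0 < t → E t ≤ 2 * ρ * H t := by
  intro t0 ht0
  by_contra hcon
  push Not at hcon
  have hpos0 : 0 < H t0 := by
    rcases (hH0 t0 ht0).lt_or_eq with h | h
    · exact h
    · exfalso
      have h1 := hcs t0 ht0
      rw [← h] at h1 hcon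
      have h2 : 0 ≤ I t0 := by linarith [hEI t0 ht0, hE0 t0 ht0]
      have h3 := hEI t0 ht0
      have h4 : 0 < I t0 := by linarith
      have h5 := h1 ((J t0 + 1) / (2 * I t0))
      have : 2 * ((J t0 + 1) / (2 * I t0)) * I t0 = J t0 + 1 := by field_simp
      linarith
  have hsub : ∀ t ∈ Ici t0, 0 < t := fun t ht => lt_of_lt_of_le ht0 ht
  have hmonoH : MonotoneOn H (Ici t0) :=
    monotoneOn_of_deriv_nonneg (convex_Ici t0)
      (fun t ht => (hH t (hsub t ht)).continuousAt.continuousWithinAt)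
      (fun t ht => (hH t (hsub t (interior_subset ht))).differentiableAt.differentiableWithinAt)
      fun t ht => by
        rw [(hH t (hsub t (interior_subset ht))).deriv]; exact hH'0 t (hsub t (interior_subset ht))
  have hHp : ∀ t ∈ Ici t0, 0 < H t := fun t ht =>
    lt_of_lt_of_le hpos0 (hmonoH self_mem_Ici ht ht)
  have hmonoQ : MonotoneOn (fun t => E t / H t) (Ici t0) := by
    have hd : ∀ t ∈ Ici t0, HasDerivAt (fun t => E t / H t)
        ((E' t * H t - E t * H' t) / H t ^ 2) t := fun t ht =>
      (hE t (hsub t ht)).div (hH t (hsub t ht)) (hHp t ht).ne'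
    refine monotoneOn_of_deriv_nonneg (convex_Ici t0)
      (fun t ht => (hd t ht).continuousAt.continuousWithinAt)
      (fun t ht => (hd t (interior_subset ht)).differentiableAt.differentiableWithinAt) fun t ht => ?_
    have ht := interior_subset ht
    rw [(hd t ht).deriv]
    refine div_nonneg ?_ (sq_nonneg _)
    have p0 := hsub t ht
    have pH := hHp t ht
    have h1 := hcs t p0 (I t / H t)
    have h2 : I t ^ 2 ≤ J t * H t := by
      have e : J t - 2 * (I t / H t) * I t + (I t / H t) ^ 2 * H t = (J t * H t - I t ^ 2) / H t := by
        field_simp; ring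
      rw [e] at h1
      have := (div_nonneg_iff.1 h1).resolve_right (by rintro ⟨_, h⟩; linarith)
      linarith [this.1]
    have h3 : t * (E' t * H t - E t * H' t) = 2 * (J t * H t) + 2 * Q t * H t - E t * I t := by
      linear_combination (-H t) * hJ t p0 + (E t) * hI t p0
    have h4 : 0 ≤ I t := by linarith [hEI t p0, hE0 t p0]
    have h5 : E t * I t ≤ 2 * I t ^ 2 := by nlinarith [hEI t p0]
    have h6 := mul_nonneg (hQ t p0) pH.le
    have h7 : 0 ≤ t * (E' t * H t - E t * H' t) := by rw [h3]; nlinarith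
    exact nonneg_of_mul_nonneg_right h7 p0
  obtain ⟨η, hη, hη'⟩ : ∃ η > 0, E t0 / H t0 = 2 * (ρ + η) := by
    refine ⟨(E t0 / H t0 - 2 * ρ) / 2, ?_, by ring⟩
    have : 2 * ρ < E t0 / H t0 := by rwa [lt_div_iff₀ hpos0]
    linarith
  have hI2 : ∀ t ∈ Ici t0, (κ + (ρ + η)) * H t ≤ t * H' t := by
    intro t ht
    have h1 := hmonoQ self_mem_Ici ht ht
    simp only [hη'] at h1
    rw [le_div_iff₀ (hHp t ht)] at h1
    have := hEI t (hsub t ht)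
    have := hI t (hsub t ht)
    linarith
  have hm := mono_pow_quot (convex_Ici t0) hsub (fun t ht => hH t (hsub t ht)) hI2
  set c := H t0 * t0 ^ (-(κ + (ρ + η))) with hc
  have hc0 : 0 < c := mul_pos hpos0 (Real.rpow_pos_of_pos ht0 _)
  have hfin : ∀ t, max t0 1 ≤ t → c * t ^ η ≤ C := by
    intro t ht
    have htt0 : t0 ≤ t := (le_max_left _ _).trans ht
    have htp : 0 < t := lt_of_lt_of_le ht0 htt0
    have h1 := hm self_mem_Ici htt0 htt0
    have h2 := hgr t ((le_max_right _ _).trans ht)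
    have h3 : c ≤ C * t ^ (κ + ρ) * t ^ (-(κ + (ρ + η))) :=
      h1.trans (mul_le_mul_of_nonneg_right h2 (Real.rpow_nonneg htp.le _))
    rw [mul_assoc, ← Real.rpow_add htp, show κ + ρ + -(κ + (ρ + η)) = -η by ring,
      Real.rpow_neg htp.le] at h3
    have := Real.rpow_pos_of_pos htp η
    rwa [← div_eq_mul_inv, le_div_iff₀ this] at h3
  have hT : Tendsto (fun t : ℝ => c * t ^ η) atTop atTop := (tendsto_rpow_atTop hη).const_mul_atTop hc0
  obtain ⟨t, h1, h2⟩ := ((hT.eventually_gt_atTop C).and (eventually_ge_atTop (max t0 1))).exists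
  linarith [hfin t h2]

section
variable {N d : ℕ} {A : Fin d → Fin d → ℝ} {g : Fin d → ℕ} {p : ℝ}
  {V : Fin d → Eu N → ℝ} {P : Eu N → ℝ} {v : ℕ → Fin d → Eu N → ℝ} {M ε : ℕ → ℝ}

/-- height function -/
def Hl (V : Fin d → Eu N → ℝ) (τ : ℝ) : ℝ := 4 * mo τ 3 (sqs V)

lemma Hl_deriv (hV : ∀ i, Continuous (V i)) (τ : ℝ) : HasDerivAt (Hl V) (12 * mo τ 2 (sqs V)) τ := by
  have := (mo_deriv (sqs_continuous hV) 1 τ).const_mul 4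
  refine this.congr_deriv ?_
  norm_num; ring

lemma Hl_nonneg (V : Fin d → Eu N → ℝ) (τ : ℝ) : 0 ≤ Hl V τ := by
  obtain ⟨R, hR, hτ⟩ := exists_R τ
  have := mo_nonneg (N := N) hR hτ 2 (h := sqs V) fun x _ => Finset.sum_nonneg fun i _ => sq_nonneg _
  unfold Hl
  linarith

def El (p : ℝ) (V : Fin d → Eu N → ℝ) (P : Eu N → ℝ) (τ : ℝ) : ℝ := Dl p V P τ 1 + 2 * mo τ 4 P

lemma El_deriv (hV : ∀ i, Continuous (V i)) (hP : Continuous P) (τ : ℝ) :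
    HasDerivAt (El p V P) (4 * Dl p V P τ 0 + 8 * mo τ 3 P) τ := by
  have h1 := mo_deriv (sqs_continuous hV) 0 τ
  have h2 := mo_deriv (sqs_continuous hV) 1 τ
  have h3 := mo_deriv hP 2 τ
  have h4 := (((((hasDerivAt_id τ).mul h1).const_mul 6).sub (h2.const_mul (6 + (N:ℝ)))).const_mul 4).sub
    (h3.const_mul (2 * p))
  have e : El p V P = fun t => (4 * (6 * (t * mo t 2 (sqs V)) - (6 + (N:ℝ)) * mo t 3 (sqs V)))
    - 2 * p * mo t 4 P := by
    ext t; unfold El Dl; norm_num; ring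
  rw [e]
  refine h4.congr_deriv ?_
  unfold Dl
  norm_num
  ring

lemma Il_eq (V : Fin d → Eu N → ℝ) (t : ℝ) :
    Il V t = t * (12 * mo t 2 (sqs V)) - (3 + (N:ℝ) / 2) * Hl V t := by
  unfold Il Hl; ring

lemma Jl_eq (t : ℝ) : 2 * Jl p V P t = t * (4 * Dl p V P t 0 + 8 * mo t 3 P)
    - (3 + (N:ℝ) / 2) * El p V P t - 2 * mo t 4 P := by
  unfold Jl El; ring

lemma El_eq (t : ℝ) : El p V P t = 2 * Il V t - 2 * p * mo t 4 P := by
  unfold Il El Dl; norm_num; ring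

lemma mo_nonneg' {h : Eu N → ℝ} (hh : ∀ x, 0 ≤ h x) (τ : ℝ) (k : ℕ) : 0 ≤ mo τ (k + 1) h := by
  obtain ⟨R, hR, hτ⟩ := exists_R τ
  exact mo_nonneg hR hτ k fun x _ => hh x

lemma Apx.growth (hA : CplOK A g) (hp : 0 < p) (h : Apx A p V P v M ε) {ρ C : ℝ}
    (hgr : ∀ t, 1 ≤ t → Hl V t ≤ C * t ^ (3 + (N:ℝ) / 2 + ρ)) {t : ℝ} (ht : 0 < t) :
    El p V P t ≤ 2 * ρ * Hl V t :=
  ode_growth (Q := fun t => mo t 4 P) (I := Il V) (J := Jl p V P) (fun t _ => Hl_deriv h.Vc t) (fun t _ => El_deriv h.Vc h.Pc t)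
    (fun t _ => Il_eq V t) (fun t _ => Jl_eq t) (fun t _ => mo_nonneg' h.P0 t 3)
    (fun t _ => by
      rw [El_eq]
      have := mul_nonneg hp.le (mo_nonneg' h.P0 t 3)
      norm_num at this
      linarith)
    (fun t ht => add_nonneg (h.D_nonneg hp ht 1) (mul_nonneg zero_le_two (mo_nonneg' h.P0 t 3)))
    (fun t ht c => h.C_nonneg hA hp ht c)
    (fun t _ => Hl_nonneg V t)
    (fun t _ => mul_nonneg (by norm_num) (mo_nonneg' (fun x => Finset.sum_nonneg fun i _ => sq_nonneg _) t 1))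
    hgr t ht

/-- with zero potential: antitone -/
lemma Apx.anti (hA : CplOK A g) (hp : 0 < p) (h : Apx A p V (fun _ => 0) v M ε) {ρ C : ℝ}
    (hgr : ∀ t, 1 ≤ t → Hl V t ≤ C * t ^ (3 + (N:ℝ) / 2 + ρ)) :
    AntitoneOn (fun t => Hl V t * t ^ (-(3 + (N:ℝ) / 2 + ρ))) (Ioi 0) := by
  have h1 : MonotoneOn (fun t => (fun t => - Hl V t) t * t ^ (-(3 + (N:ℝ) / 2 + ρ))) (Ioi 0) := by
    refine mono_pow_quot (H' := fun t => -(12 * mo t 2 (sqs V))) (convex_Ioi 0) (fun t ht => ht)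
      (fun t _ => (Hl_deriv h.Vc t).neg) fun t ht => ?_
    have h2 := h.growth hA hp hgr ht
    rw [El_eq, Il_eq] at h2
    have h0 : mo t 4 (fun _ : Eu N => (0:ℝ)) = 0 := by simp [mo]
    rw [h0] at h2
    simp only [Pi.neg_apply]
    linarith
  intro a ha b hb hab
  have := h1 ha hb hab
  simp only at this ⊢
  linarith

lemma Apx.homog_C (hp : 0 < p) {ρ c : ℝ} (hVc : ∀ i, Continuous (V i)) {T : ℝ}
    (hh : ∀ t, 0 < t → t < T → Hl V t = c * t ^ (3 + (N:ℝ) / 2 + ρ)) {t : ℝ} (ht : 0 < t) (htT : t < T) :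
    Jl p V (fun _ => 0) t - 2 * ρ * Il V t + ρ ^ 2 * (4 * mo t 3 (sqs V)) = 0 := by
  have z : ∀ s k, mo s k (fun _ : Eu N => (0:ℝ)) = 0 := fun s k => by simp [mo]
  have hI : ∀ s, 0 < s → s < T → Il V s = ρ * Hl V s := by
    intro s hs hsT
    have h1 : HasDerivAt (fun t => c * t ^ (3 + (N:ℝ) / 2 + ρ))
        (c * ((3 + (N:ℝ) / 2 + ρ) * s ^ (3 + (N:ℝ) / 2 + ρ - 1))) s :=
      (Real.hasDerivAt_rpow_const (Or.inl hs.ne')).const_mul c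
    have h2 : (fun t => c * t ^ (3 + (N:ℝ) / 2 + ρ)) =ᶠ[𝓝 s] Hl V := by
      filter_upwards [Ioo_mem_nhds hs hsT] with t ht
      rw [hh t ht.1 ht.2]
    have h3 := (h1.congr_of_eventuallyEq h2.symm).unique (Hl_deriv hVc s)
    have h4 : s ^ (3 + (N:ℝ) / 2 + ρ) = s * s ^ (3 + (N:ℝ) / 2 + ρ - 1) := by
      rw [mul_comm, ← Real.rpow_add_one hs.ne']; congr 1; ring
    rw [Il_eq, ← h3, hh s hs hsT, h4]; ring
  have hE' : 4 * Dl p V (fun _ => 0) t 0 + 8 * mo t 3 (fun _ : Eu N => (0:ℝ)) = 2 * ρ * (12 * mo t 2 (sqs V)) := by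
    have h1 := (Hl_deriv hVc t).const_mul (2 * ρ)
    have h2 : El p V (fun _ => 0) =ᶠ[𝓝 t] fun t => 2 * ρ * Hl V t := by
      filter_upwards [Ioo_mem_nhds ht htT] with s hs
      rw [El_eq, z, hI s hs.1 hs.2]; ring
    exact (El_deriv hVc continuous_const t).unique (h1.congr_of_eventuallyEq h2)
  have hJ := Jl_eq (p := p) (V := V) (P := fun _ => 0) t
  rw [hE', El_eq, z, hI t ht htT] at hJ
  have hi := Il_eq V t
  rw [hI t ht htT] at hi ⊢
  rw [show 4 * mo t 3 (sqs V) = Hl V t from rfl]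
  linear_combination (1/2) * hJ - ρ * hi
end

end

section

lemma scale_diff {N : ℕ} {w ψ : Eu N → ℝ} {R τ τ' ρ : ℝ} (hR : 0 ≤ R) (hτ0 : 0 < τ') (hττ : τ' < τ)
    (hτR : 16 * τ < R ^ 2)
    (hw : ContDiffOn ℝ 1 w (ball 0 R)) (hψ : Continuous ψ) {l : ℝ} (hl : 0 < l) (hl1 : l ≤ 1)
    (hρ : 0 ≤ ρ) {B : ℝ} (hB0 : 0 ≤ B) (hB : ∀ x : Eu N, ‖x‖ ^ 2 < τ' → |ψ x| ≤ B) :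
    |mo τ' 1 (fun x => ψ x * w x) - mo τ' 1 (fun x => ψ x * (l ^ (-ρ) * w (l • x)))|
      ≤ B * τ' / (τ - τ') ^ 3 * l ^ (-ρ - 1 - N) * mo τ 3 (fun x => |pd x w x - ρ * w x|) := by
  set f : ℝ → ℝ := fun t => mo τ' 1 (fun x => ψ x * (t ^ (-ρ) * w (t • x))) with hf
  set hh : Eu N → ℝ := fun y => pd y w y - ρ * w y with hhd
  have chh : ContinuousOn hh (ball 0 R) := (cont_rd hw).sub (hw.continuousOn.const_mul ρ)
  have hin : ∀ t : ℝ, |t| ≤ 2 → ∀ x : Eu N, ‖x‖ ^ 2 ≤ 2 * τ' → t • x ∈ ball (0 : Eu N) R := by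
    intro t ht x hx
    rw [mem_ball_zero_iff, norm_smul, Real.norm_eq_abs]
    have h1 : (|t| * ‖x‖) ^ 2 < R ^ 2 := by
      rw [mul_pow]
      have : |t| ^ 2 ≤ 4 := by nlinarith [abs_nonneg t]
      nlinarith [sq_nonneg ‖x‖]
    exact lt_of_pow_lt_pow_left₀ 2 hR h1
  -- the derivative
  set G : ℝ × Eu N → ℝ := fun q => ψ q.2 * (q.1 ^ (-ρ - 1) * hh (q.1 • q.2)) with hG
  set K : Set (ℝ × Eu N) := Icc (l / 2) 2 ×ˢ closedBall (0 : Eu N) (Real.sqrt τ') with hK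
  have hKc : IsCompact K := isCompact_Icc.prod (isCompact_closedBall _ _)
  have hsq : ∀ x : Eu N, ‖x‖ ≤ Real.sqrt τ' ↔ ‖x‖ ^ 2 ≤ τ' := fun x =>
    Real.le_sqrt (norm_nonneg _) hτ0.le
  have hKb : ∀ q ∈ K, q.1 • q.2 ∈ ball (0 : Eu N) R := by
    rintro ⟨t, x⟩ ⟨ht, hx⟩
    rw [mem_closedBall_zero_iff, hsq] at hx
    refine hin t ?_ x (by linarith)
    rw [abs_le]; constructor <;> linarith [ht.1, ht.2]
  have hKpos : ∀ q ∈ K, 0 < q.1 := by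
    rintro ⟨t, x⟩ ⟨ht, hx⟩
    have := ht.1
    simp only at this ⊢
    linarith
  have cG : ContinuousOn G K := by
    refine (hψ.comp continuous_snd).continuousOn.mul (ContinuousOn.mul ?_ ?_)
    · exact continuous_fst.continuousOn.rpow_const fun q hq => Or.inl (hKpos q hq).ne'
    · exact chh.comp (continuous_fst.smul continuous_snd).continuousOn hKb
  obtain ⟨B1, hB1⟩ := hKc.exists_bound_of_continuousOn cG
  have hτR' : τ' < R ^ 2 := by nlinarith
  have contF : ∀ t ∈ Ioo (l / 2) 2, Continuous fun x : Eu N => wt τ' (0 + 1) x * (ψ x * (t ^ (-ρ) * w (t • x))) := by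
    intro t ht
    -- use a slightly bigger ball
    refine wt_mul_cont (R := Real.sqrt (2 * τ')) (Real.sqrt_nonneg _)
      (by rw [Real.sq_sqrt (by positivity)]; linarith) 0 ?_
    refine hψ.continuousOn.mul (continuousOn_const.mul (hw.continuousOn.comp
      (continuous_const_smul t).continuousOn ?_))
    intro x hx
    rw [mem_ball_zero_iff] at hx
    have h2 : ‖x‖ ^ 2 < 2 * τ' := by
      rw [← Real.lt_sqrt (norm_nonneg _)]; exact hx
    exact hin t (by rw [abs_le]; constructor <;> linarith [ht.1, ht.2]) x h2.le
  have hder : ∀ t ∈ Ioo (l / 2) 2, ∀ x : Eu N, HasDerivAt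
      (fun t : ℝ => wt τ' (0 + 1) x * (ψ x * (t ^ (-ρ) * w (t • x)))) (wt τ' (0 + 1) x * G (t, x)) t := by
    intro t ht x
    by_cases hx : τ' ≤ ‖x‖ ^ 2
    · rw [wt_zero hx]; simp only [zero_mul]; exact hasDerivAt_const _ _
    push Not at hx
    have ht0 : 0 < t := by linarith [ht.1]
    have hmem := hin t (by rw [abs_le]; constructor <;> linarith [ht.1, ht.2]) x (by linarith)
    have h1 : HasDerivAt (fun t : ℝ => w (t • x)) (pd x w (t • x)) t := by
      have hd := ((cd_at isOpen_ball hw hmem).differentiableAt (by norm_num)).hasFDerivAt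
      have h2 : HasDerivAt (fun t : ℝ => t • x) ((1 : ℝ) • x) t := (hasDerivAt_id t).smul_const x
      have := hd.comp_hasDerivAt t h2
      rw [one_smul] at this
      exact this
    have h2 := (Real.hasDerivAt_rpow_const (p := -ρ) (Or.inl ht0.ne')).mul h1
    refine ((h2.const_mul (ψ x)).const_mul (wt τ' (0 + 1) x)).congr_deriv ?_
    have e1 : t ^ (-ρ) = t * t ^ (-ρ - 1) := by
      rw [mul_comm, ← Real.rpow_add_one ht0.ne']; congr 1; ring
    have e2 : pd (t • x) w (t • x) = t * pd x w (t • x) := by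
      simp [pd]
    simp only [hG, hhd]
    rw [e1, e2]; ring
  have hGb : ∀ t ∈ Ioo (l / 2) 2, ∀ x : Eu N, ‖wt τ' (0 + 1) x * G (t, x)‖ ≤ wt τ' (0 + 1) x * B1 := by
    intro t ht x
    rw [norm_mul, Real.norm_eq_abs, abs_of_nonneg (wt_nonneg _ _ _)]
    by_cases hx : τ' ≤ ‖x‖ ^ 2
    · rw [wt_zero hx]; simp
    push Not at hx
    refine mul_le_mul_of_nonneg_left (hB1 _ ⟨⟨ht.1.le, ht.2.le⟩, ?_⟩) (wt_nonneg _ _ _)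
    rw [mem_closedBall_zero_iff, hsq]; exact hx.le
  have hfd : ∀ t ∈ Icc l 1, HasDerivAt f (∫ x, wt τ' (0 + 1) x * G (t, x)) t := by
    intro t ht
    have htI : t ∈ Ioo (l / 2) 2 := ⟨by linarith [ht.1], by linarith [ht.2]⟩
    refine (hasDerivAt_integral_of_dominated_loc_of_deriv_le (μ := volume)
      (F := fun t (x : Eu N) => wt τ' (0 + 1) x * (ψ x * (t ^ (-ρ) * w (t • x))))
      (F' := fun t x => wt τ' (0 + 1) x * G (t, x)) (s := Ioo (l / 2) 2)
      (bound := fun x => wt τ' (0 + 1) x * B1) (Ioo_mem_nhds htI.1 htI.2) ?_ ?_ ?_ ?_ ?_ ?_).2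
    · filter_upwards [Ioo_mem_nhds htI.1 htI.2] with s hs
      exact (contF s hs).aestronglyMeasurable
    · exact (contF t htI).integrable_of_hasCompactSupport (wt_mul_supp 0 _)
    · have : ∀ x, wt τ' (0 + 1) x * G (t, x) = deriv (fun t : ℝ => wt τ' (0 + 1) x * (ψ x * (t ^ (-ρ) * w (t • x)))) t :=
        fun x => (hder t htI x).deriv.symm
      refine (wt_mul_cont (R := Real.sqrt (2 * τ')) (Real.sqrt_nonneg _)
        (by rw [Real.sq_sqrt (by positivity)]; linarith) 0 (g := fun x => G (t, x)) ?_).aestronglyMeasurable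
      have hmaps : MapsTo (fun x : Eu N => t • x) (ball 0 (Real.sqrt (2 * τ'))) (ball 0 R) := by
        intro x hx
        rw [mem_ball_zero_iff] at hx
        have h2 : ‖x‖ ^ 2 < 2 * τ' := by
          rw [← Real.lt_sqrt (norm_nonneg _)]; exact hx
        exact hin t (by rw [abs_le]; constructor <;> linarith [htI.1, htI.2]) x h2.le
      have hcc : ContinuousOn (fun x : Eu N => hh (t • x)) (ball 0 (Real.sqrt (2 * τ'))) :=
        chh.comp (continuous_const_smul t).continuousOn hmaps
      have hcm : ContinuousOn (fun x : Eu N => t ^ (-ρ - 1) * hh (t • x)) (ball 0 (Real.sqrt (2 * τ'))) :=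
        hcc.const_mul _
      exact hψ.continuousOn.mul hcm
    · exact Eventually.of_forall fun x s hs => hGb s hs x
    · exact wt_mul_int hR hτR' 0 continuousOn_const
    · exact Eventually.of_forall fun x s hs => hder s hs x
  have hRτ : τ < R ^ 2 := by nlinarith
  have hbd : ∀ t ∈ Icc l 1, ‖∫ x, wt τ' (0 + 1) x * G (t, x)‖
      ≤ B * τ' / (τ - τ') ^ 3 * l ^ (-ρ - 1 - N) * mo τ 3 (fun x => |pd x w x - ρ * w x|) := by
    intro t ht
    have ht0 : 0 < t := lt_of_lt_of_le hl ht.1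
    have hintg : Integrable fun x : Eu N => wt τ 3 x * |hh x| := wt_mul_int hR hRτ 2 chh.abs
    have hint2 : Integrable fun x : Eu N => (fun y => wt τ 3 y * |hh y|) (t • x) :=
      hintg.comp_smul ht0.ne'
    have hcv : ∫ x : Eu N, (fun y => wt τ 3 y * |hh y|) (t • x) = t ^ (-(N:ℝ)) * mo τ 3 (fun x => |hh x|) := by
      have hq := Measure.integral_comp_smul volume (fun y : Eu N => wt τ 3 y * |hh y|) t
      refine hq.trans ?_
      simp only [finrank_euclideanSpace, Fintype.card_fin, smul_eq_mul, mo]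
      rw [Real.rpow_neg ht0.le, Real.rpow_natCast, abs_of_nonneg (by positivity)]
    have hpt : ∀ x : Eu N, ‖wt τ' (0 + 1) x * G (t, x)‖ ≤ (B * τ' / (τ - τ') ^ 3 * t ^ (-ρ - 1)) *
        (fun y => wt τ 3 y * |hh y|) (t • x) := by
      intro x
      have hd3 : 0 < (τ - τ') ^ 3 := pow_pos (by linarith) 3
      have hr0 := Real.rpow_pos_of_pos ht0 (-ρ - 1)
      have hwt3 := wt_nonneg τ 3 (t • x)
      by_cases hx : τ' ≤ ‖x‖ ^ 2
      · rw [wt_zero hx, zero_mul, norm_zero]; positivity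
      push Not at hx
      have h1 : wt τ' (0 + 1) x ≤ τ' := by simpa using wt_le hτ0.le 1 x
      have h2 : (τ - τ') ^ 3 ≤ wt τ 3 (t • x) := by
        unfold wt
        refine pow_le_pow_left₀ (by linarith) (le_max_of_le_left ?_) 3
        have : ‖t • x‖ ^ 2 ≤ τ' := by
          rw [norm_smul, mul_pow, Real.norm_eq_abs, sq_abs]
          have : t ^ 2 ≤ 1 := by nlinarith [ht.2]
          nlinarith [sq_nonneg ‖x‖]
        linarith
      have h3 := hB x hx
      rw [norm_mul, Real.norm_eq_abs, Real.norm_eq_abs, abs_of_nonneg (wt_nonneg _ _ _), hG]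
      simp only
      rw [abs_mul, abs_mul, abs_of_pos hr0]
      calc wt τ' (0 + 1) x * (|ψ x| * (t ^ (-ρ - 1) * |hh (t • x)|))
          ≤ τ' * (B * (t ^ (-ρ - 1) * |hh (t • x)|)) := by
            have := wt_nonneg τ' (0+1) x
            gcongr
        _ = (B * τ' / (τ - τ') ^ 3 * t ^ (-ρ - 1)) * ((τ - τ') ^ 3 * |hh (t • x)|) := by
            have hne : τ - τ' ≠ 0 := by
              intro hz
              linarith
            field_simp
        _ ≤ _ := by gcongr
    have h1 := norm_integral_le_of_norm_le (hint2.const_mul (B * τ' / (τ - τ') ^ 3 * t ^ (-ρ - 1)))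
      (Eventually.of_forall hpt)
    rw [integral_const_mul, hcv] at h1
    refine h1.trans ?_
    have hmo : 0 ≤ mo τ 3 (fun x => |hh x|) := mo_nonneg' (fun x => abs_nonneg _) τ 2
    have hexp : t ^ (-ρ - 1) * t ^ (-(N:ℝ)) ≤ l ^ (-ρ - 1 - N) := by
      rw [← Real.rpow_add ht0, show -ρ - 1 + -(N:ℝ) = -ρ - 1 - N by ring]
      exact Real.rpow_le_rpow_of_nonpos hl ht.1 (by have : (0:ℝ) ≤ N := Nat.cast_nonneg N
                                                    linarith)
    have hc : 0 ≤ B * τ' / (τ - τ') ^ 3 := by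
      have : 0 < (τ - τ') ^ 3 := pow_pos (by linarith) 3
      positivity
    calc _ = B * τ' / (τ - τ') ^ 3 * (t ^ (-ρ - 1) * t ^ (-(N:ℝ))) * mo τ 3 (fun x => |hh x|) := by ring
      _ ≤ _ := by gcongr
  have hmv := (convex_Icc l 1).norm_image_sub_le_of_norm_hasDerivWithin_le
    (fun t ht => (hfd t ht).hasDerivWithinAt) hbd (left_mem_Icc.2 hl1) (right_mem_Icc.2 hl1)
  have h1 : f 1 = mo τ' 1 (fun x => ψ x * w x) := by simp [hf]
  rw [h1, Real.norm_eq_abs, Real.norm_eq_abs, abs_of_nonneg (by linarith : (0:ℝ) ≤ 1 - l)] at hmv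
  refine hmv.trans ?_
  have hmo : 0 ≤ mo τ 3 (fun x => |pd x w x - ρ * w x|) := mo_nonneg' (fun x => abs_nonneg _) τ 2
  have hc : 0 ≤ B * τ' / (τ - τ') ^ 3 := by
      have : 0 < (τ - τ') ^ 3 := pow_pos (by linarith) 3
      positivity
  have := Real.rpow_pos_of_pos hl (-ρ - 1 - N)
  exact mul_le_of_le_one_right (by positivity) (by linarith)

lemma mo_zero {N : ℕ} {ψ : Eu N → ℝ} (hψ : Continuous ψ) (h0 : ∀ x, 0 ≤ ψ x) {τ : ℝ} {k : ℕ}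
    (h : mo τ (k + 1) ψ = 0) {x : Eu N} (hx : ‖x‖ ^ 2 < τ) : ψ x = 0 := by
  have hc : Continuous fun x => wt τ (k + 1) x * ψ x := (wt_continuous _ _).mul hψ
  obtain ⟨R, hR, hτ⟩ := exists_R τ
  have h1 := (integral_eq_zero_iff_of_nonneg (fun x => mul_nonneg (wt_nonneg τ (k+1) x) (h0 x))
    (wt_mul_int hR hτ k hψ.continuousOn)).1 h
  have h2 := (hc.ae_eq_iff_eq volume continuous_const).1 h1
  have h3 : wt τ (k + 1) x * ψ x = 0 := congrFun h2 x
  exact (mul_eq_zero.1 h3).resolve_left (wt_pos hx).ne'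

section
variable {N d : ℕ} {A : Fin d → Fin d → ℝ} {g : Fin d → ℕ} {p : ℝ}
  {V : Fin d → Eu N → ℝ} {P : Eu N → ℝ} {v : ℕ → Fin d → Eu N → ℝ} {M ε : ℕ → ℝ}

lemma mo_abs_tendsto {l : Filter ℕ} {τ R : ℝ} (hR : 0 ≤ R) (hτ : τ < R ^ 2) {k : ℕ}
    {f : ℕ → Fin d → Eu N → ℝ} (hf : ∀ᶠ n in l, ∀ i, ContinuousOn (f n i) (ball 0 R))
    (h : Tendsto (fun n => 4 * mo τ (k + 1) (fun x => ∑ i, (f n i x) ^ 2)) l (𝓝 0)) (i : Fin d) :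
    Tendsto (fun n => mo τ (k + 1) (fun x => |f n i x|)) l (𝓝 0) := by
  rw [Metric.tendsto_nhds]
  intro e he
  set c := mo (N := N) τ (k + 1) (fun _ => 1) with hc
  have hc0 : 0 ≤ c := mo_nonneg' (fun _ => zero_le_one) _ _
  set s := e / (2 * (c + 1)) with hs
  have hs0 : 0 < s := by positivity
  have h2 := (Metric.tendsto_nhds.1 h) (e * s) (by positivity)
  filter_upwards [hf, h2] with n h3 h4
  have csum : ContinuousOn (fun x => ∑ i, (f n i x) ^ 2) (ball 0 R) :=
    continuousOn_finset_sum _ fun i _ => (h3 i).pow 2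
  have h5 := mo_mono hR hτ k (g := fun x => |f n i x|)
    (h := fun x => s * 1 + s⁻¹ * ∑ i, (f n i x) ^ 2) (h3 i).abs
    (continuousOn_const.add (csum.const_mul _)) fun x _ => by
      have a1 : (f n i x) ^ 2 ≤ ∑ i, (f n i x) ^ 2 :=
        Finset.single_le_sum (f := fun i => (f n i x) ^ 2) (fun i _ => sq_nonneg _) (Finset.mem_univ i)
      have a2 : s⁻¹ * (f n i x) ^ 2 ≤ s⁻¹ * ∑ i, (f n i x) ^ 2 := by gcongr
      have a3 : |f n i x| ≤ s * 1 + s⁻¹ * (f n i x) ^ 2 := by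
        have : s * |f n i x| ≤ s * (s * 1 + s⁻¹ * (f n i x) ^ 2) := by
          have e1 : s * (s * 1 + s⁻¹ * (f n i x) ^ 2) = s ^ 2 + (f n i x) ^ 2 := by field_simp
          rw [e1]
          nlinarith [sq_nonneg (s - |f n i x|), sq_abs (f n i x), abs_nonneg (f n i x)]
        exact le_of_mul_le_mul_left this hs0
      linarith
  rw [mo_add hR hτ k continuousOn_const (csum.const_mul _), mo_cmul, mo_cmul, ← hc] at h5
  have h6 : 0 ≤ mo τ (k + 1) (fun x => |f n i x|) := mo_nonneg' (fun _ => abs_nonneg _) _ _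
  have h7 : 0 ≤ mo τ (k + 1) (fun x => ∑ i, (f n i x) ^ 2) :=
    mo_nonneg' (fun _ => Finset.sum_nonneg fun _ _ => sq_nonneg _) _ _
  rw [Real.dist_eq, sub_zero, abs_of_nonneg (by positivity)] at h4
  rw [Real.dist_eq, sub_zero, abs_of_nonneg h6]
  refine lt_of_le_of_lt h5 ?_
  have h8 : s⁻¹ * mo τ (k + 1) (fun x => ∑ i, (f n i x) ^ 2) < e / 4 := by
    rw [inv_mul_lt_iff₀ hs0]; linarith
  have h9 : s * c ≤ e / 2 := by
    rw [hs, div_mul_eq_mul_div, div_le_iff₀ (by positivity)]; nlinarith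
  linarith

lemma Apx.homog (h : Apx A p V P v M ε) {τ ρ : ℝ} (hρ : 0 ≤ ρ)
    (hz : Tendsto (fun n => 4 * mo τ 3 (fun x => ∑ i, (pd x (v n i) x - ρ * v n i x) ^ 2)) atTop (𝓝 0))
    (i : Fin d) {x : Eu N} (hx : ‖x‖ ^ 2 < τ) {l : ℝ} (hl : 0 < l) (hl1 : l ≤ 1) :
    V i (l • x) = l ^ ρ * V i x := by
  obtain ⟨τ', hxτ, hττ⟩ := exists_between hx
  have hτ0 : 0 < τ' := lt_of_le_of_lt (sq_nonneg _) hxτ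
  obtain ⟨R, hR, hτ16⟩ := exists_R (16 * τ)
  have hτ : τ < R ^ 2 := by linarith
  have hτ' : τ' < R ^ 2 := by linarith
  set ψ : Eu N → ℝ := fun x => V i x - l ^ (-ρ) * V i (l • x) with hψd
  have hψ : Continuous ψ := (h.Vc i).sub (continuous_const.mul ((h.Vc i).comp (continuous_const_smul l)))
  obtain ⟨B, hB⟩ := (isCompact_closedBall (0 : Eu N) R).exists_bound_of_continuousOn hψ.continuousOn
  have hB0 : 0 ≤ B := (norm_nonneg _).trans (hB 0 (by simpa using hR))
  have hlin : ∀ x ∈ ball (0 : Eu N) R, l • x ∈ ball (0 : Eu N) R := by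
    intro x hx
    rw [mem_ball_zero_iff] at hx ⊢
    rw [norm_smul, Real.norm_eq_abs, abs_of_pos hl]
    nlinarith [norm_nonneg x]
  have t1 : Tendsto (fun n => mo τ' (0 + 1) (fun x => ψ x * v n i x)) atTop
      (𝓝 (mo τ' (0 + 1) (fun x => ψ x * V i x))) := by
    refine mo_tendsto hR hτ' 0 ?_ (hψ.mul (h.Vc i)).continuousOn fun δ hδ => ?_
    · filter_upwards [h.as R] with n hn
      exact hψ.continuousOn.mul (hn i).1.continuousOn
    · filter_upwards [h.conv R (δ / (B + 1)) (by positivity)] with n hn x hx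
      rw [← mul_sub, abs_mul]
      have a1 := hB x (ball_subset_closedBall hx)
      have a2 := hn i x hx
      calc |ψ x| * |v n i x - V i x| ≤ B * (δ / (B + 1)) := by gcongr; exact a1
        _ ≤ δ := by rw [mul_div_assoc', div_le_iff₀ (by positivity)]; nlinarith
  have hlr := Real.rpow_pos_of_pos hl (-ρ)
  have t2 : Tendsto (fun n => mo τ' (0 + 1) (fun x => ψ x * (l ^ (-ρ) * v n i (l • x)))) atTop
      (𝓝 (mo τ' (0 + 1) (fun x => ψ x * (l ^ (-ρ) * V i (l • x))))) := by
    refine mo_tendsto hR hτ' 0 ?_ (hψ.mul (continuous_const.mul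
      ((h.Vc i).comp (continuous_const_smul l)))).continuousOn fun δ hδ => ?_
    · filter_upwards [h.as R] with n hn
      exact hψ.continuousOn.mul (continuousOn_const.mul ((hn i).1.continuousOn.comp
        (continuous_const_smul l).continuousOn hlin))
    · filter_upwards [h.conv R (δ / ((B + 1) * l ^ (-ρ))) (by positivity)] with n hn x hx
      rw [← mul_sub, ← mul_sub, abs_mul, abs_mul, abs_of_pos hlr]
      have a1 := hB x (ball_subset_closedBall hx)
      have a2 := hn i _ (hlin x hx)
      calc |ψ x| * (l ^ (-ρ) * |v n i (l • x) - V i (l • x)|)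
          ≤ B * (l ^ (-ρ) * (δ / ((B + 1) * l ^ (-ρ)))) := by gcongr; exact a1
        _ = B * (δ / (B + 1)) := by field_simp
        _ ≤ δ := by rw [mul_div_assoc', div_le_iff₀ (by positivity)]; nlinarith
  have hz' := mo_abs_tendsto hR hτ (k := 2) (f := fun n i x => pd x (v n i) x - ρ * v n i x) (by
    filter_upwards [h.as R] with n hn i
    have hv1 : ContDiffOn ℝ 1 (v n i) (ball 0 R) := (hn i).1.of_le (by norm_num)
    exact (cont_rd hv1).sub (hv1.continuousOn.const_mul ρ)) hz i
  have t3 : Tendsto (fun n => mo τ' (0 + 1) (fun x => ψ x * v n i x)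
      - mo τ' (0 + 1) (fun x => ψ x * (l ^ (-ρ) * v n i (l • x)))) atTop (𝓝 0) := by
    have hz2 := hz'.const_mul (B * τ' / (τ - τ') ^ 3 * l ^ (-ρ - 1 - N))
    rw [mul_zero] at hz2
    refine squeeze_zero_norm' ?_ hz2
    filter_upwards [h.as R] with n hn
    have hv1 : ContDiffOn ℝ 1 (v n i) (ball 0 R) := (hn i).1.of_le (by norm_num)
    refine scale_diff hR hτ0 hττ hτ16 hv1 hψ hl hl1 hρ hB0 fun y hy => hB y ?_
    rw [mem_closedBall_zero_iff]
    exact le_of_sq_le_sq (by linarith) hR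
  have e := tendsto_nhds_unique t3 (t1.sub t2)
  have hsub := mo_sub hR hτ' 0 (g := fun x => ψ x * V i x)
    (h := fun x => ψ x * (l ^ (-ρ) * V i (l • x))) (hψ.mul (h.Vc i)).continuousOn
    (hψ.mul (continuous_const.mul ((h.Vc i).comp (continuous_const_smul l)))).continuousOn
  rw [← hsub] at e
  have e2 : mo τ' (0 + 1) (fun x => ψ x ^ 2) = 0 := by
    refine Eq.trans ?_ e.symm
    congr 1; ext y; simp only [hψd]; ring
  have e3 := mo_zero (hψ.pow 2) (fun x => sq_nonneg _) e2 hxτ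
  have e4 : ψ x = 0 := by simpa using e3
  simp only [hψd] at e4
  have e5 : l ^ ρ * l ^ (-ρ) = 1 := by rw [← Real.rpow_add hl]; simp
  linear_combination (-(l ^ ρ)) * e4 - V i (l • x) * e5
end

end

section

lemma eta_d1 {δ : ℝ} (hδ : 0 < δ) (t : ℝ) :
    HasDerivAt (fun t : ℝ => Real.sqrt (δ ^ 2 + t ^ 2)) (t / Real.sqrt (δ ^ 2 + t ^ 2)) t := by
  have h1 : HasDerivAt (fun t : ℝ => δ ^ 2 + t ^ 2) (2 * t) t := by
    simpa using (hasDerivAt_pow 2 t).const_add (δ ^ 2)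
  have h2 := h1.sqrt (by positivity)
  refine h2.congr_deriv ?_
  have : Real.sqrt (δ ^ 2 + t ^ 2) ≠ 0 := by positivity
  field_simp

lemma eta_d2 {δ : ℝ} (hδ : 0 < δ) (t : ℝ) :
    ∃ c, 0 ≤ c ∧ HasDerivAt (fun t : ℝ => t / Real.sqrt (δ ^ 2 + t ^ 2)) c t := by
  have h0 : Real.sqrt (δ ^ 2 + t ^ 2) ≠ 0 := by positivity
  refine ⟨_, ?_, (hasDerivAt_id t).div (eta_d1 hδ t) h0⟩
  have h3 : 0 < Real.sqrt (δ ^ 2 + t ^ 2) := by positivity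
  have h4 : Real.sqrt (δ ^ 2 + t ^ 2) ^ 2 = δ ^ 2 + t ^ 2 := Real.sq_sqrt (by positivity)
  refine div_nonneg ?_ (by positivity)
  simp only [id]
  have : t * (t / Real.sqrt (δ ^ 2 + t ^ 2)) ≤ Real.sqrt (δ ^ 2 + t ^ 2) := by
    rw [mul_div_assoc', div_le_iff₀ h3]; nlinarith [sq_nonneg δ]
  linarith

lemma eta_cd {N : ℕ} {δ : ℝ} (hδ : 0 < δ) {v : Eu N → ℝ} {S : Set (Eu N)} (hv : ContDiffOn ℝ 2 v S) :
    ContDiffOn ℝ 2 (fun x => Real.sqrt (δ ^ 2 + v x ^ 2)) S :=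
  (contDiffOn_const.add (hv.pow 2)).sqrt fun x _ => by positivity

lemma eta_lapl {N : ℕ} {δ : ℝ} (hδ : 0 < δ) {v : Eu N → ℝ} {x : Eu N} (hv : ContDiffAt ℝ 2 v x) :
    v x / Real.sqrt (δ ^ 2 + v x ^ 2) * lapl v x ≤ lapl (fun x => Real.sqrt (δ ^ 2 + v x ^ 2)) x := by
  obtain ⟨c, hc, h2⟩ := eta_d2 hδ (v x)
  have := lapl_chain (φ := fun t : ℝ => Real.sqrt (δ ^ 2 + t ^ 2))
    (Eventually.of_forall fun t => eta_d1 hδ t) h2 hv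
  rw [this]
  have : 0 ≤ grad2 v x := Finset.sum_nonneg fun _ _ => sq_nonneg _
  nlinarith [mul_nonneg hc this]

lemma seg_alg {d : ℕ} {A : Fin d → Fin d → ℝ} {g : Fin d → ℕ} (hA : CplOK A g) {p : ℝ}
    (hp : 0 < p) {s : Fin d → ℝ} {δ : ℝ} (hδ : 0 < δ)
    (hs : ∀ i j, g i ≠ g j → |s i| ≤ δ ∨ |s j| ≤ δ) :
    (2 * p + 2) * Wf A p s ≤ 4 * δ * ∑ i, s i / Real.sqrt (δ ^ 2 + s i ^ 2) * coup A p s i := by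
  set η : Fin d → ℝ := fun i => Real.sqrt (δ ^ 2 + s i ^ 2) with hη
  have hη0 : ∀ i, 0 < η i := fun i => by simp only [hη]; positivity
  set a : Fin d → Fin d → ℝ := fun i j => if i = j then 0 else A i j * (|s i| ^ (p + 1) * |s j| ^ (p + 1)) with ha
  have hasym : ∀ i j, a i j = a j i := fun i j => by
    simp only [ha]
    by_cases h : i = j
    · simp [h]
    · rw [if_neg h, if_neg (Ne.symm h), hA.symm i j]; ring
  have ha0 : ∀ i j, 0 ≤ a i j := fun i j => by
    simp only [ha]
    split_ifs with h
    · exact le_rfl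
    · have := hA.nonneg h; positivity
  have hT : ∀ i, s i * coup A p s i = ∑ j, a i j := fun i => by
    unfold coup
    rw [Finset.mul_sum, ← Finset.add_sum_erase _ _ (Finset.mem_univ i)]
    have e0 : a i i = 0 := by simp [ha]
    rw [e0, zero_add]
    refine Finset.sum_congr rfl fun j hj => ?_
    have hji : i ≠ j := (Finset.ne_of_mem_erase hj).symm
    simp only [ha, if_neg hji, ← mul_mul_abs hp (s i)]
    ring
  rw [← sum_mul_coup A hp s]
  have e1 : ∑ i, s i / η i * coup A p s i = ∑ i, ∑ j, a i j / η i := by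
    refine Finset.sum_congr rfl fun i _ => ?_
    rw [div_mul_eq_mul_div, hT, Finset.sum_div]
  have e2 : ∑ i, ∑ j, a i j / η i = ∑ i, ∑ j, a i j / η j := by
    rw [Finset.sum_comm]
    exact Finset.sum_congr rfl fun i _ => Finset.sum_congr rfl fun j _ => by rw [hasym]
  have hle : ∀ i, |s i| ≤ δ → η i ≤ 2 * δ := fun i hi => by
    simp only [hη]
    rw [Real.sqrt_le_left (by positivity)]
    have : s i ^ 2 ≤ δ ^ 2 := by rw [← sq_abs]; exact pow_le_pow_left₀ (abs_nonneg _) hi 2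
    nlinarith
  have key : ∀ i j, a i j ≤ 2 * δ * (a i j / η i + a i j / η j) := fun i j => by
    by_cases hg : g i = g j
    · have : a i j = 0 := by
        simp only [ha]; split_ifs with h
        · rfl
        · rw [hA.zero i j h hg]; ring
      rw [this]; simp
    · have q1 : 0 ≤ a i j / η i := div_nonneg (ha0 i j) (hη0 i).le
      have q2 : 0 ≤ a i j / η j := div_nonneg (ha0 i j) (hη0 j).le
      rcases hs i j hg with h | h
      · have : a i j = η i * (a i j / η i) := by field_simp [(hη0 i).ne']
        calc a i j = η i * (a i j / η i) := this
          _ ≤ 2 * δ * (a i j / η i) := by gcongr; exact hle i h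
          _ ≤ _ := by gcongr; linarith
      · have : a i j = η j * (a i j / η j) := by field_simp [(hη0 j).ne']
        calc a i j = η j * (a i j / η j) := this
          _ ≤ 2 * δ * (a i j / η j) := by gcongr; exact hle j h
          _ ≤ _ := by gcongr; linarith
  calc ∑ i, s i * coup A p s i = ∑ i, ∑ j, a i j := Finset.sum_congr rfl fun i _ => hT i
    _ ≤ ∑ i, ∑ j, 2 * δ * (a i j / η i + a i j / η j) :=
      Finset.sum_le_sum fun i _ => Finset.sum_le_sum fun j _ => key i j
    _ = 2 * δ * (∑ i, ∑ j, a i j / η i + ∑ i, ∑ j, a i j / η j) := by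
      simp only [← Finset.mul_sum, Finset.sum_add_distrib]
    _ = _ := by rw [← e2, ← e1]; ring

lemma seg_fin {N d : ℕ} {A : Fin d → Fin d → ℝ} {g : Fin d → ℕ} (hA : CplOK A g) {p : ℝ}
    (hp : 0 < p) {M ε : ℝ} (hM : 0 ≤ M) {v : Fin d → Eu N → ℝ} {τ R : ℝ} (hR : 0 ≤ R) (hτ0 : 0 < τ)
    (hτ : τ < R ^ 2) (h : ASOn A p M ε (ball 0 R) v) {B : ℝ} {δ : ℝ} (hδ : 0 < δ)
    (hB : ∀ i, ∀ x ∈ ball (0 : Eu N) R, |v i x| ≤ B)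
    (hs : ∀ x ∈ ball (0 : Eu N) R, ∀ i j, g i ≠ g j → |v i x| ≤ δ ∨ |v j x| ≤ δ) :
    (2 * p + 2) * mo τ 4 (fun x => M * Wf A p fun j => v j x)
      ≤ 4 * δ * (d * (48 * τ * ((B + δ) * mo (N := N) τ 2 (fun _ => 1))) + d * ε * mo (N := N) τ 4 (fun _ => 1)) := by
  set F : Fin d → Eu N → ℝ := fun i x => Real.sqrt (δ ^ 2 + v i x ^ 2) with hF
  have cF : ∀ i, ContDiffOn ℝ 2 (F i) (ball 0 R) := fun i => eta_cd hδ (h i).1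
  have h1 : mo τ 4 (fun x => (2 * p + 2) * (M * Wf A p fun j => v j x)) ≤
      mo τ 4 (fun x => 4 * δ * (∑ i, lapl (F i) x + d * ε * 1)) := by
    refine mo_mono hR hτ 3 ?_ ?_ fun x hx => ?_
    · exact (((cd_Wf A hp fun i => (h i).1).continuousOn.const_mul M).const_mul _)
    · exact ((continuousOn_finset_sum _ fun i _ => cont_lapl (cF i)).add continuousOn_const).const_mul _
    · have a1 := seg_alg hA hp hδ (hs x hx)
      have a2 : ∀ i, v i x / Real.sqrt (δ ^ 2 + v i x ^ 2) * (M * coup A p (fun j => v j x) i)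
          ≤ lapl (F i) x + ε := fun i => by
        have b1 := eta_lapl hδ (cd_at isOpen_ball (h i).1 hx)
        have b2 := (h i).2 x hx
        have b3 : |v i x / Real.sqrt (δ ^ 2 + v i x ^ 2)| ≤ 1 := by
          rw [abs_div, abs_of_nonneg (Real.sqrt_nonneg _)]
          refine div_le_one_of_le₀ ?_ (Real.sqrt_nonneg _)
          exact Real.abs_le_sqrt (by nlinarith [sq_nonneg δ])
        have b4 : |v i x / Real.sqrt (δ ^ 2 + v i x ^ 2) * (lapl (v i) x - M * coup A p (fun j => v j x) i)| ≤ ε := by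
          rw [abs_mul]
          calc _ ≤ 1 * ε := by gcongr
            _ = ε := one_mul _
        have b5 := (abs_le.1 b4).1
        simp only [hF]
        linarith
      calc (2 * p + 2) * (M * Wf A p fun j => v j x) = M * ((2 * p + 2) * Wf A p fun j => v j x) := by ring
        _ ≤ M * (4 * δ * ∑ i, v i x / Real.sqrt (δ ^ 2 + v i x ^ 2) * coup A p (fun j => v j x) i) := by gcongr
        _ = 4 * δ * ∑ i, v i x / Real.sqrt (δ ^ 2 + v i x ^ 2) * (M * coup A p (fun j => v j x) i) := by
          rw [Finset.mul_sum, Finset.mul_sum, Finset.mul_sum]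
          exact Finset.sum_congr rfl fun i _ => by ring
        _ ≤ 4 * δ * ∑ i, (lapl (F i) x + ε) := by gcongr with i; exact a2 i
        _ = _ := by rw [Finset.sum_add_distrib]; simp
  rw [mo_cmul τ 4 (2 * p + 2), mo_cmul τ 4 (4 * δ)] at h1
  rw [mo_add hR hτ 3 (continuousOn_finset_sum _ fun i _ => cont_lapl (cF i)) continuousOn_const,
    mo_cmul τ 4 (d * ε), mo_sum _ hR hτ 3 fun i => cont_lapl (cF i)] at h1
  refine h1.trans ?_
  have h2 : ∀ i, mo τ 4 (lapl (F i)) ≤ 48 * τ * ((B + δ) * mo (N := N) τ 2 (fun _ => 1)) := fun i => by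
    have e := G3 hR hτ 1 (cF i)
    have b1 : 0 ≤ mo τ 3 (F i) := mo_nonneg' (fun x => Real.sqrt_nonneg _) τ 2
    have b2 : mo τ 2 (F i) ≤ (B + δ) * mo (N := N) τ 2 (fun _ => 1) := by
      rw [← mo_cmul]
      refine mo_mono hR hτ 1 (cF i).continuousOn continuousOn_const fun x hx => ?_
      have := hB i x hx
      simp only [hF]
      rw [Real.sqrt_le_left (by have := abs_nonneg (v i x); linarith)]
      nlinarith [sq_abs (v i x), abs_nonneg (v i x)]
    norm_num at e
    rw [e]
    have hN : (0:ℝ) ≤ N := Nat.cast_nonneg N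
    nlinarith [mul_nonneg hN b1, mul_le_mul_of_nonneg_left b2 hτ0.le]
  gcongr
  calc ∑ i, mo τ 4 (lapl (F i)) ≤ ∑ i : Fin d, 48 * τ * ((B + δ) * mo (N := N) τ 2 (fun _ => 1)) :=
        Finset.sum_le_sum fun i _ => h2 i
    _ = _ := by simp

lemma wt_le_wt {N : ℕ} {τ : ℝ} (hτ : 0 < τ) (k : ℕ) (x : Eu N) :
    wt τ (k + 1) x ≤ τ ^ (k + 1) * wt (τ + 1) 4 x := by
  by_cases hx : τ ≤ ‖x‖ ^ 2
  · rw [wt_zero hx]; have := wt_nonneg (τ + 1) 4 x; positivity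
  push Not at hx
  have h1 := wt_le hτ.le (k + 1) x
  have h2 : 1 ≤ wt (τ + 1) 4 x := by
    unfold wt
    exact one_le_pow₀ (le_max_of_le_left (by linarith))
  calc _ ≤ τ ^ (k + 1) * 1 := by linarith
    _ ≤ _ := by gcongr

lemma seg_tendsto {N d : ℕ} {A : Fin d → Fin d → ℝ} {g : Fin d → ℕ} (hA : CplOK A g) {p : ℝ}
    (hp : 0 < p) {l : Filter ℕ} {v : ℕ → Fin d → Eu N → ℝ} {V : Fin d → Eu N → ℝ} {M ε : ℕ → ℝ}
    (hM : ∀ n, 0 ≤ M n) (hε : Tendsto ε l (𝓝 0))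
    (has : ∀ R : ℝ, ∀ᶠ n in l, ASOn A p (M n) (ε n) (ball 0 R) (v n))
    (hconv : ∀ R δ : ℝ, 0 < δ → ∀ᶠ n in l, ∀ i, ∀ x ∈ ball 0 R, |v n i x - V i x| ≤ δ)
    (hVc : ∀ i, Continuous (V i)) (hseg : ∀ i j, g i ≠ g j → ∀ x, V i x = 0 ∨ V j x = 0)
    {τ : ℝ} (hτ0 : 0 < τ) (k : ℕ) :
    Tendsto (fun n => mo τ (k + 1) (fun x => M n * Wf A p fun j => v n j x)) l (𝓝 0) := by
  obtain ⟨R, hR, hτ⟩ := exists_R (τ + 1)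
  obtain ⟨B, hB0, hB⟩ := exists_bd hVc R
  set c2 := mo (N := N) (τ + 1) 2 (fun _ => 1) with hc2
  set c4 := mo (N := N) (τ + 1) 4 (fun _ => 1) with hc4
  have hc2' : 0 ≤ c2 := mo_nonneg' (fun _ => zero_le_one) _ _
  have hc4' : 0 ≤ c4 := mo_nonneg' (fun _ => zero_le_one) _ _
  set K := τ ^ (k + 1) * (4 * (d * (48 * (τ + 1) * ((B + 1 + 1) * c2)) + d * 1 * c4)) with hK
  have hK0 : 0 ≤ K := by positivity
  rw [Metric.tendsto_nhds]
  intro e he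
  obtain ⟨δ, hδ0, hδ1, hδe⟩ : ∃ δ : ℝ, 0 < δ ∧ δ ≤ 1 ∧ K * δ < e := by
    refine ⟨min 1 (e / (2 * (K + 1))), by positivity, min_le_left _ _, ?_⟩
    have h1 : min 1 (e / (2 * (K + 1))) ≤ e / (2 * (K + 1)) := min_le_right _ _
    calc K * min 1 (e / (2 * (K + 1))) ≤ K * (e / (2 * (K + 1))) := by gcongr
      _ < e := by rw [mul_div_assoc', div_lt_iff₀ (by positivity)]; nlinarith
  have hε1 : ∀ᶠ n in l, ε n < 1 := hε.eventually (gt_mem_nhds one_pos)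
  filter_upwards [has R, hconv R δ hδ0, hε1] with n h1 h2 h3
  have h4 := seg_fin hA hp (hM n) hR (by linarith : 0 < τ + 1) hτ h1 hδ0 (B := B + 1) (fun i x hx => by
      have a1 := h2 i x hx
      have a2 := hB i x (ball_subset_closedBall hx)
      have a3 := abs_sub_abs_le_abs_sub (v n i x) (V i x)
      linarith) (fun x hx i j hij => by
      rcases hseg i j hij x with h | h
      · left; have := h2 i x hx; rwa [h, sub_zero] at this
      · right; have := h2 j x hx; rwa [h, sub_zero] at this)
  have hW0 : ∀ x, 0 ≤ M n * Wf A p fun j => v n j x := fun x => mul_nonneg (hM n) (Wf_nonneg hA hp _)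
  have hcW : ContinuousOn (fun x => M n * Wf A p fun j => v n j x) (ball 0 R) :=
    (cd_Wf A hp fun i => (h1 i).1).continuousOn.const_mul _
  have h5 : mo τ (k + 1) (fun x => M n * Wf A p fun j => v n j x)
      ≤ τ ^ (k + 1) * mo (τ + 1) 4 (fun x => M n * Wf A p fun j => v n j x) := by
    unfold mo
    rw [← integral_const_mul]
    refine integral_mono (wt_mul_int hR (by linarith) k hcW) ((wt_mul_int hR hτ 3 hcW).const_mul _) fun x => ?_
    have := wt_le_wt hτ0 k x
    calc _ ≤ (τ ^ (k + 1) * wt (τ + 1) 4 x) * (M n * Wf A p fun j => v n j x) :=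
          mul_le_mul_of_nonneg_right this (hW0 x)
      _ = _ := by ring
  have h6 : 0 ≤ mo τ (k + 1) (fun x => M n * Wf A p fun j => v n j x) := mo_nonneg' hW0 τ k
  have h7 : 0 ≤ mo (τ + 1) 4 (fun x => M n * Wf A p fun j => v n j x) := mo_nonneg' hW0 (τ + 1) 3
  rw [Real.dist_eq, sub_zero, abs_of_nonneg h6]
  have h8 : mo (τ + 1) 4 (fun x => M n * Wf A p fun j => v n j x) ≤
      4 * δ * (d * (48 * (τ + 1) * ((B + 1 + 1) * c2)) + d * 1 * c4) := by
    calc _ ≤ (2 * p + 2) * mo (τ + 1) 4 (fun x => M n * Wf A p fun j => v n j x) := by nlinarith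
      _ ≤ _ := h4
      _ ≤ _ := by gcongr
  calc _ ≤ _ := h5
    _ ≤ τ ^ (k + 1) * (4 * δ * (d * (48 * (τ + 1) * ((B + 1 + 1) * c2)) + d * 1 * c4)) := by gcongr
    _ = K * δ := by rw [hK]; ring
    _ < e := hδe

end

section

/-- the constant of Lemma AB -/
def KA {d : ℕ} (A : Fin d → Fin d → ℝ) : ℝ := (∑ a, ∑ b, |A a b|) * ∑ a, ∑ b, |A a b|⁻¹

lemma KA_nonneg {d : ℕ} (A : Fin d → Fin d → ℝ) : 0 ≤ KA A := by
  unfold KA; positivity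

lemma lemmaAB {N d : ℕ} {A : Fin d → Fin d → ℝ} {g : Fin d → ℕ} (hA : CplOK A g) {p : ℝ}
    (hp : 0 < p) {M ε : ℝ} (hM : 0 ≤ M) (hε : 0 ≤ ε) {x : Eu N} {r : ℝ} (hr : 0 < r)
    {v : Fin d → Eu N → ℝ} (h : ASOn A p M ε (ball x r) v) {j : Fin d}
    {s ω B : ℝ} (hs : 0 < s) (hω : 0 < ω) (hB : 0 < B) (hj : ∀ y ∈ ball x r, s ≤ |v j y|)
    (hi : ∀ i, g i ≠ g j → ∀ y ∈ ball x r, |v i y - v i x| ≤ ω)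
    (hb : ∀ l, |v l x| ≤ B * s) (k : Fin d) :
    |lapl (v k) x| ≤ ε + KA A * B ^ (p + 1) * (ε + 16 * N * ω / r ^ 2) := by
  set q := ε + 16 * N * ω / r ^ 2 with hq
  have hq0 : 0 ≤ q := by positivity
  set c := ∑ a, ∑ b, |A a b|⁻¹ with hc
  have hc0 : 0 ≤ c := by positivity
  have h1 := lemmaB hA hp hM (s := fun l => v l x) hs hB hb (j := j) (δ := c * q) (fun i hij => by
    have a1 := lemmaA hA hp hM hr h hij hs hω hj (hi i hij)
    have hpos := hA.pos i j hij
    have a2 : (A i j)⁻¹ ≤ c := by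
      calc (A i j)⁻¹ = |A i j|⁻¹ := by rw [abs_of_pos hpos]
        _ ≤ ∑ b, |A i b|⁻¹ := Finset.single_le_sum (f := fun b => |A i b|⁻¹)
            (fun b _ => inv_nonneg.2 (abs_nonneg _)) (Finset.mem_univ j)
        _ ≤ c := Finset.single_le_sum (f := fun a => ∑ b, |A a b|⁻¹)
            (fun a _ => Finset.sum_nonneg fun b _ => inv_nonneg.2 (abs_nonneg _)) (Finset.mem_univ i)
    calc M * s ^ (p + 1) * |v i x| ^ p = (A i j)⁻¹ * (M * A i j * s ^ (p + 1) * |v i x| ^ p) := by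
          field_simp
      _ ≤ (A i j)⁻¹ * q := by gcongr
      _ ≤ c * q := by gcongr) (by positivity) k
  have h2 := (h k).2 x (mem_ball_self hr)
  have h3 := abs_add_le (lapl (v k) x - M * coup A p (fun j => v j x) k) (M * coup A p (fun j => v j x) k)
  rw [sub_add_cancel] at h3
  have e : KA A * B ^ (p + 1) * q = (∑ a, ∑ b, |A a b|) * B ^ (p + 1) * (c * q) := by
    unfold KA; ring
  rw [e]
  linarith

/-- limits of solutions with exploding coupling -/
def InfL {N d : ℕ} (A : Fin d → Fin d → ℝ) (p : ℝ) (V : Fin d → Eu N → ℝ) : Prop :=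
  ∀ R ε K : ℝ, 0 < ε → ∃ M : ℝ, K ≤ M ∧ 0 ≤ M ∧ ∃ v : Fin d → Eu N → ℝ,
    ASOn A p M ε (ball 0 R) v ∧ ∀ i, ∀ x ∈ ball (0 : Eu N) R, |v i x - V i x| ≤ ε

section
variable {N d : ℕ} {A : Fin d → Fin d → ℝ} {g : Fin d → ℕ} {p : ℝ}
  {V : Fin d → Eu N → ℝ}

lemma InfL.rescale (h : InfL A p V) (x0 : Eu N) {r l : ℝ} (hr : 0 < r) (hl : 0 < l) :
    InfL A p (fun i x => V i (x0 + r • x) / l) := by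
  intro R ε K hε
  have hc : 0 < r ^ 2 * l ^ (2 * p) := by positivity
  obtain ⟨M, hK, hM, v, h1, h2⟩ := h (‖x0‖ + r * R) (min (ε * l) (ε * l / r ^ 2))
    (K / (r ^ 2 * l ^ (2 * p))) (by positivity)
  have hin : ∀ x ∈ ball (0 : Eu N) R, x0 + r • x ∈ ball (0 : Eu N) (‖x0‖ + r * R) := by
    intro x hx
    rw [mem_ball_zero_iff] at hx ⊢
    calc _ ≤ ‖x0‖ + ‖r • x‖ := norm_add_le _ _
      _ < _ := by rw [norm_smul, Real.norm_eq_abs, abs_of_pos hr]; gcongr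
  refine ⟨M * r ^ 2 * l ^ (2 * p), ?_, by positivity, fun i x => v i (x0 + r • x) / l, ?_, ?_⟩
  · rw [div_le_iff₀ hc] at hK; linarith
  · refine (h1.rescale isOpen_ball x0 r hl hin).mono ?_ subset_rfl
    have : min (ε * l) (ε * l / r ^ 2) ≤ ε * l / r ^ 2 := min_le_right _ _
    rw [div_le_iff₀ hl]
    calc _ ≤ (ε * l / r ^ 2) * r ^ 2 := by gcongr
      _ = ε * l := by field_simp
  · intro i x hx
    have := h2 i _ (hin x hx)
    rw [← sub_div, abs_div, abs_of_pos hl, div_le_iff₀ hl]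
    exact this.trans (min_le_left _ _)

lemma InfL.seq (h : InfL A p V) : ∃ (v : ℕ → Fin d → Eu N → ℝ) (M ε : ℕ → ℝ),
    (∀ n, 0 ≤ M n) ∧ (∀ n, 0 ≤ ε n) ∧ Tendsto M atTop atTop ∧ Tendsto ε atTop (𝓝 0) ∧
    (∀ R : ℝ, ∀ᶠ n in atTop, ASOn A p (M n) (ε n) (ball 0 R) (v n)) ∧
    (∀ R δ : ℝ, 0 < δ → ∀ᶠ n in atTop, ∀ i, ∀ x ∈ ball 0 R, |v n i x - V i x| ≤ δ) := by
  have h1 : ∀ n : ℕ, _ := fun n => h n (1 / ((n:ℝ) + 1)) n (by positivity)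
  choose M hK hM v h2 h3 using h1
  have hε : Tendsto (fun n : ℕ => 1 / ((n:ℝ) + 1)) atTop (𝓝 0) := tendsto_one_div_add_atTop_nhds_zero_nat
  refine ⟨v, M, fun n => 1 / ((n:ℝ) + 1), hM, fun n => by positivity,
    tendsto_atTop_mono hK tendsto_natCast_atTop_atTop, hε, fun R => ?_, fun R δ hδ => ?_⟩
  · filter_upwards [tendsto_natCast_atTop_atTop.eventually_ge_atTop R] with n hn
    exact (h2 n).mono le_rfl (ball_subset_ball hn)
  · filter_upwards [tendsto_natCast_atTop_atTop.eventually_ge_atTop R, hε.eventually (gt_mem_nhds hδ)] with n hn he i x hx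
    exact (h3 n i x (ball_subset_ball hn hx)).trans he.le

lemma InfL.lim {l : Filter ℕ} [l.NeBot] {W : ℕ → Fin d → Eu N → ℝ} (h : ∀ n, InfL A p (W n))
    (hc : ∀ R δ : ℝ, 0 < δ → ∀ᶠ n in l, ∀ i, ∀ x ∈ ball 0 R, |W n i x - V i x| ≤ δ) : InfL A p V := by
  intro R ε K hε
  obtain ⟨n, hn⟩ := (hc R (ε / 2) (by positivity)).exists
  obtain ⟨M, hK, hM, v, h1, h2⟩ := h n R (ε / 2) K (by positivity)
  refine ⟨M, hK, hM, v, h1.mono (by linarith) subset_rfl, fun i x hx => ?_⟩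
  have := abs_sub_le (v i x) (W n i x) (V i x)
  linarith [h2 i x hx, hn i x hx]

lemma InfL.seg (hA : CplOK A g) (hp : 0 < p) (h : InfL A p V) (hVc : ∀ i, Continuous (V i)) :
    ∀ i j, g i ≠ g j → ∀ x, V i x = 0 ∨ V j x = 0 := by
  intro i j hij x0
  by_contra hcon
  push Not at hcon
  obtain ⟨hi, hj⟩ := hcon
  obtain ⟨v, M, ε, hM, hε0, hMt, hε, has, hcv⟩ := h.seq
  have ci : 0 < |V i x0| := abs_pos.2 hi
  have cj : 0 < |V j x0| := abs_pos.2 hj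
  obtain ⟨r1, hr1, h1⟩ := Metric.continuousAt_iff.1 (hVc i).continuousAt 1 one_pos
  obtain ⟨r2, hr2, h2⟩ := Metric.continuousAt_iff.1 (hVc j).continuousAt (|V j x0| / 4) (by positivity)
  set r := min r1 r2 with hr
  have hr0 : 0 < r := by positivity
  set s := |V j x0| / 2 with hs
  have hsub : ball x0 r ⊆ ball 0 (‖x0‖ + r) := fun y hy => by
    rw [mem_ball, dist_eq_norm] at hy
    rw [mem_ball_zero_iff]
    calc ‖y‖ = ‖x0 + (y - x0)‖ := by congr 1; abel
      _ ≤ ‖x0‖ + ‖y - x0‖ := norm_add_le _ _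
      _ < _ := by linarith
  have hbig : Tendsto (fun n => M n * (A i j * s ^ (p + 1) * (|V i x0| / 2) ^ p)) atTop atTop :=
    hMt.atTop_mul_const (by have := hA.pos i j hij; positivity)
  set δ := min (min (1/2) (|V j x0| / 4)) (|V i x0| / 2) with hδ
  have hδ0 : 0 < δ := by positivity
  obtain ⟨n, n1, n2, n3, n4⟩ := ((has (‖x0‖ + r)).and ((hcv (‖x0‖ + r) δ hδ0).and
    ((hbig.eventually_gt_atTop (1 + 16 * N * 2 / r ^ 2)).and (hε.eventually (gt_mem_nhds one_pos))))).exists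
  have n2' : ∀ i, ∀ y ∈ ball x0 r, |v n i y - V i y| ≤ δ := fun i y hy => n2 i y (hsub hy)
  have d1 : δ ≤ 1/2 := (min_le_left _ _).trans (min_le_left _ _)
  have d2 : δ ≤ |V j x0| / 4 := (min_le_left _ _).trans (min_le_right _ _)
  have d3 : δ ≤ |V i x0| / 2 := min_le_right _ _
  have := lemmaA hA hp (hM n) hr0 (n1.mono le_rfl hsub) hij (s := s) (ω := 2) (by positivity) two_pos
    (fun y hy => by
      have a1 := h2 (lt_of_lt_of_le (mem_ball.1 hy) (min_le_right _ _))
      rw [Real.dist_eq] at a1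
      have a2 := n2' j y hy
      have a3 := abs_sub_abs_le_abs_sub (V j x0) (v n j y)
      have a4 := abs_sub_le (V j x0) (V j y) (v n j y)
      rw [abs_sub_comm (V j x0) (V j y), abs_sub_comm (V j y) (v n j y)] at a4
      rw [hs]
      linarith)
    (fun y hy => by
      have a1 := h1 (lt_of_lt_of_le (mem_ball.1 hy) (min_le_left _ _))
      rw [Real.dist_eq] at a1
      have a2 := n2' i y hy
      have a3 := n2' i x0 (mem_ball_self hr0)
      rw [abs_le] at *
      rw [abs_lt] at a1
      constructor <;> linarith)
  have hge : |V i x0| / 2 ≤ |v n i x0| := by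
    have a3 := n2' i x0 (mem_ball_self hr0)
    have a4 := abs_sub_abs_le_abs_sub (V i x0) (v n i x0)
    rw [abs_sub_comm] at a4
    linarith
  have hle : M n * (A i j * s ^ (p + 1) * (|V i x0| / 2) ^ p) ≤ M n * A i j * s ^ (p + 1) * |v n i x0| ^ p := by
    have := hA.pos i j hij
    have := hM n
    calc _ = M n * A i j * s ^ (p + 1) * (|V i x0| / 2) ^ p := by ring
      _ ≤ _ := by gcongr
  linarith

lemma InfL.harm (hA : CplOK A g) (hp : 0 < p) (h : InfL A p V) (hVc : ∀ i, Continuous (V i))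
    {x0 : Eu N} {k : Fin d} (hk : V k x0 ≠ 0) (i : Fin d) : LocHarm (V i) x0 := by
  have hseg := h.seg hA hp hVc
  obtain ⟨v, M, ε, hM, hε0, hMt, hε, has, hcv⟩ := h.seq
  have ck : 0 < |V k x0| := abs_pos.2 hk
  obtain ⟨r2, hr2, h2⟩ := Metric.continuousAt_iff.1 (hVc k).continuousAt (|V k x0| / 4) (by positivity)
  set r := r2 / 2 with hr
  have hr0 : 0 < r := by positivity
  set s := |V k x0| / 2 with hs
  have hs0 : 0 < s := by positivity
  have hge : ∀ y ∈ ball x0 r2, |V k x0| * (3/4) ≤ |V k y| := fun y hy => by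
    have a1 := h2 (mem_ball.1 hy)
    rw [Real.dist_eq, abs_sub_comm] at a1
    have := abs_sub_abs_le_abs_sub (V k x0) (V k y)
    linarith
  have hsub : ball x0 r2 ⊆ ball 0 (‖x0‖ + r2) := fun y hy => by
    rw [mem_ball, dist_eq_norm] at hy
    rw [mem_ball_zero_iff]
    calc ‖y‖ = ‖x0 + (y - x0)‖ := by congr 1; abel
      _ ≤ ‖x0‖ + ‖y - x0‖ := norm_add_le _ _
      _ < _ := by linarith
  obtain ⟨B, hB0, hB⟩ := exists_bd hVc (‖x0‖ + r2)
  set B' := (B + 1) / s with hB'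
  have hB'0 : 0 < B' := by positivity
  refine ⟨r, hr0, fun e he => ?_⟩
  -- smallness of the final bound
  have hK0 := KA_nonneg A
  have hT : Tendsto (fun q : ℝ => q + KA A * B' ^ (p + 1) * (q + 16 * N * (2 * q) / r ^ 2)) (𝓝 0) (𝓝 0) := by
    have : Continuous (fun q : ℝ => q + KA A * B' ^ (p + 1) * (q + 16 * N * (2 * q) / r ^ 2)) := by fun_prop
    simpa using this.tendsto 0
  obtain ⟨q0, hq0, hq⟩ := Metric.tendsto_nhds_nhds.1 hT e he
  set q := min (q0 / 2) (min (min 1 e) (|V k x0| / 4)) with hqd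
  have hqp : 0 < q := by positivity
  have q1 : q ≤ q0 / 2 := min_le_left _ _
  have q2 : q ≤ 1 := (min_le_right _ _).trans ((min_le_left _ _).trans (min_le_left _ _))
  have q3 : q ≤ e := (min_le_right _ _).trans ((min_le_left _ _).trans (min_le_right _ _))
  have q4 : q ≤ |V k x0| / 4 := (min_le_right _ _).trans (min_le_right _ _)
  have hqe := hq (x := q) (by rw [Real.dist_eq, sub_zero, abs_of_pos hqp]; linarith)
  rw [Real.dist_eq, sub_zero] at hqe
  have hqe' := (le_abs_self _).trans hqe.le
  obtain ⟨n, n1, n2, n3⟩ := ((has (‖x0‖ + r2)).and ((hcv (‖x0‖ + r2) q hqp).and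
    (hε.eventually (gt_mem_nhds hqp)))).exists
  have hrr : ball x0 r ⊆ ball x0 r2 := ball_subset_ball (by linarith)
  refine ⟨v n i, (n1 i).1.mono (hrr.trans hsub), fun x hx => ⟨(n2 i x (hsub (hrr hx))).trans q3, ?_⟩⟩
  have hxb : ball x r ⊆ ball x0 r2 := fun y hy => by
    have := dist_triangle y x x0
    rw [mem_ball] at *
    linarith
  refine (lemmaAB hA hp (hM n) hqp.le hr0 (n1.mono n3.le (hxb.trans hsub)) (j := k) (s := s) (ω := 2 * q) (B := B')
    hs0 (by positivity) hB'0 (fun y hy => ?_) (fun i' hi' y hy => ?_) (fun l => ?_) i).trans hqe'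
  · have a1 := hge y (hxb hy)
    have a2 := n2 k y (hsub (hxb hy))
    have a3 := abs_sub_abs_le_abs_sub (V k y) (v n k y)
    rw [abs_sub_comm] at a3
    rw [hs]; linarith
  · have z : ∀ y ∈ ball x0 r2, V i' y = 0 := fun y hy => by
      rcases hseg i' k hi' y with h | h
      · exact h
      · have := hge y hy; rw [h, abs_zero] at this; linarith
    have a1 := n2 i' y (hsub (hxb hy))
    have a2 := n2 i' x (hsub (hrr hx))
    rw [z y (hxb hy), sub_zero] at a1
    rw [z x (hrr hx), sub_zero] at a2
    have := abs_sub (v n i' y) (v n i' x)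
    linarith
  · have a1 := n2 l x (hsub (hrr hx))
    have a2 := hB l x (ball_subset_closedBall (hsub (hrr hx)))
    have a3 := abs_sub_abs_le_abs_sub (v n l x) (V l x)
    rw [hB', div_mul_cancel₀ _ hs0.ne']
    linarith

lemma InfL.apx (hA : CplOK A g) (hp : 0 < p) (h : InfL A p V) (hVc : ∀ i, Continuous (V i)) :
    ∃ (v : ℕ → Fin d → Eu N → ℝ) (M ε : ℕ → ℝ), Apx A p V (fun _ => 0) v M ε := by
  have hseg := h.seg hA hp hVc
  obtain ⟨v, M, ε, hM, hε0, hMt, hε, has, hcv⟩ := h.seq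
  refine ⟨v, M, ε, hM, hε, has, hcv, fun τ hτ k => ?_, hVc, continuous_const, fun _ => le_rfl⟩
  have := seg_tendsto hA hp hM hε has hcv hVc hseg hτ k
  have e : mo (N := N) τ (k + 1) (fun _ => 0) = 0 := by simp [mo]
  rwa [e]

end

end

section

lemma ultra_lim {N d : ℕ} (l : Ultrafilter ℕ) {v : ℕ → Fin d → Eu N → ℝ} {ω : ℝ → ℝ} {ε : ℕ → ℝ}
    (hω : ∀ δ : ℝ, 0 < δ → ∃ η : ℝ, 0 < η ∧ ∀ t, 0 ≤ t → t < η → ω t ≤ δ)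
    (hε : Tendsto ε l (𝓝 0))
    (hosc : ∀ R : ℝ, ∀ᶠ n in (l : Filter ℕ), ∀ i, ∀ x ∈ ball (0 : Eu N) R, ∀ y ∈ ball (0 : Eu N) R,
      |v n i x - v n i y| ≤ ω (dist x y) + ε n)
    {B : ℝ} (hB : ∀ᶠ n in (l : Filter ℕ), ∀ i, |v n i 0| ≤ B) :
    ∃ V : Fin d → Eu N → ℝ, (∀ i x, Tendsto (fun n => v n i x) l (𝓝 (V i x))) ∧
      (∀ R δ : ℝ, 0 < δ → ∀ᶠ n in (l : Filter ℕ), ∀ i, ∀ x ∈ ball (0 : Eu N) R, |v n i x - V i x| ≤ δ) ∧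
      ∀ i x y, |V i x - V i y| ≤ ω (dist x y) := by
  have hε1 : ∀ᶠ n in (l : Filter ℕ), ε n < 1 := hε.eventually (gt_mem_nhds one_pos)
  have hpt : ∀ i x, ∃ c, Tendsto (fun n => v n i x) l (𝓝 c) := by
    intro i x
    have hx : x ∈ ball (0 : Eu N) (‖x‖ + 1) := by rw [mem_ball_zero_iff]; linarith
    have h0 : (0 : Eu N) ∈ ball (0 : Eu N) (‖x‖ + 1) := mem_ball_self (by positivity)
    set c := B + ω (dist x 0) + 1 with hc
    have h1 : ∀ᶠ n in (l : Filter ℕ), v n i x ∈ Icc (-c) c := by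
      filter_upwards [hε1, hB, hosc (‖x‖ + 1)] with n a1 a2 a3
      have b1 := a3 i x hx 0 h0
      have b2 := a2 i
      rw [abs_le] at b1 b2
      rw [mem_Icc]
      constructor <;> linarith [b1.1, b1.2, b2.1, b2.2]
    have h2 : ((l.map fun n => v n i x : Ultrafilter ℝ) : Filter ℝ) ≤ 𝓟 (Icc (-c) c) := by
      rw [le_principal_iff, Ultrafilter.mem_coe, Ultrafilter.mem_map]
      exact h1
    obtain ⟨a, _, ha⟩ := isCompact_Icc.ultrafilter_le_nhds _ h2
    exact ⟨a, ha⟩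
  choose V hV using hpt
  have hVω : ∀ i x y, |V i x - V i y| ≤ ω (dist x y) := by
    intro i x y
    have t1 : Tendsto (fun n => |v n i x - v n i y|) l (𝓝 |V i x - V i y|) := ((hV i x).sub (hV i y)).abs
    have t2 : Tendsto (fun n => ω (dist x y) + ε n) l (𝓝 (ω (dist x y))) := by
      simpa using hε.const_add (ω (dist x y))
    refine le_of_tendsto_of_tendsto t1 t2 ?_
    filter_upwards [hosc (‖x‖ + ‖y‖ + 1)] with n hn
    refine hn i x ?_ y ?_ <;> rw [mem_ball_zero_iff] <;> linarith [norm_nonneg x, norm_nonneg y]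
  refine ⟨V, hV, fun R δ hδ => ?_, hVω⟩
  obtain ⟨η, hη, hηω⟩ := hω (δ / 4) (by positivity)
  obtain ⟨t, hts, htf, htc⟩ := (isCompact_closedBall (0 : Eu N) R).finite_cover_balls hη
  have hfin : ∀ᶠ n in (l : Filter ℕ), ∀ y ∈ t, ∀ i, |v n i y - V i y| ≤ δ / 4 := by
    rw [htf.eventually_all]
    intro y hy
    rw [eventually_all]
    intro i
    have := (Metric.tendsto_nhds.1 (hV i y)) (δ / 4) (by positivity)
    filter_upwards [this] with n hn
    rw [Real.dist_eq] at hn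
    exact hn.le
  filter_upwards [hfin, hosc (R + 1), hε.eventually (gt_mem_nhds (show (0:ℝ) < δ / 4 by positivity))]
    with n a1 a2 a3 i x hx
  obtain ⟨y, hy, hxy⟩ := mem_iUnion₂.1 (htc (ball_subset_closedBall hx))
  have hyR : y ∈ ball (0 : Eu N) (R + 1) := by
    have := mem_closedBall_zero_iff.1 (hts hy)
    rw [mem_ball_zero_iff]; linarith
  have b1 := a2 i x (ball_subset_ball (by linarith) hx) y hyR
  have b2 := a1 y hy i
  have b3 := hVω i x y
  have b4 := hηω _ dist_nonneg (mem_ball.1 hxy)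
  rw [abs_le] at *
  constructor <;> linarith [b1.1, b1.2, b2.1, b2.2, b3.1, b3.2]

lemma pow_mod {C ρ : ℝ} (hρ : 0 < ρ) :
    ∀ δ : ℝ, 0 < δ → ∃ η : ℝ, 0 < η ∧ ∀ t : ℝ, 0 ≤ t → t < η → C * t ^ ρ ≤ δ := by
  intro δ hδ
  have hc : ContinuousAt (fun t : ℝ => C * t ^ ρ) 0 :=
    continuousAt_const.mul (Real.continuousAt_rpow_const _ _ (Or.inr hρ.le))
  obtain ⟨η, hη, h⟩ := Metric.continuousAt_iff.1 hc δ hδ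
  refine ⟨η, hη, fun t h0 ht => ?_⟩
  have := h (x := t) (by rw [Real.dist_eq, sub_zero, abs_of_nonneg h0]; exact ht)
  rw [Real.zero_rpow hρ.ne', mul_zero, Real.dist_eq, sub_zero] at this
  exact (le_abs_self _).trans this.le

lemma mod_cont {N : ℕ} {V : Eu N → ℝ} {ω : ℝ → ℝ}
    (hω : ∀ δ : ℝ, 0 < δ → ∃ η : ℝ, 0 < η ∧ ∀ t, 0 ≤ t → t < η → ω t ≤ δ)
    (h : ∀ x y, |V x - V y| ≤ ω (dist x y)) : Continuous V := by
  rw [Metric.continuous_iff]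
  intro b e he
  obtain ⟨η, hη, h1⟩ := hω (e / 2) (by positivity)
  refine ⟨η, hη, fun a ha => ?_⟩
  have h2 := h1 _ dist_nonneg ha
  have h3 := h a b
  rw [Real.dist_eq]; linarith

lemma mo_scale {N : ℕ} {r : ℝ} (hr : 0 < r) (τ : ℝ) (k : ℕ) (h : Eu N → ℝ) :
    mo τ k (fun x => h (r • x)) = (r ^ (2 * k + N))⁻¹ * mo (r ^ 2 * τ) k h := by
  have hw : ∀ x : Eu N, wt τ k x = (r ^ (2 * k))⁻¹ * wt (r ^ 2 * τ) k (r • x) := fun x => by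
    unfold wt
    have : max (r ^ 2 * τ - ‖r • x‖ ^ 2) 0 = r ^ 2 * max (τ - ‖x‖ ^ 2) 0 := by
      rw [norm_smul, Real.norm_eq_abs, abs_of_pos hr, mul_max_of_nonneg _ _ (by positivity)]
      congr 1 <;> ring
    rw [this, mul_pow, ← pow_mul]
    field_simp
  unfold mo
  have e : ∀ x : Eu N, wt τ k x * h (r • x)
      = (r ^ (2 * k))⁻¹ * (fun y => wt (r ^ 2 * τ) k y * h y) (r • x) := fun x => by
    rw [hw]; ring
  simp_rw [e]
  rw [integral_const_mul]
  have hq := Measure.integral_comp_smul volume (fun y : Eu N => wt (r ^ 2 * τ) k y * h y) r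
  rw [hq]
  simp only [finrank_euclideanSpace, Fintype.card_fin, smul_eq_mul]
  rw [abs_of_pos (by positivity), pow_add, mul_inv]; ring

section
variable {N d : ℕ} {A : Fin d → Fin d → ℝ} {g : Fin d → ℕ} {p : ℝ}
  {V : Fin d → Eu N → ℝ}

lemma Hl_scale (V : Fin d → Eu N → ℝ) {r : ℝ} (hr : 0 < r) (ρ τ : ℝ) :
    Hl (fun i x => V i (r • x) / r ^ ρ) τ = Hl V (r ^ 2 * τ) * (r ^ 2) ^ (-(3 + (N:ℝ) / 2 + ρ)) := by
  have e : sqs (fun i x => V i (r • x) / r ^ ρ) = fun x => (r ^ ρ)⁻¹ ^ 2 * (sqs V) (r • x) := by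
    ext x; simp only [sqs, Finset.mul_sum]
    exact Finset.sum_congr rfl fun i _ => by rw [div_eq_mul_inv]; ring
  unfold Hl
  rw [e, mo_cmul, mo_scale hr]
  have e2 : (r ^ 2) ^ (-(3 + (N:ℝ) / 2 + ρ)) = (r ^ ρ)⁻¹ ^ 2 * (r ^ (2 * 3 + N))⁻¹ := by
    rw [← Real.rpow_natCast r 2, ← Real.rpow_natCast r (2 * 3 + N), ← Real.rpow_mul hr.le, ← Real.rpow_neg hr.le,
      ← Real.rpow_natCast _ 2, ← Real.rpow_mul hr.le, ← Real.rpow_neg hr.le, ← Real.rpow_add hr]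
    congr 1; push_cast; ring
  rw [e2]; ring

/-- the class of normalised limit profiles -/
structure KK (A : Fin d → Fin d → ℝ) (p C ρ : ℝ) (V : Fin d → Eu N → ℝ) : Prop where
  hol : ∀ i x y, |V i x - V i y| ≤ C * dist x y ^ ρ
  inf : InfL A p V
  zero : ∀ i, V i 0 = 0

variable {C ρ : ℝ}

lemma KK.cont (hρ : 0 < ρ) (h : KK A p C ρ V) (i : Fin d) : Continuous (V i) :=
  mod_cont (pow_mod hρ) (h.hol i)

lemma hol_rescale (h : ∀ (i : Fin d) x y, |V i x - V i y| ≤ C * dist x y ^ ρ) (x0 : Eu N) {r : ℝ}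
    (hr : 0 < r) (i : Fin d) (x y : Eu N) :
    |V i (x0 + r • x) / r ^ ρ - V i (x0 + r • y) / r ^ ρ| ≤ C * dist x y ^ ρ := by
  have hr' := Real.rpow_pos_of_pos hr ρ
  rw [← sub_div, abs_div, abs_of_pos hr', div_le_iff₀ hr']
  refine (h i _ _).trans (le_of_eq ?_)
  rw [dist_add_left, dist_smul₀, Real.norm_eq_abs, abs_of_pos hr, Real.mul_rpow hr.le dist_nonneg]; ring

lemma KK.rescale (h : KK A p C ρ V) {x0 : Eu N} (hx0 : ∀ i, V i x0 = 0) {r : ℝ} (hr : 0 < r) :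
    KK A p C ρ (fun i x => V i (x0 + r • x) / r ^ ρ) :=
  ⟨hol_rescale h.hol x0 hr, h.inf.rescale x0 hr (Real.rpow_pos_of_pos hr ρ), fun i => by simp [hx0 i]⟩

lemma KK.rescale0 (h : KK A p C ρ V) {r : ℝ} (hr : 0 < r) :
    KK A p C ρ (fun i x => V i (r • x) / r ^ ρ) := by
  simpa using h.rescale h.zero hr

lemma KK.transl (h : KK A p C ρ V) {x0 : Eu N} (hx0 : ∀ i, V i x0 = 0) :
    KK A p C ρ (fun i x => V i (x0 + x)) := by
  simpa using h.rescale hx0 one_pos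

lemma KK.lim (hρ : 0 < ρ) {W : ℕ → Fin d → Eu N → ℝ} (h : ∀ n, KK A p C ρ (W n)) :
    ∃ V, KK A p C ρ V ∧ (∀ i x, Tendsto (fun n => W n i x) (hyperfilter ℕ) (𝓝 (V i x))) ∧
      ∀ t, Tendsto (fun n => Hl (W n) t) (hyperfilter ℕ) (𝓝 (Hl V t)) := by
  obtain ⟨V, h1, h2, h3⟩ := ultra_lim (hyperfilter ℕ) (v := W) (ω := fun t => C * t ^ ρ) (ε := fun _ => 0)
    (pow_mod hρ) tendsto_const_nhds
    (fun R => Eventually.of_forall fun n i x _ y _ => by simpa using (h n).hol i x y) (B := 0)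
    (Eventually.of_forall fun n i => by rw [(h n).zero i]; simp)
  have hK : KK A p C ρ V := ⟨h3, InfL.lim (fun n => (h n).inf) h2, fun i => by
    refine tendsto_nhds_unique (h1 i 0) ?_
    simp_rw [(h _).zero]; exact tendsto_const_nhds⟩
  refine ⟨V, hK, h1, fun t => ?_⟩
  obtain ⟨R, hR, hτ⟩ := exists_R t
  obtain ⟨B, hB0, hB⟩ := exists_bd (hK.cont hρ) R
  refine (mo_tendsto hR hτ 2 (Eventually.of_forall fun n => (sqs_continuous ((h n).cont hρ)).continuousOn)
    (sqs_continuous (hK.cont hρ)).continuousOn ?_).const_mul 4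
  exact unif_comp hB0 (fun i x hx => hB i x (ball_subset_closedBall hx)) (h2 R)
      (F := fun s => ∑ i, s i ^ 2) (by fun_prop)

lemma KK.Hl_le (hρ : 0 < ρ) (hC : 0 ≤ C) (h : KK A p C ρ V) :
    Hl V 1 ≤ 4 * mo (N := N) 1 3 (fun _ => d * (C * 2 ^ ρ) ^ 2) := by
  unfold Hl
  have := mo_mono (N := N) (R := 2) (by norm_num) (by norm_num) 2 (τ := 1) (g := sqs V)
    (h := fun _ => d * (C * 2 ^ ρ) ^ 2) (sqs_continuous (h.cont hρ)).continuousOn continuousOn_const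
    fun x hx => by
      calc sqs V x ≤ ∑ i : Fin d, (C * 2 ^ ρ) ^ 2 := by
            refine Finset.sum_le_sum fun i _ => ?_
            have a := h.hol i x 0
            rw [h.zero, sub_zero] at a
            have b : dist x 0 ≤ 2 := (mem_ball.1 hx).le
            rw [← sq_abs]
            refine pow_le_pow_left₀ (abs_nonneg _) (a.trans ?_) 2
            gcongr
        _ = _ := by simp
  linarith

/-- extremal profile: homogeneous about the origin, maximal -/
lemma exists_extremal (hA : CplOK A g) (hp : 0 < p) (hρ : 0 < ρ) (hC : 0 ≤ C)
    (hne : ∃ V : Fin d → Eu N → ℝ, KK A p C ρ V) :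
    ∃ (c : ℝ) (W : Fin d → Eu N → ℝ), KK A p C ρ W ∧ 
      (∀ t, 0 < t → Hl W t = c * t ^ (3 + (N:ℝ) / 2 + ρ)) ∧
      (∀ V : Fin d → Eu N → ℝ, KK A p C ρ V → ∀ t, 0 < t → Hl V t ≤ c * t ^ (3 + (N:ℝ) / 2 + ρ)) := by
  set S : Set ℝ := {a | ∃ V : Fin d → Eu N → ℝ, KK A p C ρ V ∧ Hl V 1 = a} with hS
  have hSne : S.Nonempty := by obtain ⟨V, hV⟩ := hne; exact ⟨_, V, hV, rfl⟩
  have hSb : BddAbove S := ⟨_, by rintro a ⟨V, hV, rfl⟩; exact hV.Hl_le hρ hC⟩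
  set c := sSup S with hc
  have hle : ∀ V : Fin d → Eu N → ℝ, KK A p C ρ V → Hl V 1 ≤ c := fun V hV => le_csSup hSb ⟨V, hV, rfl⟩
  have hscale : ∀ (V : Fin d → Eu N → ℝ) (t : ℝ), 0 < t → Hl (fun i x => V i (Real.sqrt t • x) / Real.sqrt t ^ ρ) 1
      = Hl V t * t ^ (-(3 + (N:ℝ) / 2 + ρ)) := fun V t ht => by
    rw [Hl_scale V (Real.sqrt_pos.2 ht), Real.sq_sqrt ht.le, mul_one]
  have hle' : ∀ V : Fin d → Eu N → ℝ, KK A p C ρ V → ∀ t, 0 < t →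
      Hl V t * t ^ (-(3 + (N:ℝ) / 2 + ρ)) ≤ c := fun V hV t ht => by
    rw [← hscale V t ht]; exact hle _ (hV.rescale0 (Real.sqrt_pos.2 ht))
  have hle'' : ∀ V : Fin d → Eu N → ℝ, KK A p C ρ V → ∀ t, 0 < t → Hl V t ≤ c * t ^ (3 + (N:ℝ) / 2 + ρ) := by
    intro V hV t ht
    have := hle' V hV t ht
    rw [Real.rpow_neg ht.le, ← div_eq_mul_inv, div_le_iff₀ (Real.rpow_pos_of_pos ht _)] at this
    exact this
  obtain ⟨s, hsm, hst, hsS⟩ := exists_seq_tendsto_sSup hSne hSb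
  choose U hU hUs using hsS
  obtain ⟨V, hV, _, hVH⟩ := KK.lim hρ hU
  have hV1 : Hl V 1 = c := by
    refine tendsto_nhds_unique (hVH 1) ?_
    simp_rw [hUs]
    exact hst.mono_left Nat.hyperfilter_le_atTop
  obtain ⟨v, M, ε, hx⟩ := hV.inf.apx hA hp (hV.cont hρ)
  have hanti := hx.anti hA hp (C := c) (ρ := ρ) fun t ht => hle'' V hV t (by linarith)
  have hVt : ∀ t, 0 < t → t ≤ 1 → Hl V t * t ^ (-(3 + (N:ℝ) / 2 + ρ)) = c := fun t ht ht1 => by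
    refine le_antisymm (hle' V hV t ht) ?_
    have := hanti (mem_Ioi.2 ht) (mem_Ioi.2 one_pos) ht1
    simp only [Real.one_rpow, mul_one, hV1] at this
    exact this
  obtain ⟨W, hW, _, hWH⟩ := KK.lim hρ (W := fun n i x => V i (((n:ℝ) + 1)⁻¹ • x) / ((n:ℝ) + 1)⁻¹ ^ ρ)
    fun n => hV.rescale0 (by positivity)
  refine ⟨c, W, hW, fun t ht => ?_, hle''⟩
  refine tendsto_nhds_unique (hWH t) (Tendsto.congr' ?_ tendsto_const_nhds)
  have hlim : Tendsto (fun n : ℕ => (((n:ℝ) + 1)⁻¹) ^ 2 * t) atTop (𝓝 0) := by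
    have : Tendsto (fun n : ℕ => ((n:ℝ) + 1)⁻¹) atTop (𝓝 0) := by
      simpa using tendsto_one_div_add_atTop_nhds_zero_nat (𝕜 := ℝ)
    simpa using (this.pow 2).mul_const t
  have hev : ∀ᶠ n : ℕ in hyperfilter ℕ, (((n:ℝ) + 1)⁻¹) ^ 2 * t < 1 :=
    Nat.hyperfilter_le_atTop (hlim.eventually (gt_mem_nhds one_pos))
  filter_upwards [hev] with n hn
  have hr : 0 < ((n:ℝ) + 1)⁻¹ := by positivity
  rw [Hl_scale V hr]
  have h1 := hVt _ (by positivity : 0 < (((n:ℝ) + 1)⁻¹) ^ 2 * t) hn.le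
  rw [← h1, Real.mul_rpow (by positivity) ht.le, Real.rpow_neg ht.le]
  have := Real.rpow_pos_of_pos ht (3 + (N:ℝ) / 2 + ρ)
  field_simp

end

end

section

section
variable {N d : ℕ} {A : Fin d → Fin d → ℝ} {g : Fin d → ℕ} {p : ℝ}
  {V W : Fin d → Eu N → ℝ} {C ρ : ℝ}

lemma KK.homog (hA : CplOK A g) (hp : 0 < p) (hρ : 0 < ρ) (h : KK A p C ρ W) {c : ℝ}
    (hW : ∀ t, 0 < t → Hl W t = c * t ^ (3 + (N:ℝ) / 2 + ρ)) (i : Fin d) (x : Eu N) {l : ℝ} (hl : 0 < l) :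
    W i (l • x) = l ^ ρ * W i x := by
  obtain ⟨v, M, ε, hx⟩ := h.inf.apx hA hp (h.cont hρ)
  have key : ∀ (x : Eu N) (l : ℝ), 0 < l → l ≤ 1 → W i (l • x) = l ^ ρ * W i x := by
    intro x l hl hl1
    have hτ : 0 < ‖x‖ ^ 2 + 1 := by positivity
    refine hx.homog (τ := ‖x‖ ^ 2 + 1) hρ.le ?_ i (by linarith) hl hl1
    have h1 := hx.t_C hA hp hτ ρ
    rwa [Apx.homog_C hp (h.cont hρ) (T := ‖x‖ ^ 2 + 2) (fun t ht _ => hW t ht) hτ (by linarith)] at h1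
  rcases le_total l 1 with h1 | h1
  · exact key x l hl h1
  · have h2 := key (l • x) l⁻¹ (by positivity) (inv_le_one_of_one_le₀ h1)
    rw [smul_smul, inv_mul_cancel₀ hl.ne', one_smul, Real.inv_rpow hl.le] at h2
    have := Real.rpow_pos_of_pos hl ρ
    rw [h2]; field_simp

lemma KK.period (hA : CplOK A g) (hp : 0 < p) (hρ : 0 < ρ) (h : KK A p C ρ W) {c : ℝ}
    (hW : ∀ t, 0 < t → Hl W t = c * t ^ (3 + (N:ℝ) / 2 + ρ))
    (hmax : ∀ V : Fin d → Eu N → ℝ, KK A p C ρ V → ∀ t, 0 < t → Hl V t ≤ c * t ^ (3 + (N:ℝ) / 2 + ρ))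
    {x0 : Eu N} (hx0 : ∀ i, W i x0 = 0) (i : Fin d) (y : Eu N) : W i (x0 + y) = W i y := by
  have hT := h.transl hx0
  obtain ⟨v, M, ε, hx⟩ := hT.inf.apx hA hp (hT.cont hρ)
  have hanti := hx.anti hA hp (C := c) (ρ := ρ) fun t ht => hmax _ hT t (by linarith)
  have hlim0 : Tendsto (fun n : ℕ => ((n:ℝ) + 1)⁻¹) atTop (𝓝 0) := by
    simpa using tendsto_one_div_add_atTop_nhds_zero_nat (𝕜 := ℝ)
  have hpt : ∀ (i : Fin d) (y : Eu N), Tendsto (fun n : ℕ => W i ((((n:ℝ) + 1)⁻¹) • x0 + y)) atTop (𝓝 (W i y)) := by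
    intro i y
    have := (hlim0.smul_const x0).add_const y
    rw [zero_smul, zero_add] at this
    exact ((h.cont hρ i).tendsto y).comp this
  have hbl : ∀ (n : ℕ) (i : Fin d) (x : Eu N), W i (x0 + ((n:ℝ)+1) • x) / ((n:ℝ)+1) ^ ρ
      = W i ((((n:ℝ) + 1)⁻¹) • x0 + x) := by
    intro n i x
    have hn : 0 < (n:ℝ) + 1 := by positivity
    have := h.homog hA hp hρ hW i ((((n:ℝ) + 1)⁻¹) • x0 + x) hn
    rw [smul_add, smul_smul, mul_inv_cancel₀ hn.ne', one_smul] at this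
    rw [this]
    have := Real.rpow_pos_of_pos hn ρ
    field_simp
  obtain ⟨Z, hZ, hZ1, hZ2⟩ := KK.lim hρ (W := fun n i x => W i (x0 + ((n:ℝ)+1) • x) / ((n:ℝ)+1) ^ ρ)
    fun n => h.rescale hx0 (by positivity)
  have hZW : Z = W := by
    ext i x
    refine tendsto_nhds_unique (hZ1 i x) ?_
    simp_rw [hbl]
    exact (hpt i x).mono_left Nat.hyperfilter_le_atTop
  have h1 := hZ2 1
  rw [hZW, hW 1 one_pos, Real.one_rpow, mul_one] at h1
  have hge : ∀ t, 0 < t → Hl (fun i x => W i (x0 + x)) t = c * t ^ (3 + (N:ℝ) / 2 + ρ) := by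
    intro t ht
    refine le_antisymm (hmax _ hT t ht) ?_
    have hev : ∀ᶠ n : ℕ in hyperfilter ℕ, t < ((n:ℝ) + 1) := by
      refine Nat.hyperfilter_le_atTop ?_
      filter_upwards [tendsto_natCast_atTop_atTop.eventually_ge_atTop t] with n hn
      linarith
    have : c ≤ Hl (fun i x => W i (x0 + x)) t * t ^ (-(3 + (N:ℝ) / 2 + ρ)) := by
      refine le_of_tendsto h1 ?_
      filter_upwards [hev] with n hn
      have hn1 : (1:ℝ) ≤ n + 1 := by have : (0:ℝ) ≤ n := Nat.cast_nonneg n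
                                     linarith
      have e := Hl_scale (fun i x => W i (x0 + x)) (show 0 < (n:ℝ) + 1 by positivity) ρ 1
      rw [mul_one] at e
      rw [e]
      exact hanti (mem_Ioi.2 ht) (mem_Ioi.2 (by positivity)) (by nlinarith)
    rw [Real.rpow_neg ht.le, ← div_eq_mul_inv, le_div_iff₀ (Real.rpow_pos_of_pos ht _)] at this
    exact this
  refine tendsto_nhds_unique (f := fun n : ℕ => W i ((((n:ℝ) + 1)⁻¹) • x0 + y)) (l := atTop) ?_ (hpt i y)
  refine tendsto_const_nhds.congr fun n => ?_
  have hn : 0 < (n:ℝ) + 1 := by positivity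
  rw [← hbl, hT.homog hA hp hρ hge i y hn]
  have := Real.rpow_pos_of_pos hn ρ
  field_simp

lemma KK.ext_zero (hA : CplOK A g) (hp : 0 < p) (hρ : 0 < ρ) (hρ1 : ρ < 1) (h : KK A p C ρ W) {c : ℝ}
    (hW : ∀ t, 0 < t → Hl W t = c * t ^ (3 + (N:ℝ) / 2 + ρ))
    (hmax : ∀ V : Fin d → Eu N → ℝ, KK A p C ρ V → ∀ t, 0 < t → Hl V t ≤ c * t ^ (3 + (N:ℝ) / 2 + ρ))
    (i : Fin d) (x : Eu N) : W i x = 0 := by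
  have hper := fun {x0} hx0 => h.period hA hp hρ hW hmax (x0 := x0) hx0
  let L : Submodule ℝ (Eu N) :=
    { carrier := {x | ∀ i, W i x = 0}
      add_mem' := fun {a b} ha hb i => by rw [hper ha]; exact hb i
      zero_mem' := h.zero
      smul_mem' := fun l x hx i => by
        have hpos : ∀ (l : ℝ), 0 < l → ∀ x, (∀ i, W i x = 0) → ∀ i, W i (l • x) = 0 := fun l hl x hx i => by
          rw [h.homog hA hp hρ hW i x hl, hx i, mul_zero]
        rcases lt_trichotomy l 0 with hl | hl | hl
        · have hneg : ∀ i, W i (-x) = 0 := fun i => by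
            have := hper hx i (-x)
            rw [add_neg_cancel, h.zero] at this
            exact this.symm
          have := hpos (-l) (by linarith) (-x) hneg i
          simpa using this
        · rw [hl, zero_smul]; exact h.zero i
        · exact hpos l hl x hx i }
  have hL : ∀ x, x ∈ L ↔ ∀ i, W i x = 0 := fun x => Iff.rfl
  have hharm : ∀ x, x ∉ L → ∀ i, LocHarm (W i) x := by
    intro x hx i
    rw [hL] at hx; push Not at hx
    obtain ⟨k, hk⟩ := hx
    exact h.inf.harm hA hp (h.cont hρ) hk i
  by_contra hcon
  have hxL : x ∉ L := fun hx => hcon (hx i)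
  obtain ⟨y, hy, z, hz, hxyz⟩ := L.exists_add_mem_mem_orthogonal x
  have hz0 : z ≠ 0 := by rintro rfl; rw [add_zero] at hxyz; exact hxL (hxyz ▸ hy)
  set e := (‖z‖⁻¹ : ℝ) • z with he
  have he1 : ‖e‖ = 1 := by rw [he, norm_smul, norm_inv, norm_norm, inv_mul_cancel₀ (norm_ne_zero_iff.2 hz0)]
  have heL : e ∈ Lᗮ := Submodule.smul_mem _ _ hz
  have hort : ∀ a ∈ Lᗮ, ∀ x ∈ L, ⟪a, x⟫ = 0 := fun a ha x hx => Submodule.inner_left_of_mem_orthogonal hx ha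
  by_cases hb : ∃ b ∈ Lᗮ, b ≠ 0 ∧ ⟪e, b⟫ = 0
  · obtain ⟨b, hbL, hb0, heb⟩ := hb
    have := liouville_codim2 hρ hρ1 (h.hol i) (a := e) (b := (‖b‖⁻¹ : ℝ) • b) he1
      (by rw [norm_smul, norm_inv, norm_norm, inv_mul_cancel₀ (norm_ne_zero_iff.2 hb0)])
      (by rw [inner_smul_right, heb, mul_zero])
      (fun w hw => hharm w (fun hwL => by
        rcases hw with hw | hw
        · exact hw (hort _ heL w hwL)
        · exact hw (hort _ (Submodule.smul_mem _ _ hbL) w hwL)) i) x 0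
    rw [h.zero] at this
    exact hcon this
  · push Not at hb
    have hdec : ∀ x, x - ⟪e, x⟫ • e ∈ L := by
      intro x
      obtain ⟨y, hy, z, hz, hxyz⟩ := L.exists_add_mem_mem_orthogonal x
      have hzz : z - ⟪e, x⟫ • e = 0 := by
        by_contra hne
        refine hb _ (Submodule.sub_mem _ hz (Submodule.smul_mem _ _ heL)) hne ?_
        rw [inner_sub_right, inner_smul_right, real_inner_self_eq_norm_sq, he1, hxyz, inner_add_right, hort e heL y hy]
        ring
      have : x - ⟪e, x⟫ • e = y + (z - ⟪e, x⟫ • e) := by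
        have h5 : y = x - z := by rw [hxyz]; abel
        rw [h5]; abel
      rw [this, hzz, add_zero]; exact hy
    have heq : ∀ (k : Fin d) (x : Eu N), 0 < ⟪e, x⟫ → W k x = ⟪e, x⟫ ^ ρ * W k e := by
      intro k x hx
      have := hper (hdec x) k (⟪e, x⟫ • e)
      rw [sub_add_cancel, h.homog hA hp hρ hW k e hx] at this
      exact this
    have hee : ⟪e, e⟫ = 1 := by rw [real_inner_self_eq_norm_sq, he1]; norm_num
    have heN : e ∉ L := fun h1 => by
      have := hort e heL e h1
      rw [hee] at this; exact one_ne_zero this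
    have hev : ∀ᶠ x in 𝓝 e, 0 < ⟪e, x⟫ := by
      have : ContinuousAt (fun x : Eu N => ⟪e, x⟫) e := by fun_prop
      exact this.eventually (lt_mem_nhds (show (0:ℝ) < ⟪e, e⟫ by rw [hee]; exact one_pos))
    have test : ∀ (V : Eu N → ℝ) (w : ℝ), LocHarm V e → (∀ x, 0 < ⟪e, x⟫ → V x = ⟪e, x⟫ ^ ρ * w) →
        0 ≤ w * (ρ * (ρ - 1)) := by
      intro V w hV hVe
      have hφ : ContDiffAt ℝ 2 (fun y : Eu N => w * (⟪e, y⟫ + 0) ^ ρ) e := by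
        refine contDiffAt_const.mul ?_
        refine ContDiffAt.rpow_const_of_ne ?_ ?_
        · exact ((cd_inner e).add contDiff_const).contDiffAt
        · rw [hee]; norm_num
      have h1 := hV.test hφ (by
        filter_upwards [hev] with x hx
        rw [hVe x hx, hVe e (by rw [hee]; exact one_pos)]
        simp only [add_zero]
        apply le_of_eq; ring)
      have h2 := lapl_ridge e 0 (x := e) (φ := fun t => w * t ^ ρ) (φ' := fun t => w * (ρ * t ^ (ρ - 1)))
        (φ'' := w * (ρ * ((ρ - 1) * 1 ^ (ρ - 1 - 1)))) (by
          rw [hee, add_zero]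
          filter_upwards [lt_mem_nhds (zero_lt_one (α := ℝ))] with t ht
          exact (Real.hasDerivAt_rpow_const (Or.inl ht.ne')).const_mul w) (by
          rw [hee, add_zero]
          exact ((Real.hasDerivAt_rpow_const (Or.inl one_ne_zero)).const_mul ρ).const_mul w)
      rw [h2, he1, Real.one_rpow] at h1
      linarith
    refine heN fun k => ?_
    have t1 := test (W k) (W k e) (hharm e heN k) (heq k)
    have t2 := test (fun x => - W k x) (- W k e) (hharm e heN k).neg (fun x hx => by rw [heq k x hx]; ring)
    have : W k e * (ρ * (ρ - 1)) = 0 := by linarith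
    have hne : ρ * (ρ - 1) ≠ 0 := mul_ne_zero hρ.ne' (by linarith)
    exact (mul_eq_zero.1 this).resolve_right hne

lemma KK.eq_zero (hA : CplOK A g) (hp : 0 < p) (hρ : 0 < ρ) (hρ1 : ρ < 1) (hC : 0 ≤ C) (h : KK A p C ρ V)
    (i : Fin d) (x : Eu N) : V i x = 0 := by
  obtain ⟨c, W, hW, hW1, hmax⟩ := exists_extremal hA hp hρ hC ⟨V, h⟩
  have hz := hW.ext_zero hA hp hρ hρ1 hW1 hmax
  have hc : c = 0 := by
    have := hW1 1 one_pos
    rw [Real.one_rpow, mul_one] at this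
    rw [← this]
    have e : sqs W = fun _ => 0 := by ext x; simp [sqs, hz]
    simp [Hl, e, mo]
  have h1 := hmax V h (‖x‖ ^ 2 + 1) (by positivity)
  rw [hc, zero_mul] at h1
  have h2 : mo (‖x‖ ^ 2 + 1) (2 + 1) (sqs V) = 0 := by
    have := mo_nonneg' (N := N) (h := sqs V) (fun x => Finset.sum_nonneg fun i _ => sq_nonneg _) (‖x‖ ^ 2 + 1) 2
    unfold Hl at h1
    norm_num at this h1 ⊢
    linarith
  have h3 := mo_zero (sqs_continuous (h.cont hρ)) (fun x => Finset.sum_nonneg fun i _ => sq_nonneg _) h2 (by linarith)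
  have := (Finset.sum_eq_zero_iff_of_nonneg (fun i _ => sq_nonneg _)).1 h3 i (Finset.mem_univ _)
  exact pow_eq_zero_iff (two_ne_zero) |>.1 this

/-- Theorem 1 -/
theorem thm1 (hA : CplOK A g) (hp : 0 < p) (hρ : 0 < ρ) (hρ1 : ρ < 1) (hC : 0 ≤ C)
    (hV : ∀ i x y, |V i x - V i y| ≤ C * dist x y ^ ρ) (h : InfL A p V) (i : Fin d) (x y : Eu N) :
    V i x = V i y := by
  have hVc : ∀ i, Continuous (V i) := fun i => mod_cont (pow_mod hρ) (hV i)
  by_cases hz : ∃ x0, ∀ i, V i x0 = 0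
  · obtain ⟨x0, hx0⟩ := hz
    have hK : KK A p C ρ (fun i x => V i (x0 + x)) := by
      refine ⟨fun i x y => ?_, ?_, fun i => by simp [hx0 i]⟩
      · simpa using hV i (x0 + x) (x0 + y)
      · simpa using h.rescale x0 one_pos one_pos
    have h0 : ∀ x, V i x = 0 := fun x => by
      simpa using hK.eq_zero hA hp hρ hρ1 hC i (x - x0)
    rw [h0, h0]
  · push Not at hz
    refine liouville_univ hρ hρ1 (hV i) (fun x => ?_) x y
    obtain ⟨k, hk⟩ := hz x
    exact h.harm hA hp hVc hk i

end

end

section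

/-- a blow-up sequence along an ultrafilter -/
structure Blow {N d : ℕ} (l : Ultrafilter ℕ) (A : Fin d → Fin d → ℝ) (p C0 ρ : ℝ) (δ ε M : ℕ → ℝ)
    (v : ℕ → Fin d → Eu N → ℝ) : Prop where
  M0 : ∀ n, 0 ≤ M n
  ε0 : ∀ n, 0 ≤ ε n
  εt : Tendsto ε l (𝓝 0)
  δt : Tendsto δ l (𝓝 0)
  as : ∀ R : ℝ, ∀ᶠ n in (l : Filter ℕ), ASOn A p (M n) (ε n) (ball 0 R) (v n)
  osc : ∀ R : ℝ, ∀ᶠ n in (l : Filter ℕ), ∀ i, ∀ x ∈ ball (0 : Eu N) R, ∀ y ∈ ball (0 : Eu N) R,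
      |v n i x - v n i y| ≤ C0 * max (dist x y ^ (ρ - δ n)) (dist x y ^ (ρ + δ n)) + ε n

def Flat {N d : ℕ} (l : Ultrafilter ℕ) (v : ℕ → Fin d → Eu N → ℝ) : Prop :=
  ∀ η : ℝ, 0 < η → ∀ᶠ n in (l : Filter ℕ), ∀ i, ∀ x ∈ closedBall (0 : Eu N) 1, |v n i x - v n i 0| ≤ η

section
variable {N d : ℕ} {l : Ultrafilter ℕ} {A : Fin d → Fin d → ℝ} {g : Fin d → ℕ} {p C0 ρ : ℝ}
  {δ ε M : ℕ → ℝ} {v : ℕ → Fin d → Eu N → ℝ}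

lemma max_rpow_le {t ρ δ : ℝ} (ht : 0 ≤ t) (hδ1 : -(ρ / 2) ≤ δ) (hδ : δ ≤ ρ / 2) (hρ : 0 < ρ) :
    max (t ^ (ρ - δ)) (t ^ (ρ + δ)) ≤ max (t ^ (ρ / 2)) (t ^ (3 * ρ / 2)) := by
  rcases le_total t 1 with h | h
  · refine le_max_of_le_left (max_le ?_ ?_) <;>
    exact Real.rpow_le_rpow_of_exponent_ge' ht h (by linarith) (by linarith)
  · refine le_max_of_le_right (max_le ?_ ?_) <;>
    exact Real.rpow_le_rpow_of_exponent_le h (by linarith)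

lemma Blow.δev (h : Blow l A p C0 ρ δ ε M v) (hρ : 0 < ρ) :
    ∀ᶠ n in (l : Filter ℕ), -(ρ/2) ≤ δ n ∧ δ n ≤ ρ / 2 := by
  filter_upwards [h.δt.eventually (lt_mem_nhds (show -(ρ/2) < 0 by linarith)),
    h.δt.eventually (gt_mem_nhds (show 0 < ρ/2 by linarith))] with n a b
  exact ⟨a.le, b.le⟩

lemma Blow.osc' (h : Blow l A p C0 ρ δ ε M v) (hρ : 0 < ρ) (hC0 : 0 ≤ C0) (R : ℝ) :
    ∀ᶠ n in (l : Filter ℕ), ∀ i, ∀ x ∈ ball (0 : Eu N) R, ∀ y ∈ ball (0 : Eu N) R,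
      |v n i x - v n i y| ≤ C0 * max (dist x y ^ (ρ / 2)) (dist x y ^ (3 * ρ / 2)) + ε n := by
  filter_upwards [h.osc R, h.δev hρ] with n a b i x hx y hy
  refine (a i x hx y hy).trans ?_
  have := max_rpow_le (t := dist x y) dist_nonneg b.1 b.2 hρ
  gcongr

lemma Blow.osc_big (h : Blow l A p C0 ρ δ ε M v) (hρ : 0 < ρ) (hρ1 : ρ < 1) (hC0 : 0 ≤ C0) (R : ℝ) {k : ℝ}
    (hk : 1 ≤ k) :
    ∀ᶠ n in (l : Filter ℕ), ∀ i, ∀ x ∈ ball (0 : Eu N) R, ∀ y ∈ ball (0 : Eu N) R, dist x y ≤ k ^ 2 →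
      |v n i x - v n i y| ≤ (C0 + 1) * k ^ 3 := by
  filter_upwards [h.osc' hρ hC0 R, h.εt.eventually (gt_mem_nhds one_pos)] with n a b i x hx y hy hxy
  refine (a i x hx y hy).trans ?_
  have hk3 : 1 ≤ k ^ 3 := one_le_pow₀ hk
  have hk2 : 1 ≤ k ^ 2 := one_le_pow₀ hk
  have key : ∀ q : ℝ, 0 ≤ q → q ≤ 3 / 2 → dist x y ^ q ≤ k ^ 3 := by
    intro q hq hq2
    calc dist x y ^ q ≤ (k ^ 2) ^ q := Real.rpow_le_rpow dist_nonneg hxy hq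
      _ ≤ (k ^ 2) ^ (3 / 2 : ℝ) := Real.rpow_le_rpow_of_exponent_le hk2 hq2
      _ = k ^ 3 := by
        rw [← Real.rpow_natCast k 2, ← Real.rpow_mul (by linarith), ← Real.rpow_natCast k 3]
        norm_num
  have : max (dist x y ^ (ρ / 2)) (dist x y ^ (3 * ρ / 2)) ≤ k ^ 3 :=
    max_le (key _ (by linarith) (by linarith)) (key _ (by linarith) (by linarith))
  have := mul_le_mul_of_nonneg_left this hC0
  linarith

lemma mod_two (hρ : 0 < ρ) (C0 : ℝ) (hC0 : 0 ≤ C0) : ∀ δ : ℝ, 0 < δ → ∃ η : ℝ, 0 < η ∧ ∀ t : ℝ, 0 ≤ t → t < η →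
    C0 * max (t ^ (ρ / 2)) (t ^ (3 * ρ / 2)) ≤ δ := by
  intro δ hδ
  obtain ⟨η, hη, h1⟩ := pow_mod (C := C0) (ρ := ρ / 2) (by linarith) δ hδ
  obtain ⟨η', hη', h2⟩ := pow_mod (C := C0) (ρ := 3 * ρ / 2) (by linarith) δ hδ
  refine ⟨min η η', lt_min hη hη', fun t ht htt => ?_⟩
  rw [mul_max_of_nonneg _ _ hC0]
  exact max_le (h1 t ht (htt.trans_le (min_le_left _ _))) (h2 t ht (htt.trans_le (min_le_right _ _)))

lemma Blow.limit (h : Blow l A p C0 ρ δ ε M v) (hρ : 0 < ρ) (hC0 : 0 ≤ C0) {z : ℕ → Fin d → ℝ}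
    {B : ℝ} (hB : ∀ᶠ n in (l : Filter ℕ), ∀ i, |v n i 0 - z n i| ≤ B) :
    ∃ V : Fin d → Eu N → ℝ, 
      (∀ R δ : ℝ, 0 < δ → ∀ᶠ n in (l : Filter ℕ), ∀ i, ∀ x ∈ ball (0 : Eu N) R, |(v n i x - z n i) - V i x| ≤ δ) ∧
      ∀ i x y, |V i x - V i y| ≤ C0 * dist x y ^ ρ := by
  obtain ⟨V, h1, h2, h3⟩ := ultra_lim l (v := fun n i x => v n i x - z n i) (mod_two hρ C0 hC0) h.εt
    (fun R => by
      filter_upwards [h.osc' hρ hC0 R] with n a i x hx y hy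
      simpa using a i x hx y hy) hB
  refine ⟨V, h2, fun i x y => ?_⟩
  have t1 : Tendsto (fun n => |(v n i x - z n i) - (v n i y - z n i)|) l (𝓝 |V i x - V i y|) :=
    ((h1 i x).sub (h1 i y)).abs
  rcases eq_or_ne x y with rfl | hxy
  · rw [sub_self, abs_zero]; positivity
  have hd : 0 < dist x y := dist_pos.2 hxy
  have t2 : Tendsto (fun n => C0 * max (dist x y ^ (ρ - δ n)) (dist x y ^ (ρ + δ n)) + ε n) l
      (𝓝 (C0 * dist x y ^ ρ)) := by
    have a1 : Tendsto (fun n => dist x y ^ (ρ - δ n)) l (𝓝 (dist x y ^ ρ)) := by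
      have := (Tendsto.rpow (tendsto_const_nhds (x := dist x y)) (h.δt.const_sub ρ) (Or.inl hd.ne'))
      rwa [sub_zero] at this
    have a2 : Tendsto (fun n => dist x y ^ (ρ + δ n)) l (𝓝 (dist x y ^ ρ)) := by
      have := (Tendsto.rpow (tendsto_const_nhds (x := dist x y)) (h.δt.const_add ρ) (Or.inl hd.ne'))
      rwa [add_zero] at this
    have := ((a1.max a2).const_mul C0).add h.εt
    rwa [max_self, add_zero] at this
  refine le_of_tendsto_of_tendsto t1 t2 ?_
  filter_upwards [h.osc (‖x‖ + ‖y‖ + 1)] with n hn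
  have := hn i x (by rw [mem_ball_zero_iff]; linarith [norm_nonneg x, norm_nonneg y]) y
    (by rw [mem_ball_zero_iff]; linarith [norm_nonneg x, norm_nonneg y])
  simpa using this

lemma flat_of_const {z : ℕ → Fin d → ℝ} {V : Fin d → Eu N → ℝ}
    (h1 : ∀ R δ : ℝ, 0 < δ → ∀ᶠ n in (l : Filter ℕ), ∀ i, ∀ x ∈ ball (0 : Eu N) R, |(v n i x - z n i) - V i x| ≤ δ)
    (h2 : ∀ i x y, V i x = V i y) : Flat l v := by
  intro η hη
  filter_upwards [h1 2 (η / 2) (by positivity)] with n hn i x hx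
  have a1 := hn i x (closedBall_subset_ball (by norm_num) hx)
  have a2 := hn i 0 (mem_ball_self (by norm_num))
  rw [h2 i x 0] at a1
  rw [abs_le] at *
  constructor <;> linarith [a1.1, a1.2, a2.1, a2.2]

/-- Theorem 3 -/
lemma Blow.flat_inf (hA : CplOK A g) (hp : 0 < p) (h : Blow l A p C0 ρ δ ε M v) (hρ : 0 < ρ) (hρ1 : ρ < 1)
    (hC0 : 0 ≤ C0) (hinf : ∀ B : ℝ, ∀ᶠ n in (l : Filter ℕ), ∃ i, B < |v n i 0|) : Flat l v := by
  obtain ⟨V, h2, h3⟩ := h.limit hρ hC0 (z := fun n i => v n i 0) (B := 0) (Eventually.of_forall fun n i => by simp)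
  refine flat_of_const h2 fun i => liouville_univ hρ hρ1 (h3 i) fun x0 => ?_
  refine ⟨1, one_pos, fun η hη => ?_⟩
  -- choose the big radius
  have hK0 := KA_nonneg A
  set Q := KA A * 3 ^ (p + 1) * (16 * N * (C0 + 1)) with hQ
  have hQ0 : 0 ≤ Q := by positivity
  obtain ⟨k, hk⟩ : ∃ k : ℝ, k = 2 * Q / η + 1 := ⟨_, rfl⟩
  have hk1 : 1 ≤ k := by rw [hk]; have : 0 ≤ 2 * Q / η := by positivity
                         linarith
  have hkη : Q / k ≤ η / 2 := by
    rw [div_le_iff₀ (by linarith), hk]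
    have : η / 2 * (2 * Q / η + 1) = Q + η / 2 := by field_simp
    linarith
  set R := ‖x0‖ + 1 + k ^ 2 with hR
  obtain ⟨k', hk', hkR⟩ : ∃ k' : ℝ, 1 ≤ k' ∧ R ≤ k' ^ 2 :=
    ⟨R + 1, by rw [hR]; nlinarith [norm_nonneg x0], by rw [hR]; nlinarith [norm_nonneg x0, sq_nonneg k]⟩
  have hεev : ∀ᶠ n in (l : Filter ℕ), ε n + KA A * 3 ^ (p + 1) * ε n ≤ η / 2 := by
    have := h.εt.add (h.εt.const_mul (KA A * 3 ^ (p + 1)))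
    rw [mul_zero, add_zero] at this
    exact (this.eventually (gt_mem_nhds (show 0 < η / 2 by positivity))).mono fun n hn => hn.le
  obtain ⟨n, a1, a2, a3, a4, a5, a6⟩ := (((h.osc_big hρ hρ1 hC0 R hk1).and <| (h.osc_big hρ hρ1 hC0 R hk').and <|
    (h.as R).and <| (hinf (2 * ((C0 + 1) * k' ^ 3))).and <| hεev.and (h2 R η hη))).exists
  obtain ⟨i0, hi0⟩ := a4
  obtain ⟨j, -, hj⟩ := Finset.exists_max_image Finset.univ (fun i => |v n i 0|) ⟨i0, Finset.mem_univ _⟩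
  have hjb : 2 * ((C0 + 1) * k' ^ 3) < |v n j 0| := hi0.trans_le (hj i0 (Finset.mem_univ _))
  have hR0 : 0 < R := by rw [hR]; positivity
  have hb1 : ball x0 1 ⊆ ball (0 : Eu N) R := fun x hx => by
    rw [mem_ball_zero_iff, hR]
    have := norm_le_norm_add_norm_sub' x x0
    rw [mem_ball, dist_eq_norm] at hx
    nlinarith
  have hb2 : ∀ x ∈ ball x0 1, ball x (k ^ 2) ⊆ ball (0 : Eu N) R := fun x hx y hy => by
    rw [mem_ball_zero_iff, hR]
    have := norm_le_norm_add_norm_sub' x x0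
    have := norm_le_norm_add_norm_sub' y x
    rw [mem_ball, dist_eq_norm] at hx hy
    nlinarith
  refine ⟨fun x => v n i x - v n i 0, ((a3 i).1.mono hb1).sub contDiffOn_const, fun x hx => ⟨a6 i x (hb1 hx), ?_⟩⟩
  have hcd : ContDiffAt ℝ 2 (v n i) x := cd_at isOpen_ball (a3 i).1 (hb1 hx)
  have hlap : lapl (fun x => v n i x - v n i 0) x = lapl (v n i) x := by
    rw [lapl_sub hcd contDiffAt_const, lapl_const, sub_zero]
  have hosc0 : ∀ i, ∀ y ∈ ball (0 : Eu N) R, |v n i y - v n i 0| ≤ (C0 + 1) * k' ^ 3 := fun i y hy =>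
    a2 i y hy 0 (mem_ball_self hR0) ((mem_ball.1 hy).le.trans hkR)
  have hW : 0 < (C0 + 1) * k' ^ 3 := by positivity
  have := lemmaAB hA hp (h.M0 n) (h.ε0 n) (x := x) (r := k ^ 2) (by positivity)
    (v := v n) ((a3).mono le_rfl (hb2 x hx)) (j := j) (s := |v n j 0| / 2) (ω := (C0 + 1) * k ^ 3) (B := 3)
    (by linarith) (by positivity) (by norm_num)
    (fun y hy => by
      have b1 := hosc0 j y (hb2 x hx hy)
      have b2 := abs_sub_abs_le_abs_sub (v n j 0) (v n j y)
      rw [abs_sub_comm] at b2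
      linarith)
    (fun i _ y hy => a1 i y (hb2 x hx hy) x (hb1 hx) (mem_ball.1 hy).le)
    (fun m => by
      have b1 := hosc0 m x (hb1 hx)
      have b2 := abs_sub_abs_le_abs_sub (v n m x) (v n m 0)
      have b3 := hj m (Finset.mem_univ _)
      linarith) i
  rw [hlap]
  refine this.trans ?_
  have e : 16 * N * ((C0 + 1) * k ^ 3) / (k ^ 2) ^ 2 = 16 * N * (C0 + 1) / k := by
    have : k ≠ 0 := by linarith
    field_simp
  rw [e]
  have : KA A * 3 ^ (p + 1) * (16 * N * (C0 + 1) / k) = Q / k := by rw [hQ]; ring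
  rw [mul_add, this]
  linarith

lemma Blow.flat_Minf (hA : CplOK A g) (hp : 0 < p) (h : Blow l A p C0 ρ δ ε M v) (hρ : 0 < ρ) (hρ1 : ρ < 1)
    (hC0 : 0 ≤ C0) (hM : Tendsto M l atTop) : Flat l v := by
  by_cases hB : ∃ B : ℝ, ∀ᶠ n in (l : Filter ℕ), ∀ i, |v n i 0| ≤ B
  · obtain ⟨B, hB⟩ := hB
    obtain ⟨V, h2, h3⟩ := h.limit hρ hC0 (z := fun n i => 0) (B := B) (by simpa using hB)
    refine flat_of_const h2 (thm1 hA hp hρ hρ1 hC0 h3 ?_)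
    intro R η K hη
    obtain ⟨n, a1, a2, a3, a4⟩ := ((h.as R).and <| (h2 R η hη).and <| (hM.eventually_ge_atTop K).and
      (h.εt.eventually (gt_mem_nhds hη))).exists
    exact ⟨M n, a3, h.M0 n, v n, a1.mono a4.le subset_rfl, fun i x hx => by simpa using a2 i x hx⟩
  · refine h.flat_inf hA hp hρ hρ1 hC0 fun B => ?_
    push Not at hB
    exact hB B

end

end

section

lemma near_max {T : Type*} {F r : T → ℝ} (hr : ∀ t, 0 < r t) (hF : ∀ t, 0 ≤ F t) {C K ρ0 δ : ℝ}
    (hδ : 0 < δ) (hδ1 : δ ≤ 1 / 2)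
    (h1 : ∀ t, r t ≤ 1 → F t ≤ C * r t ^ (ρ0 - δ)) (h2 : ∀ t, 1 ≤ r t → F t ≤ K * r t ^ (ρ0 + δ))
    (h3 : ∀ B : ℝ, ∃ t, B * r t ^ (ρ0 - δ) < F t) (B : ℝ) :
    ∃ t, 1 ≤ r t ∧ B * r t ^ (ρ0 - δ) ≤ F t ∧
      ∀ t', F t' ≤ 2 * F t * max ((r t' / r t) ^ (ρ0 - δ)) ((r t' / r t) ^ (ρ0 + δ)) := by
  set B' := |B| + |C| + 1 with hB'
  have hB'0 : 0 < B' := by positivity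
  obtain ⟨t0, ht0⟩ := h3 (4 * B')
  set lam := r t0 with hlam
  have hl0 : 0 < lam := hr t0
  set ρ := ρ0 - δ with hρ
  set W : T → ℝ := fun t => r t ^ ρ * (1 + r t / lam) ^ (2 * δ) with hW
  have hrp : ∀ t, 0 < r t ^ ρ := fun t => Real.rpow_pos_of_pos (hr t) _
  have hone : ∀ t, 1 ≤ 1 + r t / lam := fun t => by
    have : 0 < r t / lam := div_pos (hr t) hl0
    linarith
  have h1p : ∀ t, 1 ≤ (1 + r t / lam) ^ (2 * δ) := fun t =>
    Real.one_le_rpow (hone t) (by linarith)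
  have hW0 : ∀ t, 0 < W t := fun t => mul_pos (hrp t) (by linarith [h1p t])
  set G : T → ℝ := fun t => F t / W t with hG
  have hG1 : ∀ t, r t ≤ 1 → G t ≤ |C| := fun t ht => by
    have hrpt := (hrp t).le
    rw [hG]; simp only
    rw [div_le_iff₀ (hW0 t)]
    calc F t ≤ C * r t ^ ρ := h1 t ht
      _ ≤ |C| * (r t ^ ρ * 1) := by rw [mul_one]; gcongr; exact le_abs_self C
      _ ≤ |C| * W t := by rw [hW]; simp only; gcongr; exact h1p t
  have hG2 : ∀ t, 1 ≤ r t → G t ≤ |K| * lam ^ (2 * δ) := fun t ht => by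
    rw [hG]; simp only
    rw [div_le_iff₀ (hW0 t)]
    have e1 : r t ^ (ρ0 + δ) = r t ^ ρ * r t ^ (2 * δ) := by
      rw [← Real.rpow_add (hr t)]; congr 1; rw [hρ]; ring
    have e2 : r t ^ (2 * δ) = lam ^ (2 * δ) * (r t / lam) ^ (2 * δ) := by
      rw [← Real.mul_rpow hl0.le (div_pos (hr t) hl0).le]; congr 1; field_simp
    have e3 : (r t / lam) ^ (2 * δ) ≤ (1 + r t / lam) ^ (2 * δ) :=
      Real.rpow_le_rpow (div_pos (hr t) hl0).le (by linarith) (by linarith)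
    calc F t ≤ K * r t ^ (ρ0 + δ) := h2 t ht
      _ ≤ |K| * r t ^ (ρ0 + δ) := by
        have := Real.rpow_pos_of_pos (hr t) (ρ0 + δ)
        gcongr; exact le_abs_self K
      _ = |K| * lam ^ (2 * δ) * (r t ^ ρ * (r t / lam) ^ (2 * δ)) := by rw [e1, e2]; ring
      _ ≤ |K| * lam ^ (2 * δ) * W t := by
        rw [hW]; simp only
        have := Real.rpow_pos_of_pos hl0 (2 * δ)
        have := hrp t
        gcongr
  have hbdd : BddAbove (range G) := by
    refine ⟨|C| + |K| * lam ^ (2 * δ), ?_⟩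
    rintro _ ⟨t, rfl⟩
    have := Real.rpow_pos_of_pos hl0 (2 * δ)
    have hk : 0 ≤ |K| * lam ^ (2 * δ) := by positivity
    rcases le_total (r t) 1 with h | h
    · linarith [hG1 t h]
    · linarith [hG2 t h, abs_nonneg C]
  have hG0 : 2 * B' ≤ G t0 := by
    rw [hG]; simp only
    rw [le_div_iff₀ (hW0 t0)]
    have e : (1 + r t0 / lam) ^ (2 * δ) ≤ 2 := by
      rw [← hlam, div_self hl0.ne']
      calc ((1:ℝ) + 1) ^ (2 * δ) ≤ (1 + 1) ^ (1:ℝ) :=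
            Real.rpow_le_rpow_of_exponent_le (by norm_num) (by linarith)
        _ = 2 := by norm_num
    calc 2 * B' * W t0 ≤ 2 * B' * (r t0 ^ ρ * 2) := by
          rw [hW]; simp only
          have := hrp t0
          gcongr
      _ = 4 * B' * r t0 ^ ρ := by ring
      _ ≤ F t0 := ht0.le
  have hs : 2 * B' ≤ sSup (range G) := hG0.trans (le_csSup hbdd ⟨t0, rfl⟩)
  obtain ⟨_, ⟨t, rfl⟩, ht⟩ := exists_lt_of_lt_csSup (⟨_, t0, rfl⟩ : (range G).Nonempty)
    (show sSup (range G) / 2 < sSup (range G) by linarith)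
  have htB : B' ≤ G t := by linarith
  have hall : ∀ t', G t' ≤ 2 * G t := fun t' => by
    have := le_csSup hbdd ⟨t', rfl⟩
    linarith
  refine ⟨t, ?_, ?_, fun t' => ?_⟩
  · by_contra hcon
    have := hG1 t (not_le.1 hcon).le
    linarith [abs_nonneg B]
  · have h5 : B' * W t ≤ F t := (le_div_iff₀ (hW0 t)).1 htB
    refine le_trans ?_ h5
    rw [hW]; simp only
    have h6 := h1p t
    have h7 := hrp t
    calc B * r t ^ ρ ≤ B' * r t ^ ρ := by gcongr; rw [hB']; linarith [le_abs_self B, abs_nonneg C]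
      _ ≤ B' * (r t ^ ρ * (1 + r t / lam) ^ (2 * δ)) := by
        gcongr
        exact le_mul_of_one_le_right h7.le h6
  · set q := r t' / r t with hq
    have hq0 : 0 < q := div_pos (hr t') (hr t)
    have hrq : r t' = q * r t := by rw [hq]; field_simp [(hr t).ne']
    have h5 := hall t'
    have h6 : F t' ≤ 2 * G t * W t' := (div_le_iff₀ (hW0 t')).1 h5
    have hWt : W t' ≤ W t * max (q ^ ρ) (q ^ (ρ0 + δ)) := by
      rw [hW]; simp only
      have hqp : 0 < q ^ ρ := Real.rpow_pos_of_pos hq0 _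
      have h7 := hrp t
      have h8 := h1p t
      have e0 : r t' ^ ρ = q ^ ρ * r t ^ ρ := by rw [hrq, Real.mul_rpow hq0.le (hr t).le]
      have hd0 : 0 < r t / lam := div_pos (hr t) hl0
      have e9 : r t' / lam = q * (r t / lam) := by rw [hrq]; ring
      rcases le_total q 1 with hq1 | hq1
      · have a : (1 + r t' / lam) ^ (2 * δ) ≤ (1 + r t / lam) ^ (2 * δ) := by
          refine Real.rpow_le_rpow (by linarith [hone t']) ?_ (by linarith)
          rw [e9]; nlinarith
        calc r t' ^ ρ * (1 + r t' / lam) ^ (2 * δ) ≤ r t' ^ ρ * (1 + r t / lam) ^ (2 * δ) := by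
              have := hrp t'
              gcongr
          _ = r t ^ ρ * (1 + r t / lam) ^ (2 * δ) * q ^ ρ := by rw [e0]; ring
          _ ≤ _ := by gcongr; exact le_max_left _ _
      · have a : (1 + r t' / lam) ^ (2 * δ) ≤ q ^ (2 * δ) * (1 + r t / lam) ^ (2 * δ) := by
          rw [← Real.mul_rpow hq0.le (by linarith)]
          refine Real.rpow_le_rpow (by linarith [hone t']) ?_ (by linarith)
          rw [e9]; nlinarith
        have e1 : q ^ (ρ0 + δ) = q ^ ρ * q ^ (2 * δ) := by
          rw [← Real.rpow_add hq0]; congr 1; rw [hρ]; ring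
        calc r t' ^ ρ * (1 + r t' / lam) ^ (2 * δ) ≤ r t' ^ ρ * (q ^ (2 * δ) * (1 + r t / lam) ^ (2 * δ)) := by
              have := hrp t'
              gcongr
          _ = r t ^ ρ * (1 + r t / lam) ^ (2 * δ) * q ^ (ρ0 + δ) := by rw [e0, e1]; ring
          _ ≤ _ := by gcongr; exact le_max_right _ _
    have hGF : G t * W t = F t := div_mul_cancel₀ _ (hW0 t).ne'
    calc F t' ≤ 2 * G t * W t' := h6
      _ ≤ 2 * G t * (W t * max (q ^ ρ) (q ^ (ρ0 + δ))) := by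
        have : 0 ≤ G t := by linarith
        gcongr
      _ = 2 * (G t * W t) * max (q ^ ρ) (q ^ (ρ0 + δ)) := by ring
      _ = _ := by rw [hGF]

def FinL {N d : ℕ} (A : Fin d → Fin d → ℝ) (p M : ℝ) (V : Fin d → Eu N → ℝ) : Prop :=
  ∀ R ε : ℝ, 0 < ε → ∃ v : Fin d → Eu N → ℝ,
    ASOn A p M ε (ball 0 R) v ∧ ∀ i, ∀ x ∈ ball (0 : Eu N) R, |v i x - V i x| ≤ ε

def Good {N d : ℕ} (V : Fin d → Eu N → ℝ) (ρ : ℝ) : Prop :=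
  ∃ K : ℝ, ∀ i x y, 1 ≤ dist x y → |V i x - V i y| ≤ K * dist x y ^ ρ

section
variable {N d : ℕ} {A : Fin d → Fin d → ℝ} {g : Fin d → ℕ} {p M : ℝ}
  {V : Fin d → Eu N → ℝ}

lemma FinL.apx (hA : CplOK A g) (hp : 0 < p) (hM : 0 ≤ M) (h : FinL A p M V) (hVc : ∀ i, Continuous (V i)) :
    ∃ (v : ℕ → Fin d → Eu N → ℝ) (ε : ℕ → ℝ), 
      Apx A p V (fun x => M * Wf A p fun j => V j x) v (fun _ => M) ε := by
  have h1 : ∀ n : ℕ, _ := fun n => h n (1 / ((n:ℝ) + 1)) (by positivity)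
  choose v h2 h3 using h1
  have hε : Tendsto (fun n : ℕ => 1 / ((n:ℝ) + 1)) atTop (𝓝 0) := tendsto_one_div_add_atTop_nhds_zero_nat
  have has : ∀ R : ℝ, ∀ᶠ n : ℕ in atTop, ASOn A p M (1 / ((n:ℝ) + 1)) (ball 0 R) (v n) := fun R => by
    filter_upwards [tendsto_natCast_atTop_atTop.eventually_ge_atTop R] with n hn
    exact (h2 n).mono le_rfl (ball_subset_ball hn)
  have hcv : ∀ R δ : ℝ, 0 < δ → ∀ᶠ n in atTop, ∀ i, ∀ x ∈ ball 0 R, |v n i x - V i x| ≤ δ := fun R δ hδ => by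
    filter_upwards [tendsto_natCast_atTop_atTop.eventually_ge_atTop R, hε.eventually (gt_mem_nhds hδ)] with n hn he i x hx
    exact (h3 n i x (ball_subset_ball hn hx)).trans he.le
  have hWc : Continuous fun x => M * Wf A p fun j => V j x :=
    continuous_const.mul ((Wf_continuous A hp).comp (continuous_pi hVc))
  refine ⟨v, fun n => 1 / ((n:ℝ) + 1), fun _ => hM, hε, has, hcv, fun τ hτ k => ?_, hVc, hWc,
    fun x => mul_nonneg hM (Wf_nonneg hA hp _)⟩
  obtain ⟨R, hR, hτR⟩ := exists_R τ
  obtain ⟨B, hB0, hB⟩ := exists_bd hVc R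
  refine mo_tendsto hR hτR k ?_ hWc.continuousOn ?_
  · filter_upwards [has R] with n hn
    exact continuousOn_const.mul (cd_Wf A hp fun i => (hn i).1).continuousOn
  · exact unif_comp hB0 (fun i x hx => hB i x (ball_subset_closedBall hx)) (hcv R)
      (F := fun s => M * Wf A p s) (continuous_const.mul (Wf_continuous A hp))

lemma growth_of_good (hVc : ∀ i, Continuous (V i)) {ρ : ℝ} (hρ : 0 < ρ) (hg : Good V ρ) :
    ∃ C : ℝ, ∀ t, 1 ≤ t → Hl V t ≤ C * t ^ (3 + (N:ℝ) / 2 + ρ) := by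
  obtain ⟨K, hK⟩ := hg
  obtain ⟨B, hB0, hB⟩ := exists_bd hVc 1
  set c := B + |K| * 2 ^ ρ with hc
  refine ⟨4 * mo (N := N) 1 3 (fun _ => d * c ^ 2), fun t ht => ?_⟩
  have ht0 : 0 < t := by linarith
  set r := Real.sqrt t with hr
  have hr0 : 0 < r := Real.sqrt_pos.2 ht0
  have hr1 : 1 ≤ r := Real.one_le_sqrt.2 ht
  have e := Hl_scale V hr0 ρ 1
  rw [Real.sq_sqrt ht0.le, mul_one, Real.rpow_neg ht0.le, ← div_eq_mul_inv] at e
  have hle : Hl (fun i x => V i (r • x) / r ^ ρ) 1 ≤ 4 * mo (N := N) 1 3 (fun _ => d * c ^ 2) := by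
    unfold Hl
    have hcont : ∀ i, Continuous (fun x => V i (r • x) / r ^ ρ) := fun i =>
      ((hVc i).comp (continuous_const_smul r)).div_const _
    have := mo_mono (N := N) (R := 2) (by norm_num) (by norm_num) 2 (τ := 1) (g := sqs (fun i x => V i (r • x) / r ^ ρ))
      (h := fun _ => d * c ^ 2) (sqs_continuous hcont).continuousOn continuousOn_const
      fun x hx => by
        calc sqs (fun i x => V i (r • x) / r ^ ρ) x ≤ ∑ i : Fin d, c ^ 2 := by
              refine Finset.sum_le_sum fun i _ => ?_
              rw [← sq_abs]
              refine pow_le_pow_left₀ (abs_nonneg _) ?_ 2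
              have hrp : 1 ≤ r ^ ρ := Real.one_le_rpow hr1 hρ.le
              rw [abs_div, abs_of_pos (by linarith : 0 < r ^ ρ), div_le_iff₀ (by linarith)]
              have h2 : (0:ℝ) < 2 ^ ρ := by positivity
              have h3 : 0 ≤ |K| * 2 ^ ρ := by positivity
              have hnx : ‖r • x‖ ≤ 2 * r := by
                rw [norm_smul, Real.norm_eq_abs, abs_of_pos hr0]
                rw [mem_ball_zero_iff] at hx
                nlinarith
              rcases le_total ‖r • x‖ 1 with h | h
              · have := hB i (r • x) (by rwa [mem_closedBall_zero_iff])
                rw [hc]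
                nlinarith
              · have a1 := hK i (r • x) 0 (by rwa [dist_zero_right])
                have a2 := hB i 0 (by simp)
                rw [dist_zero_right] at a1
                have a3 : K * ‖r • x‖ ^ ρ ≤ |K| * (2 ^ ρ * r ^ ρ) := by
                  rw [← Real.mul_rpow (by norm_num) hr0.le]
                  have : ‖r • x‖ ^ ρ ≤ (2 * r) ^ ρ := Real.rpow_le_rpow (norm_nonneg _) hnx hρ.le
                  have h0 : 0 ≤ ‖r • x‖ ^ ρ := by positivity
                  calc K * ‖r • x‖ ^ ρ ≤ |K| * ‖r • x‖ ^ ρ := by gcongr; exact le_abs_self K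
                    _ ≤ _ := by gcongr
                have a4 := abs_sub_abs_le_abs_sub (V i (r • x)) (V i 0)
                have : c * r ^ ρ = B * r ^ ρ + |K| * (2 ^ ρ * r ^ ρ) := by rw [hc]; ring
                nlinarith
          _ = _ := by simp
    linarith
  rw [e, div_le_iff₀ (Real.rpow_pos_of_pos ht0 _)] at hle
  exact hle

lemma FinL.const_of_good (hA : CplOK A g) (hp : 0 < p) (hM : 0 ≤ M) (h : FinL A p M V) (hVc : ∀ i, Continuous (V i))
    (hg : ∀ ρ : ℝ, 0 < ρ → Good V ρ) (i : Fin d) (x : Eu N) : V i x = V i 0 := by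
  obtain ⟨v, ε, hx⟩ := h.apx hA hp hM hVc
  set P : Eu N → ℝ := fun x => M * Wf A p fun j => V j x with hP
  have hE : ∀ t, 0 < t → El p V P t ≤ 0 := fun t ht => by
    refine le_of_forall_pos_le_add fun η hη => ?_
    have hH := Hl_nonneg V t
    obtain ⟨C, hC⟩ := growth_of_good hVc (ρ := η / (2 * (Hl V t + 1))) (by positivity) (hg _ (by positivity))
    have := hx.growth hA hp hC ht
    refine this.trans ?_
    have e : 2 * (η / (2 * (Hl V t + 1))) * Hl V t = η * (Hl V t / (Hl V t + 1)) := by field_simp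
    rw [e, zero_add]
    have : Hl V t / (Hl V t + 1) ≤ 1 := by rw [div_le_one (by linarith)]; linarith
    nlinarith
  have hQ : ∀ t, 0 < t → El p V P t = 0 ∧ mo t 4 P = 0 := fun t ht => by
    have a := hx.D_nonneg hp ht 1
    have b := mo_nonneg' hx.P0 t 3
    have c := hE t ht
    unfold El at c ⊢
    norm_num at b
    constructor <;> linarith
  have hJ : ∀ t, 0 < t → Jl p V P t = 0 := fun t ht => by
    have d1 := El_deriv (p := p) (P := P) hVc hx.Pc t
    have d2 : HasDerivAt (El p V P) 0 t := by
      refine (hasDerivAt_const t (0:ℝ)).congr_of_eventuallyEq ?_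
      filter_upwards [lt_mem_nhds ht] with s hs
      exact (hQ s hs).1
    have := d1.unique d2
    have e := Jl_eq (p := p) (V := V) (P := P) t
    rw [this, (hQ t ht).1, (hQ t ht).2] at e
    linarith
  have hhom : ∀ l : ℝ, 0 < l → l ≤ 1 → V i (l • x) = V i x := fun l hl hl1 => by
    have hτ : 0 < ‖x‖ ^ 2 + 1 := by positivity
    have := hx.homog (τ := ‖x‖ ^ 2 + 1) le_rfl (by
      have h1 := hx.t_C hA hp hτ 0
      rw [hJ _ hτ] at h1
      norm_num at h1 ⊢
      exact h1) i (x := x) (by linarith) hl hl1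
    rwa [Real.rpow_zero, one_mul] at this
  have hlim : Tendsto (fun n : ℕ => V i ((1 / ((n:ℝ) + 1)) • x)) atTop (𝓝 (V i 0)) := by
    have := (tendsto_one_div_add_atTop_nhds_zero_nat (𝕜 := ℝ)).smul_const x
    rw [zero_smul] at this
    exact ((hVc i).tendsto 0).comp this
  refine tendsto_nhds_unique (tendsto_const_nhds.congr fun n => ?_) hlim
  refine (hhom _ (by positivity) ?_).symm
  rw [div_le_one (by positivity)]
  have : (0:ℝ) ≤ n := Nat.cast_nonneg n
  linarith

end

end

section

section
variable {N d : ℕ} {A : Fin d → Fin d → ℝ} {g : Fin d → ℕ} {p M : ℝ}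
  {V : Fin d → Eu N → ℝ}

lemma Good.mono {a b : ℝ} (h : Good V a) (hab : a ≤ b) : Good V b := by
  obtain ⟨K, hK⟩ := h
  refine ⟨|K|, fun i x y hxy => (hK i x y hxy).trans ?_⟩
  have h1 : dist x y ^ a ≤ dist x y ^ b := Real.rpow_le_rpow_of_exponent_le hxy hab
  have h0 : 0 ≤ dist x y ^ a := Real.rpow_nonneg dist_nonneg _
  calc K * dist x y ^ a ≤ |K| * dist x y ^ a := by gcongr; exact le_abs_self K
    _ ≤ _ := by gcongr

lemma FinL.step (hM : 0 < M) (hp : 0 < p) {C α ρ0 δ : ℝ} (hδ : 0 < δ) (hδ1 : δ ≤ 1 / 2) (hδ2 : δ < ρ0) (hα : ρ0 ≤ α)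
    (hV : ∀ i x y, |V i x - V i y| ≤ C * dist x y ^ α) (hC : 0 ≤ C) (h : FinL A p M V)
    (hg1 : Good V (ρ0 + δ)) (hg2 : ¬ Good V (ρ0 - δ)) {n : ℝ} (hn : 1 ≤ n) :
    ∃ (v : Fin d → Eu N → ℝ) (m : ℝ), M * n ^ (2 * p) ≤ m ∧ ASOn A p m (2 / n) (ball 0 n) v ∧
      (∀ i, ∀ x ∈ ball (0 : Eu N) n, ∀ y ∈ ball (0 : Eu N) n, 
        |v i x - v i y| ≤ 2 * max (dist x y ^ (ρ0 - δ)) (dist x y ^ (ρ0 + δ)) + 2 / n) ∧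
      ∃ i, ∃ x ∈ closedBall (0 : Eu N) 1, 1 ≤ |v i x - v i 0| + 2 / n := by
  have hn0 : 0 < n := by linarith
  let T := {t : Fin d × Eu N × Eu N // t.2.1 ≠ t.2.2}
  let F : T → ℝ := fun t => |V t.1.1 t.1.2.1 - V t.1.1 t.1.2.2|
  let r : T → ℝ := fun t => dist t.1.2.1 t.1.2.2
  have hr : ∀ t, 0 < r t := fun t => dist_pos.2 t.2
  obtain ⟨K, hK⟩ := hg1
  have hg3 : ∀ B : ℝ, ∃ t, B * r t ^ (ρ0 - δ) < F t := by
    intro B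
    by_contra! hcon
    refine hg2 ⟨B, fun i x y hxy => ?_⟩
    have hne : x ≠ y := by rintro rfl; rw [dist_self] at hxy; linarith
    exact hcon ⟨(i, x, y), hne⟩
  obtain ⟨⟨⟨i0, x0, y0⟩, hne⟩, hR1, hB, hall⟩ := near_max (F := F) (r := r) hr (fun t => abs_nonneg _) (C := C) (K := K)
    (ρ0 := ρ0) (δ := δ) hδ hδ1 (fun t ht => by
      refine (hV _ _ _).trans ?_
      have := Real.rpow_le_rpow_of_exponent_ge (hr t) ht (show ρ0 - δ ≤ α by linarith)
      exact mul_le_mul_of_nonneg_left this hC) (fun t ht => hK _ _ _ ht) hg3 n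
  simp only [F, r] at hR1 hB hall
  simp only at hne
  set R := dist x0 y0 with hR
  set σ := |V i0 x0 - V i0 y0| with hσ
  have hR0 : 0 < R := by linarith
  have hRp : 1 ≤ R ^ (ρ0 - δ) := Real.one_le_rpow hR1 (by linarith)
  have hσn : n ≤ σ := by nlinarith
  have hσ0 : 0 < σ := by linarith
  have hVs : ∀ i x y, |V i (x0 + R • x) / σ - V i (x0 + R • y) / σ|
      ≤ 2 * max (dist x y ^ (ρ0 - δ)) (dist x y ^ (ρ0 + δ)) := by
    intro i x y
    rcases eq_or_ne x y with rfl | hxy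
    · rw [sub_self, abs_zero]; positivity
    have hd : dist (x0 + R • x) (x0 + R • y) = R * dist x y := by
      rw [dist_add_left, dist_smul₀, Real.norm_eq_abs, abs_of_pos hR0]
    have := hall ⟨(i, x0 + R • x, x0 + R • y), by
      intro hh
      rw [← dist_eq_zero, hd] at hh
      have := dist_pos.2 hxy
      have := mul_pos hR0 this
      linarith⟩
    simp only [hd] at this
    rw [mul_div_cancel_left₀ _ hR0.ne'] at this
    rw [← sub_div, abs_div, abs_of_pos hσ0, div_le_iff₀ hσ0]
    linarith
  obtain ⟨w, hw1, hw2⟩ := h (‖x0‖ + R * n) (min (σ / n) (σ / R ^ 2 / n)) (by positivity)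
  have hin : ∀ x ∈ ball (0 : Eu N) n, x0 + R • x ∈ ball (0 : Eu N) (‖x0‖ + R * n) := by
    intro x hx
    rw [mem_ball_zero_iff] at hx ⊢
    calc _ ≤ ‖x0‖ + ‖R • x‖ := norm_add_le _ _
      _ < _ := by rw [norm_smul, Real.norm_eq_abs, abs_of_pos hR0]; gcongr
  have hvV : ∀ i, ∀ x ∈ ball (0 : Eu N) n, |w i (x0 + R • x) / σ - V i (x0 + R • x) / σ| ≤ 1 / n := by
    intro i x hx
    rw [← sub_div, abs_div, abs_of_pos hσ0, div_le_iff₀ hσ0]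
    refine (hw2 i _ (hin x hx)).trans ((min_le_left _ _).trans (le_of_eq ?_))
    ring
  have hnn : (1:ℝ) / n + 1 / n = 2 / n := by ring
  refine ⟨fun i x => w i (x0 + R • x) / σ, M * R ^ 2 * σ ^ (2 * p), ?_, ?_, fun i x hx y hy => ?_, i0, (R⁻¹) • (y0 - x0), ?_, ?_⟩
  · have a1 : n ^ (2 * p) ≤ σ ^ (2 * p) := Real.rpow_le_rpow hn0.le hσn (by linarith)
    have a2 : 1 ≤ R ^ 2 := one_le_pow₀ hR1
    have a3 : 0 < σ ^ (2 * p) := by positivity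
    calc M * n ^ (2 * p) ≤ M * σ ^ (2 * p) := by gcongr
      _ = M * 1 * σ ^ (2 * p) := by ring
      _ ≤ _ := by gcongr
  · refine (hw1.rescale isOpen_ball x0 R hσ0 hin).mono ?_ subset_rfl
    have a1 : min (σ / n) (σ / R ^ 2 / n) ≤ σ / R ^ 2 / n := min_le_right _ _
    calc min (σ / n) (σ / R ^ 2 / n) * R ^ 2 / σ ≤ (σ / R ^ 2 / n) * R ^ 2 / σ := by gcongr
      _ = 1 / n := by field_simp
      _ ≤ 2 / n := by gcongr; norm_num
  · have a1 := hvV i x hx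
    have a2 := hvV i y hy
    have a3 := hVs i x y
    simp only
    rw [← hnn]
    rw [abs_le] at a1 a2 a3 ⊢
    constructor <;> linarith [a1.1, a1.2, a2.1, a2.2, a3.1, a3.2]
  · rw [mem_closedBall_zero_iff, norm_smul, norm_inv, Real.norm_eq_abs, abs_of_pos hR0, ← dist_eq_norm, dist_comm, ← hR,
      inv_mul_cancel₀ hR0.ne']
  · rcases eq_or_lt_of_le hn with h1 | h1
    · have : (2:ℝ) / n = 2 := by rw [← h1]; norm_num
      rw [this]; linarith [abs_nonneg (w i0 (x0 + R • R⁻¹ • (y0 - x0)) / σ - w i0 (x0 + R • 0) / σ)]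
    have hz : ‖(R⁻¹) • (y0 - x0)‖ = 1 := by
      rw [norm_smul, norm_inv, Real.norm_eq_abs, abs_of_pos hR0, ← dist_eq_norm, dist_comm, ← hR,
        inv_mul_cancel₀ hR0.ne']
    have a1 := hvV i0 ((R⁻¹) • (y0 - x0)) (by rw [mem_ball_zero_iff, hz]; exact h1)
    have a2 := hvV i0 0 (mem_ball_self hn0)
    have e : x0 + R • (R⁻¹) • (y0 - x0) = y0 := by rw [smul_smul, mul_inv_cancel₀ hR0.ne', one_smul]; abel
    show 1 ≤ |w i0 (x0 + R • (R⁻¹) • (y0 - x0)) / σ - w i0 (x0 + R • (0 : Eu N)) / σ| + 2 / n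
    rw [e] at a1 ⊢
    rw [smul_zero, add_zero] at a2 ⊢
    have a3 : |V i0 x0 / σ - V i0 y0 / σ| = 1 := by
      rw [← sub_div, abs_div, abs_of_pos hσ0, ← hσ, div_self hσ0.ne']
    have a4 : |V i0 x0 / σ - V i0 y0 / σ| ≤ |w i0 x0 / σ - V i0 x0 / σ| + |w i0 y0 / σ - w i0 x0 / σ| 
        + |w i0 y0 / σ - V i0 y0 / σ| := by
      have := abs_add_three (-(w i0 x0 / σ - V i0 x0 / σ)) (-(w i0 y0 / σ - w i0 x0 / σ)) (w i0 y0 / σ - V i0 y0 / σ)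
      rw [abs_neg, abs_neg] at this
      refine le_trans (le_of_eq ?_) this
      congr 1; ring
    linarith

/-- Theorem 2 -/
theorem thm2 (hA : CplOK A g) (hp : 0 < p) (hM : 0 ≤ M) {C α : ℝ} (hα0 : 0 < α) (hα1 : α < 1) (hC : 0 ≤ C)
    (hV : ∀ i x y, |V i x - V i y| ≤ C * dist x y ^ α) (h : FinL A p M V) (i : Fin d) (x y : Eu N) :
    V i x = V i y := by
  have hVc : ∀ i, Continuous (V i) := fun i => mod_cont (pow_mod hα0) (hV i)
  rcases hM.eq_or_lt with hM0 | hM0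
  · refine liouville_univ hα0 hα1 (hV i) (fun x0 => ⟨1, one_pos, fun ε hε => ?_⟩) x y
    obtain ⟨v, h1, h2⟩ := h (‖x0‖ + 1) ε hε
    have hb : ball x0 1 ⊆ ball (0 : Eu N) (‖x0‖ + 1) := fun z hz => by
      rw [mem_ball_zero_iff]
      have := norm_le_norm_add_norm_sub' z x0
      rw [mem_ball, dist_eq_norm] at hz
      linarith
    refine ⟨v i, (h1 i).1.mono hb, fun z hz => ⟨h2 i z (hb hz), ?_⟩⟩
    have := (h1 i).2 z (hb hz)
    rwa [← hM0, zero_mul, sub_zero] at this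
  set S : Set ℝ := {ρ | 0 ≤ ρ ∧ Good V ρ} with hS
  have hαS : α ∈ S := ⟨hα0.le, C, fun i x y _ => hV i x y⟩
  have hSb : BddBelow S := ⟨0, fun ρ h => h.1⟩
  set ρ0 := sInf S with hρ0
  have hρ00 : 0 ≤ ρ0 := le_csInf ⟨α, hαS⟩ fun ρ h => h.1
  have hρα : ρ0 ≤ α := csInf_le hSb hαS
  have hgt : ∀ δ, 0 < δ → Good V (ρ0 + δ) := fun δ hδ => by
    obtain ⟨a, ha, hlt⟩ := exists_lt_of_csInf_lt ⟨α, hαS⟩ (show sInf S < ρ0 + δ by linarith)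
    exact ha.2.mono hlt.le
  rcases hρ00.eq_or_lt with hz | hpos
  · have := h.const_of_good hA hp hM hVc (fun ρ hρ => by simpa [← hz] using hgt ρ hρ) i
    rw [this x, this y]
  exfalso
  have hlt : ∀ δ, 0 < δ → δ < ρ0 → ¬ Good V (ρ0 - δ) := fun δ hδ hδ' hG => by
    have := csInf_le hSb (⟨by linarith, hG⟩ : ρ0 - δ ∈ S)
    linarith
  set δ : ℕ → ℝ := fun n => (ρ0 / 2) * (1 / ((n:ℝ) + 1)) with hδ
  have hinv : Tendsto (fun n : ℕ => 1 / ((n:ℝ) + 1)) atTop (𝓝 0) := tendsto_one_div_add_atTop_nhds_zero_nat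
  have hle1 : ∀ n : ℕ, 1 / ((n:ℝ) + 1) ≤ 1 := fun n => by
    rw [div_le_one (by positivity)]
    have : (0:ℝ) ≤ n := Nat.cast_nonneg n
    linarith
  have hδ0 : ∀ n, 0 < δ n := fun n => by simp only [hδ]; positivity
  have hδ1 : ∀ n, δ n ≤ ρ0 / 2 := fun n => by
    simp only [hδ]
    have := hle1 n
    nlinarith
  have hn1 : ∀ n : ℕ, (1:ℝ) ≤ n + 1 := fun n => by
    have : (0:ℝ) ≤ n := Nat.cast_nonneg n
    linarith
  have hst := fun n : ℕ => h.step hM0 hp (hδ0 n) (by linarith [hδ1 n]) (by linarith [hδ1 n]) hρα hV hC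
    (hgt _ (hδ0 n)) (hlt _ (hδ0 n) (by linarith [hδ1 n])) (hn1 n)
  choose v m hm has hosc hbig using hst
  have hεt : Tendsto (fun n : ℕ => 2 / ((n:ℝ) + 1)) atTop (𝓝 0) := by
    have := hinv.const_mul 2
    rw [mul_zero] at this
    refine this.congr fun n => by ring
  have hge : ∀ R : ℝ, ∀ᶠ n : ℕ in hyperfilter ℕ, R ≤ (n:ℝ) + 1 := fun R => by
    refine Nat.hyperfilter_le_atTop ?_
    filter_upwards [tendsto_natCast_atTop_atTop.eventually_ge_atTop R] with n hn
    linarith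
  have hblow : Blow (hyperfilter ℕ) A p 2 ρ0 δ (fun n : ℕ => 2 / ((n:ℝ) + 1)) m v := by
    refine ⟨fun n => le_trans (by positivity) (hm n), fun n => by positivity,
      hεt.mono_left Nat.hyperfilter_le_atTop, ?_, fun R => ?_, fun R => ?_⟩
    · have := hinv.const_mul (ρ0 / 2)
      rw [mul_zero] at this
      exact this.mono_left Nat.hyperfilter_le_atTop
    · filter_upwards [hge R] with n hn
      exact (has n).mono le_rfl (ball_subset_ball hn)
    · filter_upwards [hge R] with n hn i x hx y hy
      exact hosc n i x (ball_subset_ball hn hx) y (ball_subset_ball hn hy)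
  have hflat := hblow.flat_Minf hA hp hpos (by linarith) (by norm_num) (by
    refine Tendsto.mono_left ?_ Nat.hyperfilter_le_atTop
    refine tendsto_atTop_mono hm (Tendsto.const_mul_atTop hM0 ?_)
    refine (tendsto_rpow_atTop (by linarith : 0 < 2 * p)).comp ?_
    exact tendsto_atTop_add_const_right _ _ tendsto_natCast_atTop_atTop)
  obtain ⟨n, h1, h2⟩ := ((hflat (1/4) (by norm_num)).and (hge 8)).exists
  obtain ⟨i, x, hx, hb⟩ := hbig n
  have := h1 i x hx
  have h3 : 2 / ((n:ℝ) + 1) ≤ 1 / 4 := by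
    rw [div_le_iff₀ (by linarith)]; linarith
  linarith

/-- Proposition Y -/
theorem Blow.flat {l : Ultrafilter ℕ} {C0 ρ : ℝ} {δ ε M : ℕ → ℝ} {v : ℕ → Fin d → Eu N → ℝ}
    (hA : CplOK A g) (hp : 0 < p) (h : Blow l A p C0 ρ δ ε M v) (hρ : 0 < ρ) (hρ1 : ρ < 1)
    (hC0 : 0 ≤ C0) : Flat l v := by
  by_cases hB : ∃ B : ℝ, ∀ᶠ n in (l : Filter ℕ), ∀ i, |v n i 0| ≤ B
  swap
  · refine h.flat_inf hA hp hρ hρ1 hC0 fun B => ?_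
    push Not at hB
    exact hB B
  by_cases hM : ∃ K : ℝ, ∀ᶠ n in (l : Filter ℕ), M n ≤ K
  swap
  · refine h.flat_Minf hA hp hρ hρ1 hC0 (tendsto_atTop.2 fun K => ?_)
    push Not at hM
    exact (hM K).mono fun n hn => hn.le
  obtain ⟨B, hB⟩ := hB
  obtain ⟨K, hM⟩ := hM
  obtain ⟨V, h2, h3⟩ := h.limit hρ hC0 (z := fun n i => 0) (B := B) (by simpa using hB)
  have hVc : ∀ i, Continuous (V i) := fun i => mod_cont (pow_mod hρ) (h3 i)
  obtain ⟨m, hm0, hm⟩ : ∃ m ∈ Icc 0 K, Tendsto M l (𝓝 m) := by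
    have h2 : ((l.map M : Ultrafilter ℝ) : Filter ℝ) ≤ 𝓟 (Icc 0 K) := by
      rw [le_principal_iff, Ultrafilter.mem_coe, Ultrafilter.mem_map]
      exact hM.mono fun n hn => ⟨h.M0 n, hn⟩
    obtain ⟨a, ha, ha'⟩ := isCompact_Icc.ultrafilter_le_nhds _ h2
    exact ⟨a, ha, ha'⟩
  refine flat_of_const h2 (thm2 hA hp hm0.1 hρ hρ1 hC0 h3 ?_)
  intro R η hη
  obtain ⟨B, hB0, hB⟩ := exists_bd hVc R
  set Q := (∑ k, ∑ j, |A k j|) * ((B + 1) ^ p * (B + 1) ^ (p + 1)) with hQ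
  have hev : ∀ᶠ n in (l : Filter ℕ), ε n + |M n - m| * Q < η := by
    have := h.εt.add (((hm.sub_const m).abs).mul_const Q)
    rw [sub_self, abs_zero, zero_mul, add_zero] at this
    exact this.eventually (gt_mem_nhds hη)
  obtain ⟨n, a1, a2, a3, a4⟩ := ((h.as R).and <| (h2 R η hη).and <| (h2 R 1 one_pos).and hev).exists
  refine ⟨v n, fun i => ⟨(a1 i).1, fun x hx => ?_⟩, fun i x hx => by simpa using a2 i x hx⟩
  have b1 := (a1 i).2 x hx
  have b2 := abs_coup_le A hp (fun j => v n j x) (B := B + 1) (fun j => by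
    have c1 := a3 j x hx
    rw [sub_zero] at c1
    have c2 := hB j x (ball_subset_closedBall hx)
    have c3 := abs_sub_abs_le_abs_sub (v n j x) (V j x)
    linarith) i
  have b3 : |(M n - m) * coup A p (fun j => v n j x) i| ≤ |M n - m| * Q := by
    rw [abs_mul]; gcongr
  have e : lapl (v n i) x - m * coup A p (fun j => v n j x) i
      = (lapl (v n i) x - M n * coup A p (fun j => v n j x) i) + (M n - m) * coup A p (fun j => v n j x) i := by ring
  rw [e]
  refine (abs_add_le _ _).trans ?_
  linarith

end

end

section

/-- the blow-up step at level `n` -/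
lemma blow_core {N d : ℕ} {A : Fin d → Fin d → ℝ} {p : ℝ} {U : Set (Eu N)}
    (hU : IsOpen U) {dd : Eu N → ℝ} (hdU : ∀ x, 0 < dd x ↔ x ∈ U) (hd1 : ∀ x, dd x ≤ 1)
    (hdl : ∀ x y, dd x - dd y ≤ dist x y) {Dm : ℝ} (hDm : 1 ≤ Dm)
    (hD : ∀ x ∈ U, ∀ y ∈ U, dist x y ≤ Dm) {β Cf M α n : ℝ} (hβ : 0 ≤ β) (hCf : 0 ≤ Cf) (hM : 0 < M)
    (hα0 : 0 < α) (hα1 : α < 1) (hn : 0 < n) {u : Fin d → Eu N → ℝ}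
    (has : ASOn A p β Cf U u) (hb : ∀ i, ∀ x ∈ U, |u i x| ≤ M) {L : ℝ} (hL0 : 0 ≤ L)
    (hL : ∀ i, ∀ x ∈ U, ∀ y ∈ U, |u i x - u i y| ≤ L * dist x y)
    {i0 : Fin d} {x0 y0 : Eu N} (hx0 : x0 ∈ U) (hy0 : y0 ∈ U)
    (h0 : n * dist x0 y0 ^ α < min (dd x0) (dd y0) ^ α * |u i0 x0 - u i0 y0|) :
    ∃ (v : Fin d → Eu N → ℝ) (M' : ℝ), 0 ≤ M' ∧
      ASOn A p M' (Cf * (2 * Dm ^ (2 - α)) / n) (ball 0 ((n / (4 * M)) ^ (1 / α) / 2)) v ∧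
      (∀ i, ∀ x ∈ ball (0 : Eu N) ((n / (4 * M)) ^ (1 / α) / 2),
        ∀ y ∈ ball (0 : Eu N) ((n / (4 * M)) ^ (1 / α) / 2), |v i x - v i y| ≤ 4 * dist x y ^ α) ∧
      ∃ i, ∃ y ∈ closedBall (0 : Eu N) 1, |v i y - v i 0| = 1 := by
  let T := {t : Fin d × Eu N × Eu N // t.2.1 ∈ U ∧ t.2.2 ∈ U ∧ t.2.1 ≠ t.2.2}
  let F : T → ℝ := fun t => min (dd t.1.2.1) (dd t.1.2.2) ^ α * |u t.1.1 t.1.2.1 - u t.1.1 t.1.2.2|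
    / dist t.1.2.1 t.1.2.2 ^ α
  have hxy0 : x0 ≠ y0 := by
    rintro rfl
    rw [sub_self, abs_zero, mul_zero, dist_self, Real.zero_rpow hα0.ne', mul_zero] at h0
    exact lt_irrefl _ h0
  have hw0 : ∀ {x y}, x ∈ U → y ∈ U → 0 < min (dd x) (dd y) := fun hx hy =>
    lt_min ((hdU _).2 hx) ((hdU _).2 hy)
  have hbd : ∀ t, F t ≤ L * Dm ^ (1 - α) := by
    rintro ⟨⟨i, x, y⟩, hx, hy, hxy⟩
    simp only at hx hy hxy
    show min (dd x) (dd y) ^ α * |u i x - u i y| / dist x y ^ α ≤ _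
    have hr : 0 < dist x y := dist_pos.2 hxy
    rw [div_le_iff₀ (by positivity)]
    have a1 : min (dd x) (dd y) ^ α ≤ 1 :=
      Real.rpow_le_one (hw0 hx hy).le ((min_le_left _ _).trans (hd1 x)) hα0.le
    have a2 : dist x y = dist x y ^ (1 - α) * dist x y ^ α := by
      rw [← Real.rpow_add hr]; simp
    have a3 : dist x y ^ (1 - α) ≤ Dm ^ (1 - α) :=
      Real.rpow_le_rpow hr.le (hD x hx y hy) (by linarith)
    calc _ ≤ 1 * |u i x - u i y| := by gcongr
      _ ≤ L * dist x y := by rw [one_mul]; exact hL i x hx y hy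
      _ = L * (dist x y ^ (1 - α) * dist x y ^ α) := by rw [← a2]
      _ ≤ L * (Dm ^ (1 - α) * dist x y ^ α) := by gcongr
      _ = _ := by ring
  have hBdd : BddAbove (range F) := ⟨_, by rintro _ ⟨t, rfl⟩; exact hbd t⟩
  let t0 : T := ⟨(i0, x0, y0), hx0, hy0, hxy0⟩
  have ht0 : n < F t0 := by
    show n < min (dd x0) (dd y0) ^ α * |u i0 x0 - u i0 y0| / dist x0 y0 ^ α
    rw [lt_div_iff₀ (Real.rpow_pos_of_pos (dist_pos.2 hxy0) _)]; exact h0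
  have hS : n < ⨆ t, F t := ht0.trans_le (le_ciSup hBdd t0)
  haveI : Nonempty T := ⟨t0⟩
  obtain ⟨t1, ht1⟩ := exists_lt_of_lt_ciSup (show (⨆ t, F t) / 2 < ⨆ t, F t by linarith)
  have hmax : ∀ t, F t ≤ 2 * F t1 := fun t => (le_ciSup hBdd t).trans (by linarith)
  have hn1 : n / 2 < F t1 := by linarith
  obtain ⟨⟨i, x, y⟩, hx, hy, hxy⟩ := t1
  simp only at hx hy hxy
  have hF1 : F ⟨(i, x, y), hx, hy, hxy⟩ = min (dd x) (dd y) ^ α * |u i x - u i y| / dist x y ^ α := rfl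
  rw [hF1] at hmax hn1
  have hw := hw0 hx hy
  set w := min (dd x) (dd y) with hwdef
  have hr : 0 < dist x y := dist_pos.2 hxy
  set r := dist x y with hrdef
  set σ := |u i x - u i y| with hσdef
  have hrα : 0 < r ^ α := by positivity
  have hwα : 0 < w ^ α := by positivity
  have hw1 : w ^ α ≤ 1 := Real.rpow_le_one hw.le ((min_le_left _ _).trans (hd1 x)) hα0.le
  rw [lt_div_iff₀ hrα] at hn1
  have hσ : 0 < σ := by
    by_contra hc
    have : w ^ α * σ ≤ 0 := mul_nonpos_of_nonneg_of_nonpos hwα.le (not_lt.1 hc)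
    have : 0 < n / 2 * r ^ α := by positivity
    linarith
  have hσM : σ ≤ 2 * M := by
    have a1 := hb i x hx
    have a2 := hb i y hy
    rw [hσdef]
    rw [abs_le] at a1 a2 ⊢
    constructor <;> linarith [a1.1, a1.2, a2.1, a2.2]
  have hR : (n / (4 * M)) ^ (1 / α) ≤ w / r := by
    have a1 : n / (4 * M) ≤ (w / r) ^ α := by
      rw [Real.div_rpow hw.le hr.le, div_le_div_iff₀ (by positivity) hrα]
      have : w ^ α * σ ≤ w ^ α * (2 * M) := by gcongr
      linarith
    calc (n / (4 * M)) ^ (1 / α) ≤ ((w / r) ^ α) ^ (1 / α) :=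
          Real.rpow_le_rpow (by positivity) a1 (by positivity)
      _ = w / r := by
          rw [← Real.rpow_mul (by positivity), mul_one_div_cancel hα0.ne', Real.rpow_one]
  set R := (n / (4 * M)) ^ (1 / α) / 2 with hRdef
  have hRr : R * r ≤ w / 2 := by
    rw [le_div_iff₀ hr] at hR
    rw [hRdef]; linarith
  have hdin : ∀ z ∈ ball (0 : Eu N) R, w / 2 ≤ dd (x + r • z) := by
    intro z hz
    rw [mem_ball_zero_iff] at hz
    have a1 := hdl x (x + r • z)
    have a2 : dist x (x + r • z) = r * ‖z‖ := by
      rw [dist_self_add_right, norm_smul, Real.norm_eq_abs, abs_of_pos hr]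
    have a3 : r * ‖z‖ ≤ r * R := by gcongr
    have a4 : w ≤ dd x := min_le_left _ _
    rw [a2] at a1
    linarith
  have hin : ∀ z ∈ ball (0 : Eu N) R, x + r • z ∈ U := fun z hz =>
    (hdU _).1 (by linarith [hdin z hz])
  refine ⟨fun i z => u i (x + r • z) / σ, β * r ^ 2 * σ ^ (2 * p), by positivity, ?_, ?_, ?_⟩
  · refine (has.rescale hU x r hσ hin).mono ?_ subset_rfl
    rw [div_le_div_iff₀ hσ hn, mul_assoc, mul_assoc]
    refine mul_le_mul_of_nonneg_left ?_ hCf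
    have a2 : r ^ 2 = r ^ (2 - α) * r ^ α := by
      rw [← Real.rpow_add hr, ← Real.rpow_two]; congr 1; ring
    have a3 : r ^ (2 - α) ≤ Dm ^ (2 - α) := Real.rpow_le_rpow hr.le (hD x hx y hy) (by linarith)
    have a4 : w ^ α * σ ≤ 1 * σ := by gcongr
    calc r ^ 2 * n = r ^ (2 - α) * (2 * (n / 2 * r ^ α)) := by rw [a2]; ring
      _ ≤ Dm ^ (2 - α) * (2 * σ) := by gcongr; linarith
      _ = _ := by ring
  · intro j z hz z' hz'
    simp only
    by_cases hzz : z = z'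
    · subst hzz; rw [sub_self, abs_zero, dist_self, Real.zero_rpow hα0.ne', mul_zero]
    have hd : dist (x + r • z) (x + r • z') = r * dist z z' := by
      rw [dist_add_left, dist_smul₀, Real.norm_eq_abs, abs_of_pos hr]
    have hz0 : 0 < dist z z' := dist_pos.2 hzz
    have hne : x + r • z ≠ x + r • z' := by
      rw [← dist_pos, hd]; positivity
    have a1 := hmax ⟨(j, x + r • z, x + r • z'), hin z hz, hin z' hz', hne⟩
    have a2 : F ⟨(j, x + r • z, x + r • z'), hin z hz, hin z' hz', hne⟩
      = min (dd (x + r • z)) (dd (x + r • z')) ^ α * |u j (x + r • z) - u j (x + r • z')|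
        / dist (x + r • z) (x + r • z') ^ α := rfl
    rw [a2, hd, Real.mul_rpow hr.le hz0.le] at a1
    have hm : (w / 2) ^ α ≤ min (dd (x + r • z)) (dd (x + r • z')) ^ α :=
      Real.rpow_le_rpow (by positivity) (le_min (hdin z hz) (hdin z' hz')) hα0.le
    have hzα : 0 < dist z z' ^ α := by positivity
    have h2 : (2:ℝ) ^ α ≤ 2 := by
      conv_rhs => rw [← Real.rpow_one 2]
      exact Real.rpow_le_rpow_of_exponent_le (by norm_num) hα1.le
    have h2p : 0 < (2:ℝ) ^ α := by positivity
    rw [div_le_iff₀ (by positivity)] at a1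
    have a3 : w ^ α / 2 * |u j (x + r • z) - u j (x + r • z')| ≤ 2 * (w ^ α * σ) * dist z z' ^ α := by
      calc _ ≤ (w / 2) ^ α * |u j (x + r • z) - u j (x + r • z')| := by
            rw [Real.div_rpow hw.le (by norm_num)]; gcongr
        _ ≤ min (dd (x + r • z)) (dd (x + r • z')) ^ α * |u j (x + r • z) - u j (x + r • z')| := by gcongr
        _ ≤ _ := a1
        _ = _ := by field_simp
    rw [← sub_div, abs_div, abs_of_pos hσ, div_le_iff₀ hσ]
    refine le_of_mul_le_mul_left ?_ hwα
    linarith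
  · refine ⟨i, r⁻¹ • (y - x), ?_, ?_⟩
    · rw [mem_closedBall_zero_iff, norm_smul, norm_inv, Real.norm_eq_abs, abs_of_pos hr, ← dist_eq_norm,
        dist_comm, ← hrdef, inv_mul_cancel₀ hr.ne']
    · show |u i (x + r • r⁻¹ • (y - x)) / σ - u i (x + r • (0 : Eu N)) / σ| = 1
      rw [smul_smul, mul_inv_cancel₀ hr.ne', one_smul, smul_zero, add_zero, add_sub_cancel, ← sub_div, abs_div,
        abs_of_pos hσ, abs_sub_comm, ← hσdef, div_self hσ.ne']

end

/-- the abstract uniform bound -/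
lemma unif_bound {N d : ℕ} {A : Fin d → Fin d → ℝ} {g : Fin d → ℕ} (hA : CplOK A g) {p : ℝ} (hp : 0 < p)
    {U : Set (Eu N)}
    (hU : IsOpen U) {dd : Eu N → ℝ} (hdU : ∀ x, 0 < dd x ↔ x ∈ U) (hd1 : ∀ x, dd x ≤ 1)
    (hdl : ∀ x y, dd x - dd y ≤ dist x y) {Dm : ℝ} (hDm : 1 ≤ Dm)
    (hD : ∀ x ∈ U, ∀ y ∈ U, dist x y ≤ Dm) {Cf M α : ℝ} (hCf : 0 ≤ Cf) (hM : 0 < M)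
    (hα0 : 0 < α) (hα1 : α < 1) {u : ℝ → Fin d → Eu N → ℝ}
    (has : ∀ β, 0 < β → ASOn A p β Cf U (u β)) (hb : ∀ β, 0 < β → ∀ i, ∀ x ∈ U, |u β i x| ≤ M)
    (hL : ∀ β, 0 < β → ∃ L : ℝ, 0 ≤ L ∧ ∀ i, ∀ x ∈ U, ∀ y ∈ U, |u β i x - u β i y| ≤ L * dist x y) :
    ∃ n : ℝ, 0 < n ∧ ∀ β, 0 < β → ∀ i, ∀ x ∈ U, ∀ y ∈ U,
      min (dd x) (dd y) ^ α * |u β i x - u β i y| ≤ n * dist x y ^ α := by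
  by_contra hcon
  push Not at hcon
  have key : ∀ n : ℕ, ∃ (v : Fin d → Eu N → ℝ) (M' : ℝ), 0 ≤ M' ∧
      ASOn A p M' (Cf * (2 * Dm ^ (2 - α)) / ((n : ℝ) + 1)) (ball 0 ((((n : ℝ) + 1) / (4 * M)) ^ (1 / α) / 2)) v ∧
      (∀ i, ∀ x ∈ ball (0 : Eu N) ((((n : ℝ) + 1) / (4 * M)) ^ (1 / α) / 2),
        ∀ y ∈ ball (0 : Eu N) ((((n : ℝ) + 1) / (4 * M)) ^ (1 / α) / 2), |v i x - v i y| ≤ 4 * dist x y ^ α) ∧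
      ∃ i, ∃ y ∈ closedBall (0 : Eu N) 1, |v i y - v i 0| = 1 := by
    intro n
    obtain ⟨β, hβ, i, x, hx, y, hy, h⟩ := hcon ((n : ℝ) + 1) (by positivity)
    obtain ⟨L, hL0, hL⟩ := hL β hβ
    exact blow_core hU hdU hd1 hdl hDm hD hβ.le hCf hM hα0 hα1 (by positivity) (has β hβ) (hb β hβ) hL0 hL
      hx hy h
  choose v M' h1 h2 h3 h4 using key
  have hDm0 : 0 < Dm := by linarith
  have hnt : Tendsto (fun n : ℕ => (n : ℝ) + 1) atTop atTop :=
    tendsto_atTop_add_const_right _ _ tendsto_natCast_atTop_atTop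
  have hRt : Tendsto (fun n : ℕ => (((n : ℝ) + 1) / (4 * M)) ^ (1 / α) / 2) atTop atTop :=
    ((tendsto_rpow_atTop (by positivity)).comp (hnt.atTop_div_const (by positivity))).atTop_div_const (by norm_num)
  let l : Ultrafilter ℕ := hyperfilter ℕ
  have hl : (l : Filter ℕ) ≤ atTop := Nat.hyperfilter_le_atTop
  have hblow : Blow l A p 4 α (fun _ => 0) (fun n => Cf * (2 * Dm ^ (2 - α)) / ((n : ℝ) + 1)) M' v :=
    { M0 := h1
      ε0 := fun n => by positivity
      εt := (tendsto_const_nhds.div_atTop hnt).mono_left hl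
      δt := tendsto_const_nhds
      as := fun R => by
        filter_upwards [hl (hRt.eventually_ge_atTop R)] with n hn
        exact (h2 n).mono le_rfl (ball_subset_ball hn)
      osc := fun R => by
        filter_upwards [hl (hRt.eventually_ge_atTop R)] with n hn i x hx y hy
        rw [sub_zero, add_zero, max_self]
        have := h3 n i x (ball_subset_ball hn hx) y (ball_subset_ball hn hy)
        have h0 : 0 ≤ Cf * (2 * Dm ^ (2 - α)) / ((n : ℝ) + 1) := by positivity
        linarith }
  have hfl := hblow.flat hA hp hα0 hα1 (by norm_num) (1 / 2) (by norm_num)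
  obtain ⟨n, hn⟩ := hfl.exists
  obtain ⟨i, y, hy, h⟩ := h4 n
  have := hn i y hy
  rw [h] at this
  norm_num at this

lemma Decomp.exists_mem {d m : ℕ} (D : Decomp d m) (i : Fin d) : ∃ h, D.mem h i := by
  by_contra hc
  push Not at hc
  have : ∀ k : ℕ, ∀ hk : k < m + 1, D.pts ⟨k, hk⟩ ≤ (i : ℕ) := by
    intro k
    induction k with
    | zero =>
      intro hk
      have : D.pts ⟨0, hk⟩ = 0 := D.zero
      omega
    | succ k ih =>
      intro hk
      have h1 := ih (by omega)
      have h2 := hc ⟨k, by omega⟩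
      by_contra h3
      exact h2 ⟨h1, not_le.1 h3⟩
  have h1 := this m (by omega)
  have h2 : D.pts ⟨m, by omega⟩ = d := D.last
  have := i.2
  omega

lemma CoefOK.cpl {d m : ℕ} {D : Decomp d m} {A : Fin d → Fin d → ℝ} (hA : CoefOK D A) :
    ∃ g : Fin d → ℕ, CplOK A g := by
  choose h hh using D.exists_mem
  refine ⟨fun i => (h i : ℕ), hA.1, fun i j hij hg => ?_, fun i j hg => ?_⟩
  · have : h i = h j := Fin.ext hg
    exact hA.2.1 i j hij ⟨h i, hh i, this ▸ hh j⟩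
  · exact hA.2.2 i j ⟨h i, h j, fun e => hg (by rw [e]), hh i, hh j⟩

lemma HypH.bound {N d m : ℕ} {D : Decomp d m} {Ω : Set (EuclideanSpace ℝ (Fin N))} {p : ℝ} (hp : 0 < p)
    {f : ℝ → Fin d → EuclideanSpace ℝ (Fin N) → (Fin d → ℝ) → ℝ} (hf : HypH D Ω p f)
    {u : ℝ → Fin d → EuclideanSpace ℝ (Fin N) → ℝ} {M : ℝ}
    (hbdd : ∀ β : ℝ, 0 < β → ∀ i : Fin d, ∀ x ∈ Ω, |u β i x| ≤ M)
    {K : Set (EuclideanSpace ℝ (Fin N))} (hK : IsCompact K) (hKΩ : K ⊆ Ω) :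
    ∃ C : ℝ, 0 ≤ C ∧ ∀ β : ℝ, 0 < β → ∀ i, ∀ x ∈ K, |f β i x (fun j => u β j x)| ≤ C := by
  unfold HypH at hf
  split_ifs at hf with h1
  · obtain ⟨C, hC⟩ := hf (K ×ˢ (Set.pi univ fun _ => Icc (-M) M))
      (hK.prod (isCompact_univ_pi fun _ => isCompact_Icc)) (fun z hz => hKΩ hz.1)
    refine ⟨|C|, abs_nonneg _, fun β hβ i x hx => (hC β hβ i (x, fun j => u β j x) ⟨hx, fun j _ => ?_⟩).trans
      (le_abs_self _)⟩
    exact abs_le.1 (hbdd β hβ j x (hKΩ hx))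
  · obtain ⟨C, hC⟩ := hf K hK hKΩ
    refine ⟨|C| * ∑ j : Fin d, |M| ^ p, by positivity, fun β hβ i x hx => ?_⟩
    obtain ⟨h, hh⟩ := D.exists_mem i
    calc _ ≤ C * ∑ j ∈ D.grpSet h, |u β j x| ^ p := hC β hβ h i hh x hx _
      _ ≤ |C| * ∑ j ∈ D.grpSet h, |u β j x| ^ p := by gcongr; exact le_abs_self _
      _ ≤ |C| * ∑ j : Fin d, |u β j x| ^ p := by
          gcongr
          exact Finset.subset_univ _
      _ ≤ _ := by
          refine mul_le_mul_of_nonneg_left (Finset.sum_le_sum fun j _ => ?_) (abs_nonneg _)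
          exact Real.rpow_le_rpow (abs_nonneg _) ((hbdd β hβ j x (hKΩ hx)).trans (le_abs_self _)) hp.le

lemma lip_compact {N : ℕ} {Ω K : Set (Eu N)} (hΩ : IsOpen Ω) (hK : IsCompact K) (hKΩ : K ⊆ Ω) {w : Eu N → ℝ}
    (hw : ContDiffOn ℝ 2 w Ω) : ∃ L : ℝ, 0 ≤ L ∧ ∀ x ∈ K, ∀ y ∈ K, |w x - w y| ≤ L * dist x y := by
  have h : LocallyLipschitzOn K w := by
    intro x hx
    have := (hw.contDiffAt (hΩ.mem_nhds (hKΩ hx))).of_le (m := 1) (by norm_num)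
    obtain ⟨L, t, ht, hL⟩ := this.exists_lipschitzOnWith
    exact ⟨L, t, mem_nhdsWithin_of_mem_nhds ht, hL⟩
  obtain ⟨L, hL⟩ := h.exists_lipschitzOnWith_of_compact hK
  refine ⟨L, L.2, fun x hx y hy => ?_⟩
  have := hL.dist_le_mul x hx y hy
  rwa [Real.dist_eq] at this

/-- interior uniform `C^{0,α}` bounds for uniformly `L^∞`-bounded families of
solutions of the system `(S_β)` under hypothesis (H). -/
theorem stmt0
    (N d m : ℕ) (hN : 1 ≤ N) (hd : 2 ≤ d) (hm1 : 1 ≤ m) (hm : m ≤ d)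
    (D : Decomp d m) (p : ℝ) (hp : 0 < p)
    (Ω : Set (EuclideanSpace ℝ (Fin N))) (hΩ : IsOpen Ω)
    (A : Fin d → Fin d → ℝ) (hA : CoefOK D A)
    (f : ℝ → Fin d → EuclideanSpace ℝ (Fin N) → (Fin d → ℝ) → ℝ)
    (hf : HypH D Ω p f)
    (u : ℝ → Fin d → EuclideanSpace ℝ (Fin N) → ℝ)
    (hu : SolSys Ω p A f u)
    (M : ℝ) (hbdd : ∀ β : ℝ, 0 < β → ∀ i : Fin d, ∀ x ∈ Ω, |u β i x| ≤ M)
    (Ω' : Set (EuclideanSpace ℝ (Fin N))) (hΩ' : IsOpen Ω')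
    (hcc : IsCompact (closure Ω')) (hsub : closure Ω' ⊆ Ω)
    (α : ℝ) (hα : α ∈ Set.Ioo (0:ℝ) 1) :
    ∃ C : ℝ, 0 < C ∧ ∀ β : ℝ, 0 < β → ∀ i : Fin d,
      (∀ x ∈ Ω', |u β i x| ≤ C) ∧
      ∀ x ∈ Ω', ∀ y ∈ Ω', |u β i x - u β i y| ≤ C * dist x y ^ α := by
  rcases Ω'.eq_empty_or_nonempty with he | hne
  · exact ⟨1, one_pos, fun β _ i => ⟨fun x hx => by simp [he] at hx, fun x hx => by simp [he] at hx⟩⟩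
  obtain ⟨g, hg⟩ := hA.cpl
  obtain ⟨δ1, hδ1, hK1⟩ := hcc.exists_cthickening_subset_open hΩ hsub
  set δ := min δ1 1 with hδdef
  have hδ : 0 < δ := lt_min hδ1 one_pos
  set K := cthickening δ (closure Ω') with hKdef
  have hKΩ : K ⊆ Ω := (cthickening_mono (min_le_left _ _) _).trans hK1
  have hK : IsCompact K := hcc.cthickening
  obtain ⟨Cf, hCf, hCfb⟩ := hf.bound hp hbdd hK hKΩ
  set U := thickening δ (closure Ω') with hUdef
  have hUK : U ⊆ K := thickening_subset_cthickening _ _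
  have hne' : (closure Ω').Nonempty := hne.closure
  have hbd : Bornology.IsBounded K := hK.isBounded
  have key := unif_bound (u := u) (U := U) (dd := fun x => δ - infDist x (closure Ω')) (Dm := max (diam K) 1)
    (Cf := Cf) (M := |M| + 1) (α := α) hg hp isOpen_thickening (fun x => ?_) (fun x => ?_) (fun x y => ?_) (le_max_right _ _)
    (fun x hx y hy => (dist_le_diam_of_mem hbd (hUK hx) (hUK hy)).trans (le_max_left _ _))
    hCf (by positivity) hα.1 hα.2 (fun β hβ i => ⟨?_, fun x hx => ?_⟩) (fun β hβ i x hx => ?_) (fun β hβ => ?_)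
  · obtain ⟨n, hn, hkey⟩ := key
    refine ⟨|M| + 1 + n / δ ^ α, by positivity, fun β hβ i => ⟨fun x hx => ?_, fun x hx y hy => ?_⟩⟩
    · have a1 := hbdd β hβ i x (hsub (subset_closure hx))
      have a2 := le_abs_self M
      have a3 : 0 < n / δ ^ α := by positivity
      linarith
    · have hU' : ∀ z ∈ Ω', z ∈ U := fun z hz => self_subset_thickening hδ _ (subset_closure hz)
      have a1 := hkey β hβ i x (hU' x hx) y (hU' y hy)
      simp only [infDist_zero_of_mem (subset_closure hx), infDist_zero_of_mem (subset_closure hy), sub_zero,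
        min_self] at a1
      have a2 : 0 < δ ^ α := by positivity
      have a3 : |u β i x - u β i y| ≤ n / δ ^ α * dist x y ^ α := by
        rw [div_mul_eq_mul_div, le_div_iff₀ a2]; linarith
      refine a3.trans ?_
      gcongr
      linarith [abs_nonneg M]
  · rw [hUdef, mem_thickening_iff_infDist_lt hne', sub_pos]
  · have := infDist_nonneg (x := x) (s := closure Ω')
    have : δ ≤ 1 := min_le_right _ _
    linarith
  · have := infDist_le_infDist_add_dist (s := closure Ω') (x := y) (y := x)
    rw [dist_comm] at this
    linarith
  · exact ((hu β hβ i).1).mono (hUK.trans hKΩ)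
  · have a1 := (hu β hβ i).2 x (hKΩ (hUK hx))
    have a2 := hCfb β hβ i x (hUK hx)
    rw [coup]
    rw [show lapl (u β i) x - β * ∑ j ∈ Finset.univ.erase i,
      A i j * u β i x * |u β i x| ^ (p - 1) * |u β j x| ^ (p + 1) = - f β i x (fun j => u β j x) by linarith, abs_neg]
    exact a2
  · have a1 := hbdd β hβ i x (hKΩ (hUK hx))
    linarith [le_abs_self M]
  · choose L hL0 hL using fun i => lip_compact hΩ hK hKΩ (hu β hβ i).1
    refine ⟨∑ i, L i, Finset.sum_nonneg fun i _ => hL0 i, fun i x hx y hy => (hL i x (hUK hx) y (hUK hy)).trans ?_⟩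
    gcongr
    exact Finset.single_le_sum (fun j _ => hL0 j) (Finset.mem_univ i)

end
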